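/- Stability estimate for outgoing solutions (Lemma 4.2, sup-norm form). Fix R > M. There exists a constant c > 0, depending only on f, L, k, θ and R, such that: for every ε > 0 and every function w that is continuous on the closure of D, twice continuously differentiable in D, quasiperiodic, outgoing, satisfies Δw + k²w = 0 in D, and has boundary norm (∫_{S_L} |w|² ds)^{1/2} ≤ ε, one has |w(x,y)| ≤ c ε for every (x,y) ∈ D with y ≥ R. -/

import Mathlib

open MeasureTheory

/-- The Picard iterates of the linear differential equation `u' = A u`, `u 0 = x₀`. -/
noncomputable def linearPicard {E : Type*} [NormedAddCommGroup E] [NormedSpace ℝ E]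
    (A : ℝ → E →L[ℝ] E) (x₀ : E) : ℕ → ℝ → E
  | 0 => fun _ => x₀
  | n + 1 => fun t => ∫ s in (0 : ℝ)..t, A s (linearPicard A x₀ n s)

theorem continuous_linearPicard {E : Type*} [NormedAddCommGroup E] [NormedSpace ℝ E]
    [CompleteSpace E] {A : ℝ → E →L[ℝ] E} (hA : Continuous A) (x₀ : E) (n : ℕ) :
    Continuous (linearPicard A x₀ n) := by
  induction n with
  | zero => exact continuous_const
  | succ n ih =>
    have h : Continuous fun s => A s (linearPicard A x₀ n s) := hA.clm_apply ih
    exact continuous_iff_continuousAt.2 fun t =>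
      (h.integral_hasStrictDerivAt 0 t).hasDerivAt.continuousAt

theorem norm_linearPicard_le {E : Type*} [NormedAddCommGroup E] [NormedSpace ℝ E]
    {A : ℝ → E →L[ℝ] E} {K : ℝ} (hK : ∀ t, ‖A t‖ ≤ K) (x₀ : E) (n : ℕ) (t : ℝ) :
    ‖linearPicard A x₀ n t‖ ≤ ‖x₀‖ * ((K * |t|) ^ n / n.factorial) := by
  have hK0 : 0 ≤ K := (norm_nonneg _).trans (hK 0)
  induction n generalizing t with
  | zero => simp [linearPicard]
  | succ n ih =>
    have hb : ∀ s, ‖A s (linearPicard A x₀ n s)‖ ≤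
        ‖x₀‖ * K ^ (n + 1) / n.factorial * |s - 0| ^ n := fun s => by
      calc ‖A s (linearPicard A x₀ n s)‖ ≤ K * (‖x₀‖ * ((K * |s|) ^ n / n.factorial)) :=
            (A s).le_of_opNorm_le_of_le (hK s) (ih s)
        _ = _ := by rw [mul_pow, sub_zero]; ring
    have hint : IntervalIntegrable
        (fun s => ‖x₀‖ * K ^ (n + 1) / n.factorial * |s - 0| ^ n) volume 0 t :=
      Continuous.intervalIntegrable (by fun_prop) _ _
    calc ‖linearPicard A x₀ (n + 1) t‖
        ≤ |∫ s in (0 : ℝ)..t, ‖x₀‖ * K ^ (n + 1) / n.factorial * |s - 0| ^ n| :=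
          intervalIntegral.norm_integral_le_abs_of_norm_le (Filter.Eventually.of_forall hb) hint
      _ = |∫ s in Set.uIoc (0 : ℝ) t, ‖x₀‖ * K ^ (n + 1) / n.factorial * |s - 0| ^ n| :=
          intervalIntegral.abs_intervalIntegral_eq _ _ _ _
      _ = _ := by
          rw [integral_const_mul, integral_pow_abs_sub_uIoc, abs_of_nonneg (by positivity),
            Nat.factorial_succ, sub_zero, mul_pow]
          push_cast
          field_simp

theorem exists_linear_ode_solution {E : Type*} [NormedAddCommGroup E] [NormedSpace ℝ E]
    [CompleteSpace E] {A : ℝ → E →L[ℝ] E} (hA : Continuous A) {T : ℝ} (hT : 0 ≤ T) (x₀ : E) :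
    ∃ u : ℝ → E, u 0 = x₀ ∧ ∀ t ∈ Set.Icc 0 T, HasDerivAt u (A t (u t)) t := by
  let B : ℝ → E →L[ℝ] E := fun t => A (Set.projIcc 0 T hT t)
  have hB : Continuous B := hA.comp (continuous_subtype_val.comp continuous_projIcc)
  obtain ⟨K, hK⟩ : ∃ K, ∀ t, ‖B t‖ ≤ K := by
    obtain ⟨K, hK⟩ := (isCompact_Icc (a := (0 : ℝ)) (b := T)).exists_bound_of_continuousOn
      hA.continuousOn
    exact ⟨K, fun t => hK _ (Set.projIcc 0 T hT t).2⟩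
  have hK0 : 0 ≤ K := (norm_nonneg _).trans (hK 0)
  let v := linearPicard B x₀
  have hv : ∀ n, Continuous (v n) := continuous_linearPicard hB x₀
  have hsum : ∀ t, Summable fun n => v n t := fun t =>
    Summable.of_norm_bounded ((Real.summable_pow_div_factorial (K * |t|)).mul_left ‖x₀‖)
      fun n => norm_linearPicard_le hK x₀ n t
  have hsumB : ∀ r : ℝ, Summable fun n : ℕ => K * (‖x₀‖ * ((K * r) ^ n / n.factorial)) :=
    fun r => ((Real.summable_pow_div_factorial (K * r)).mul_left ‖x₀‖).mul_left K
  have hder : ∀ n t, HasDerivAt (v (n + 1)) (B t (v n t)) t := fun n t =>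
    ((hB.clm_apply (hv n)).integral_hasStrictDerivAt 0 t).hasDerivAt
  refine ⟨fun t => ∑' n, v n t, ?_, fun t ht => ?_⟩
  · change ∑' n, v n 0 = x₀
    rw [tsum_eq_single 0]
    · rfl
    · intro n hn
      obtain ⟨m, rfl⟩ := Nat.exists_eq_succ_of_ne_zero hn
      simp [v, linearPicard]
  · have hBt : B t = A t := by simp only [B, Set.projIcc_of_mem hT ht]
    have h1 : HasDerivAt (fun z => ∑' n, v (n + 1) z) (∑' n, B t (v n t)) t := by
      refine hasDerivAt_tsum_of_isPreconnected (hsumB (T + 1))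
        (isOpen_Ioo (a := -(T + 1)) (b := T + 1)) isPreconnected_Ioo
        (g' := fun n y => B y (v n y)) (fun n y _ => hder n y) (fun n y hy => ?_)
        (y₀ := t) ⟨by linarith [ht.1], by linarith [ht.2]⟩
        ((summable_nat_add_iff 1).2 (hsum t)) ⟨by linarith [ht.1], by linarith [ht.2]⟩
      refine (B y).le_of_opNorm_le_of_le (hK y) ((norm_linearPicard_le hK x₀ n y).trans ?_)
      have : |y| ≤ T + 1 := abs_le.2 ⟨hy.1.le, hy.2.le⟩
      gcongr
    have h2 : (fun z => ∑' n, v n z) = fun z => x₀ + ∑' n, v (n + 1) z := by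
      funext z
      exact (hsum z).tsum_eq_zero_add
    rw [← hBt, (B t).map_tsum (hsum t), h2]
    exact h1.const_add x₀

/-- The sesquilinear form `∑ z̄_j B_{jl} z_l`. -/
noncomputable def sesq {ι : Type*} [Fintype ι] (B : ι → ι → ℂ) (z : ι → ℂ) : ℂ :=
  ∑ j, ∑ l, star (z j) * B j l * z l

/-- The energy `∑ (|z'_j|² + d_j |z_j|²) - ⟨B z, z⟩`. -/
noncomputable def modeEnergy {ι : Type*} [Fintype ι] (d : ι → ℝ) (B : ι → ι → ℂ)
    (z z' : ι → ℂ) : ℂ :=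
  ∑ j, (star (z' j) * z' j + d j * (star (z j) * z j)) - sesq B z

theorem hasDerivAt_star {g : ℝ → ℂ} {g' : ℂ} {y : ℝ} (h : HasDerivAt g g' y) :
    HasDerivAt (fun t => star (g t)) (star g') y := h.star

theorem hasDerivAt_re {g : ℝ → ℂ} {g' : ℂ} {y : ℝ} (h : HasDerivAt g g' y) :
    HasDerivAt (fun t => (g t).re) g'.re y :=
  Complex.reCLM.hasFDerivAt.comp_hasDerivAt y h

theorem hasDerivAt_im {g : ℝ → ℂ} {g' : ℂ} {y : ℝ} (h : HasDerivAt g g' y) :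
    HasDerivAt (fun t => (g t).im) g'.im y :=
  Complex.imCLM.hasFDerivAt.comp_hasDerivAt y h

section ModeSystem

variable {ι : Type*} [Fintype ι] {d : ι → ℝ} {Q P : ℝ → ι → ι → ℂ} {V V' : ℝ → ι → ℂ} {y : ℝ}

theorem hasDerivAt_modeEnergy
    (hQ : ∀ j l, HasDerivAt (fun t => Q t j l) (-P y j l) y)
    (hherm : ∀ j l, star (Q y j l) = Q y l j)
    (hV : ∀ j, HasDerivAt (fun t => V t j) (V' y j) y)
    (hV' : ∀ j, HasDerivAt (fun t => V' t j) (∑ l, Q y j l * V y l - d j * V y j) y) :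
    HasDerivAt (fun t => modeEnergy d (Q t) (V t) (V' t)) (sesq (P y) (V y)) y := by
  have h1 : HasDerivAt (fun t => modeEnergy d (Q t) (V t) (V' t))
      (∑ j, ((star (∑ l, Q y j l * V y l - d j * V y j) * V' y j
          + star (V' y j) * (∑ l, Q y j l * V y l - d j * V y j))
          + d j * (star (V' y j) * V y j + star (V y j) * V' y j))
        - ∑ j, ∑ l, ((star (V' y j) * Q y j l + star (V y j) * (-P y j l)) * V y l
          + star (V y j) * Q y j l * V' y l)) y := by
    unfold modeEnergy sesq
    refine HasDerivAt.sub (HasDerivAt.fun_sum fun j _ => ?_)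
      (HasDerivAt.fun_sum fun j _ => HasDerivAt.fun_sum fun l _ => ?_)
    · exact (((hV' j).star).mul (hV' j)).add ((((hV j).star).mul (hV j)).const_mul _)
    · exact (((hV j).star).mul (hQ j l)).mul (hV l)
  convert h1 using 1
  have hsw : ∑ j, ∑ l, star (Q y j l) * star (V y l) * V' y j
      = ∑ j, ∑ l, star (V y j) * Q y j l * V' y l := by
    rw [Finset.sum_comm]
    refine Finset.sum_congr rfl fun j _ => Finset.sum_congr rfl fun l _ => ?_
    rw [hherm]; ring
  have h2 : ∑ j, ((star (∑ l, Q y j l * V y l - d j * V y j) * V' y j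
          + star (V' y j) * (∑ l, Q y j l * V y l - d j * V y j))
          + d j * (star (V' y j) * V y j + star (V y j) * V' y j))
      = ∑ j, ∑ l, star (Q y j l) * star (V y l) * V' y j
        + ∑ j, ∑ l, star (V' y j) * Q y j l * V y l := by
    rw [← Finset.sum_add_distrib]
    refine Finset.sum_congr rfl fun j _ => ?_
    have hd : star ((d j : ℝ) : ℂ) = (d j : ℂ) := Complex.conj_ofReal _
    have e1 : star (∑ l, Q y j l * V y l) * V' y j
        = ∑ l, star (Q y j l) * star (V y l) * V' y j := by
      rw [star_sum, Finset.sum_mul]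
      exact Finset.sum_congr rfl fun l _ => by rw [star_mul']
    have e2 : star (V' y j) * (∑ l, Q y j l * V y l)
        = ∑ l, star (V' y j) * Q y j l * V y l := by
      rw [Finset.mul_sum]
      exact Finset.sum_congr rfl fun l _ => by ring
    rw [← e1, ← e2, star_sub, star_mul', hd]
    ring
  rw [h2, hsw, sesq, ← Finset.sum_add_distrib, ← Finset.sum_sub_distrib]
  refine Finset.sum_congr rfl fun j _ => ?_
  rw [← Finset.sum_add_distrib, ← Finset.sum_sub_distrib]
  refine Finset.sum_congr rfl fun l _ => ?_
  ring

theorem hasDerivAt_modeFlux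
    (hV : ∀ j, HasDerivAt (fun t => V t j) (V' y j) y)
    (hV' : ∀ j, HasDerivAt (fun t => V' t j) (∑ l, Q y j l * V y l - d j * V y j) y) :
    HasDerivAt (fun t => ∑ j, star (V t j) * V' t j)
      (∑ j, (star (V' y j) * V' y j - d j * (star (V y j) * V y j)) + sesq (Q y) (V y)) y := by
  have h1 : HasDerivAt (fun t => ∑ j, star (V t j) * V' t j)
      (∑ j, (star (V' y j) * V' y j
        + star (V y j) * (∑ l, Q y j l * V y l - d j * V y j))) y :=
    HasDerivAt.fun_sum fun j _ => ((hV j).star).mul (hV' j)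
  convert h1 using 1
  rw [sesq, ← Finset.sum_add_distrib]
  refine Finset.sum_congr rfl fun j _ => ?_
  have e2 : star (V y j) * (∑ l, Q y j l * V y l)
      = ∑ l, star (V y j) * Q y j l * V y l := by
    rw [Finset.mul_sum]
    exact Finset.sum_congr rfl fun l _ => by ring
  rw [← e2]; ring

theorem star_sesq {B : ι → ι → ℂ} (hB : ∀ j l, star (B j l) = B l j) (z : ι → ℂ) :
    star (sesq B z) = sesq B z := by
  unfold sesq
  rw [star_sum]
  simp_rw [star_sum]
  rw [Finset.sum_comm]
  refine Finset.sum_congr rfl fun j _ => Finset.sum_congr rfl fun l _ => ?_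
  rw [star_mul', star_mul', hB, star_star]
  ring

theorem im_sesq {B : ι → ι → ℂ} (hB : ∀ j l, star (B j l) = B l j) (z : ι → ℂ) :
    (sesq B z).im = 0 := Complex.conj_eq_iff_im.1 (star_sesq hB z)

theorem modeEnergy_re (B : ι → ι → ℂ) (z z' : ι → ℂ) :
    (modeEnergy d B z z').re = ∑ j, (‖z' j‖ ^ 2 + d j * ‖z j‖ ^ 2) - (sesq B z).re := by
  have h : ∀ w : ℂ, star w * w = ((‖w‖ ^ 2 : ℝ) : ℂ) := fun w => by
    push_cast
    exact Complex.conj_mul' w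
  unfold modeEnergy
  rw [Complex.sub_re, Complex.re_sum]
  congr 1
  refine Finset.sum_congr rfl fun j _ => ?_
  rw [h, h, ← Complex.ofReal_mul, ← Complex.ofReal_add, Complex.ofReal_re]

end ModeSystem

section ModeBound

variable {ι : Type*} [Fintype ι] [DecidableEq ι] {d : ι → ℝ} {τ : ι → ℂ}
  {Q P : ℝ → ι → ι → ℂ} {V V' : ℝ → ι → ℂ} {Y κ : ℝ} {m : ι} {c : ℂ}

theorem boundary_energy_le (hκ : 0 ≤ κ)
    (hτ : ∀ j, ‖τ j‖ ^ 2 + d j ≤ 2 * κ * (-(τ j).im)) (a : ι → ℂ)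
    (hflux : (∑ j, star (a j) * (τ j * a j + if j = m then c else 0)).im = 0) :
    ∑ j, (‖τ j * a j + if j = m then c else 0‖ ^ 2 + d j * ‖a j‖ ^ 2)
      ≤ 2 * (κ + ‖τ m‖) * ‖c‖ * ‖a m‖ + ‖c‖ ^ 2 := by
  have h1 : ∀ j, ‖τ j * a j + if j = m then c else 0‖ ^ 2 + d j * ‖a j‖ ^ 2
      ≤ 2 * κ * (-(τ j).im * ‖a j‖ ^ 2)
        + if j = m then 2 * ‖τ m‖ * ‖c‖ * ‖a m‖ + ‖c‖ ^ 2 else 0 := fun j => by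
    by_cases hj : j = m
    · subst hj
      simp only [if_true]
      have hn : ‖τ j * a j + c‖ ≤ ‖τ j‖ * ‖a j‖ + ‖c‖ := by
        simpa [norm_mul] using norm_add_le (τ j * a j) c
      have := mul_le_mul_of_nonneg_right (hτ j) (sq_nonneg ‖a j‖)
      nlinarith [norm_nonneg (τ j * a j + c)]
    · simp only [hj, if_false, add_zero, norm_mul]
      have := mul_le_mul_of_nonneg_right (hτ j) (sq_nonneg ‖a j‖)
      nlinarith
  have h2 : (∑ j, star (a j) * (τ j * a j + if j = m then c else 0)).im
      = ∑ j, (τ j).im * ‖a j‖ ^ 2 + (star (a m) * c).im := by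
    have : ∀ j, star (a j) * (τ j * a j + if j = m then c else 0)
        = τ j * ((‖a j‖ ^ 2 : ℝ) : ℂ) + if j = m then star (a m) * c else 0 := fun j => by
      have hn : star (a j) * a j = ((‖a j‖ ^ 2 : ℝ) : ℂ) := by
        push_cast
        exact Complex.conj_mul' (a j)
      rw [← hn]
      split_ifs with hj
      · subst hj; ring
      · ring
    rw [Finset.sum_congr rfl fun j _ => this j, Finset.sum_add_distrib,
      Finset.sum_ite_eq' Finset.univ m, if_pos (Finset.mem_univ m), Complex.add_im,
      Complex.im_sum]
    simp only [Complex.im_mul_ofReal]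
  have h3 : |(star (a m) * c).im| ≤ ‖a m‖ * ‖c‖ := by
    simpa using Complex.abs_im_le_norm (star (a m) * c)
  have h4 : ∑ j, -(τ j).im * ‖a j‖ ^ 2 ≤ ‖a m‖ * ‖c‖ := by
    simp only [neg_mul, Finset.sum_neg_distrib]
    rw [h2] at hflux
    linarith [(abs_le.1 h3).2]
  calc ∑ j, (‖τ j * a j + if j = m then c else 0‖ ^ 2 + d j * ‖a j‖ ^ 2)
      ≤ ∑ j, (2 * κ * (-(τ j).im * ‖a j‖ ^ 2)
        + if j = m then 2 * ‖τ m‖ * ‖c‖ * ‖a m‖ + ‖c‖ ^ 2 else 0) :=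
        Finset.sum_le_sum fun j _ => h1 j
    _ = 2 * κ * (∑ j, -(τ j).im * ‖a j‖ ^ 2) + (2 * ‖τ m‖ * ‖c‖ * ‖a m‖ + ‖c‖ ^ 2) := by
        rw [Finset.sum_add_distrib, Finset.sum_ite_eq' Finset.univ m,
          if_pos (Finset.mem_univ m), ← Finset.mul_sum]
    _ ≤ _ := by nlinarith

theorem boundary_flux_re_le (hτ : ∀ j, (τ j).re ≤ 0) (a : ι → ℂ) :
    (∑ j, star (a j) * (τ j * a j + if j = m then c else 0)).re ≤ ‖c‖ * ‖a m‖ := by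
  have h1 : ∀ j, (star (a j) * (τ j * a j + if j = m then c else 0)).re
      ≤ if j = m then ‖c‖ * ‖a m‖ else 0 := fun j => by
    have e : star (a j) * (τ j * a j + if j = m then c else 0)
        = τ j * ((‖a j‖ ^ 2 : ℝ) : ℂ) + star (a j) * if j = m then c else 0 := by
      have hn : star (a j) * a j = ((‖a j‖ ^ 2 : ℝ) : ℂ) := by
        push_cast
        exact Complex.conj_mul' (a j)
      rw [← hn]; ring
    rw [e, Complex.add_re, Complex.re_mul_ofReal]
    have h0 : (τ j).re * ‖a j‖ ^ 2 ≤ 0 :=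
      mul_nonpos_of_nonpos_of_nonneg (hτ j) (sq_nonneg _)
    split_ifs with hj
    · subst hj
      have : (star (a j) * c).re ≤ ‖a j‖ * ‖c‖ := by
        simpa using Complex.re_le_norm (star (a j) * c)
      linarith [mul_comm ‖c‖ ‖a j‖]
    · simpa using h0
  rw [Complex.re_sum]
  refine (Finset.sum_le_sum fun j _ => h1 j).trans ?_
  rw [Finset.sum_ite_eq' Finset.univ m, if_pos (Finset.mem_univ m)]

theorem energy_amplitude_bound {Y κ t c b E : ℝ} (hY : 0 < Y) (hκ : 0 ≤ κ) (ht : 0 ≤ t)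
    (hc : 0 ≤ c) (hb : 0 ≤ b) (hE : E ≤ 2 * (κ + t) * c * b + c ^ 2)
    (hH : 2 * b ^ 2 / Y ≤ Y * E + c * b) :
    E ≤ c ^ 2 * (2 * Y * (κ + t) + 1) ^ 2 := by
  obtain ⟨g, hg⟩ : ∃ g, g = κ + t := ⟨_, rfl⟩
  have hg0 : 0 ≤ g := by rw [hg]; positivity
  rw [← hg] at hE ⊢
  have h1 : 2 * b ^ 2 ≤ Y * (Y * (2 * g * c * b + c ^ 2) + c * b) := by
    rw [div_le_iff₀ hY] at hH
    have : Y * E ≤ Y * (2 * g * c * b + c ^ 2) := mul_le_mul_of_nonneg_left hE hY.le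
    nlinarith
  have h2 : b ≤ Y * c * (Y * g + 3 / 2) := by
    by_contra hcon
    push Not at hcon
    have h3 : Y * c * (Y * g + 3 / 2) * b ≤ b * b := mul_le_mul_of_nonneg_right hcon.le hb
    have h4 : Y * c ≤ b := by
      have : 0 ≤ Y * c * (Y * g + 1 / 2) := by positivity
      nlinarith
    have h5 : Y * c * (Y * c) ≤ Y * c * b := mul_le_mul_of_nonneg_left h4 (by positivity)
    have hbp : 0 < b := lt_of_le_of_lt (by positivity) hcon
    have h6 : Y * c * (Y * g + 3 / 2) * b < b * b := mul_lt_mul_of_pos_right hcon hbp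
    nlinarith
  have h3 : 2 * g * c * b ≤ 2 * g * c * (Y * c * (Y * g + 3 / 2)) :=
    mul_le_mul_of_nonneg_left h2 (by positivity)
  have h4 : 0 ≤ c ^ 2 * (2 * Y ^ 2 * g ^ 2 + Y * g) := by positivity
  nlinarith

/-- Rellich-type a priori bound for the mode system with a monotone Hermitian potential. -/
theorem mode_system_bound (hY : 0 < Y) (hκ : 0 ≤ κ)
    (hτ : ∀ j, ‖τ j‖ ^ 2 + d j ≤ 2 * κ * (-(τ j).im)) (hτre : ∀ j, (τ j).re ≤ 0)
    (hQ : ∀ y j l, HasDerivAt (fun t => Q t j l) (-P y j l) y)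
    (hherm : ∀ y j l, star (Q y j l) = Q y l j)
    (hPcont : ∀ j l, Continuous fun y => P y j l)
    (hP : ∀ y z, 0 ≤ (sesq (P y) z).re) (hQY : Q Y = 0)
    (hV : ∀ y ∈ Set.Icc 0 Y, ∀ j, HasDerivAt (fun t => V t j) (V' y j) y)
    (hV' : ∀ y ∈ Set.Icc 0 Y, ∀ j,
      HasDerivAt (fun t => V' t j) (∑ l, Q y j l * V y l - d j * V y j) y)
    (hV0 : V 0 = 0) (hbc : ∀ j, V' Y j = τ j * V Y j + if j = m then c else 0) :
    ∑ j, ‖V' 0 j‖ ^ 2 + ∫ y in (0 : ℝ)..Y, (sesq (P y) (V y)).re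
      ≤ ‖c‖ ^ 2 * (2 * Y * (κ + ‖τ m‖) + 1) ^ 2 := by
  have h0mem : (0 : ℝ) ∈ Set.Icc 0 Y := ⟨le_rfl, hY.le⟩
  have hYmem : Y ∈ Set.Icc 0 Y := ⟨hY.le, le_rfl⟩
  have hE' : ∀ y ∈ Set.Icc 0 Y, HasDerivAt
      (fun t => (modeEnergy d (Q t) (V t) (V' t)).re) (sesq (P y) (V y)).re y := fun y hy =>
    hasDerivAt_re (hasDerivAt_modeEnergy (hQ y) (hherm y) (hV y hy) (hV' y hy))
  have hF' : ∀ y ∈ Set.Icc 0 Y, HasDerivAt (fun t => ∑ j, star (V t j) * V' t j)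
      (∑ j, (star (V' y j) * V' y j - d j * (star (V y j) * V y j)) + sesq (Q y) (V y)) y :=
    fun y hy => hasDerivAt_modeFlux (hV y hy) (hV' y hy)
  have hnsq : ∀ w : ℂ, star w * w = ((‖w‖ ^ 2 : ℝ) : ℂ) := fun w => by
    push_cast
    exact Complex.conj_mul' w
  have hFval : ∀ y, ∑ j, (star (V' y j) * V' y j - d j * (star (V y j) * V y j))
      = ((∑ j, (‖V' y j‖ ^ 2 - d j * ‖V y j‖ ^ 2) : ℝ) : ℂ) := fun y => by
    rw [Complex.ofReal_sum]
    refine Finset.sum_congr rfl fun j _ => ?_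
    rw [hnsq, hnsq]; push_cast; ring
  have hVc : ∀ j, ContinuousOn (fun t => V t j) (Set.Icc 0 Y) := fun j y hy =>
    (hV y hy j).continuousAt.continuousWithinAt
  have hPVc : ContinuousOn (fun y => (sesq (P y) (V y)).re) (Set.Icc 0 Y) := by
    refine Complex.continuous_re.comp_continuousOn ?_
    unfold sesq
    refine continuousOn_finsetSum _ fun j _ => continuousOn_finsetSum _ fun l _ => ?_
    exact (((hVc j).star).mul (hPcont j l).continuousOn).mul (hVc l)
  -- total energy identity
  have hEint : ∫ y in (0 : ℝ)..Y, (sesq (P y) (V y)).re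
      = (modeEnergy d (Q Y) (V Y) (V' Y)).re - (modeEnergy d (Q 0) (V 0) (V' 0)).re := by
    refine intervalIntegral.integral_eq_sub_of_hasDerivAt (fun y hy => hE' y ?_) ?_
    · rwa [Set.uIcc_of_le hY.le] at hy
    · exact ContinuousOn.intervalIntegrable (by rwa [Set.uIcc_of_le hY.le])
  have hE0 : (modeEnergy d (Q 0) (V 0) (V' 0)).re = ∑ j, ‖V' 0 j‖ ^ 2 := by
    rw [modeEnergy_re, hV0]
    simp [sesq]
  have hEY : (modeEnergy d (Q Y) (V Y) (V' Y)).re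
      = ∑ j, (‖τ j * V Y j + if j = m then c else 0‖ ^ 2 + d j * ‖V Y j‖ ^ 2) := by
    rw [modeEnergy_re, hQY]
    simp [sesq, hbc]
  have hFY : ∑ j, star (V Y j) * V' Y j
      = ∑ j, star (V Y j) * (τ j * V Y j + if j = m then c else 0) := by
    simp only [hbc]
  have hF0 : ∑ j, star (V 0 j) * V' 0 j = 0 := by simp [hV0]
  -- the flux is real
  have hflux : (∑ j, star (V Y j) * (τ j * V Y j + if j = m then c else 0)).im = 0 := by
    have him : ∀ y ∈ Set.Icc 0 Y,
        HasDerivAt (fun t => (∑ j, star (V t j) * V' t j).im) 0 y := fun y hy => by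
      have h := hasDerivAt_im (hF' y hy)
      rwa [hFval, Complex.add_im, Complex.ofReal_im, im_sesq (hherm y), add_zero] at h
    have := intervalIntegral.integral_eq_sub_of_hasDerivAt (a := 0) (b := Y)
      (f := fun t => (∑ j, star (V t j) * V' t j).im) (f' := fun _ => 0)
      (fun y hy => him y (by rwa [Set.uIcc_of_le hY.le] at hy)) (by simp)
    rw [intervalIntegral.integral_zero, hF0, hFY] at this
    simpa using this.symm
  have hEbound := boundary_energy_le hκ hτ (V Y) hflux
  rw [← hEY] at hEbound
  -- the dilation identity
  have hH' : ∀ y ∈ Set.Icc 0 Y, HasDerivAt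
      (fun t => t * (modeEnergy d (Q t) (V t) (V' t)).re + (∑ j, star (V t j) * V' t j).re)
      (2 * ∑ j, ‖V' y j‖ ^ 2 + y * (sesq (P y) (V y)).re) y := fun y hy => by
    have h := ((hasDerivAt_id y).mul (hE' y hy)).add (hasDerivAt_re (hF' y hy))
    refine HasDerivAt.congr_deriv (f' := _) (show HasDerivAt
      (fun t => t * (modeEnergy d (Q t) (V t) (V' t)).re + (∑ j, star (V t j) * V' t j).re) _ y
      from h) ?_
    rw [hFval, Complex.add_re, Complex.ofReal_re, modeEnergy_re]
    simp only [Finset.sum_add_distrib, Finset.sum_sub_distrib, id]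
    ring
  have hmono : 2 * ‖V Y m‖ ^ 2 / Y
      ≤ Y * (modeEnergy d (Q Y) (V Y) (V' Y)).re + (∑ j, star (V Y j) * V' Y j).re := by
    let G : ℝ → ℝ := fun t =>
      (t * (modeEnergy d (Q t) (V t) (V' t)).re + (∑ j, star (V t j) * V' t j).re)
        - (4 * (star (V Y m / Y) * V t m).re - 2 * ‖V Y m / Y‖ ^ 2 * t)
    have hG : ∀ y ∈ Set.Icc 0 Y, HasDerivAt G
        ((2 * ∑ j, ‖V' y j‖ ^ 2 + y * (sesq (P y) (V y)).re)
          - (4 * (star (V Y m / Y) * V' y m).re - 2 * ‖V Y m / Y‖ ^ 2 * 1)) y := fun y hy =>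
      (hH' y hy).sub (((hasDerivAt_re ((hV y hy m).const_mul _)).const_mul 4).sub
        ((hasDerivAt_id y).const_mul _))
    have hGmono : MonotoneOn G (Set.Icc 0 Y) := by
      refine monotoneOn_of_deriv_nonneg (convex_Icc 0 Y)
        (fun y hy => (hG y hy).continuousAt.continuousWithinAt) (fun y hy => ?_) fun y hy => ?_
      · exact (hG y (interior_subset hy)).differentiableAt.differentiableWithinAt
      · have hy' := interior_subset hy
        rw [(hG y hy').deriv]
        have h1 : ‖V' y m‖ ^ 2 ≤ ∑ j, ‖V' y j‖ ^ 2 :=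
          Finset.single_le_sum (f := fun j => ‖V' y j‖ ^ 2) (fun j _ => sq_nonneg _)
            (Finset.mem_univ m)
        have h2 : (star (V Y m / Y) * V' y m).re ≤ ‖V Y m / Y‖ * ‖V' y m‖ := by
          refine (Complex.re_le_norm _).trans ?_
          rw [norm_mul, norm_star]
        have h3 : 0 ≤ y * (sesq (P y) (V y)).re := mul_nonneg hy'.1 (hP y _)
        nlinarith [sq_nonneg (‖V' y m‖ - ‖V Y m / Y‖)]
    have h := hGmono h0mem hYmem hY.le
    have hG0 : G 0 = 0 := by simp [G, hV0]
    have hsq : (star (V Y m / Y) * V Y m).re = ‖V Y m‖ ^ 2 / Y := by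
      have : star (V Y m / (Y : ℂ)) * V Y m = ((‖V Y m‖ ^ 2 / Y : ℝ) : ℂ) := by
        have hs : star (Y : ℂ) = Y := Complex.conj_ofReal Y
        rw [star_div₀, hs, div_mul_eq_mul_div, hnsq]; push_cast; ring
      rw [this, Complex.ofReal_re]
    have hn : ‖V Y m / (Y : ℂ)‖ ^ 2 * Y = ‖V Y m‖ ^ 2 / Y := by
      rw [norm_div, Complex.norm_real, Real.norm_of_nonneg hY.le]
      field_simp
    rw [hG0] at h
    simp only [G, hsq] at h
    have e : 2 * ‖V Y m‖ ^ 2 / Y = 4 * (‖V Y m‖ ^ 2 / Y) - 2 * ‖V Y m / (Y : ℂ)‖ ^ 2 * Y := by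
      rw [mul_assoc, hn]; ring
    rw [e]; linarith
  have hHle := boundary_flux_re_le (m := m) (c := c) hτre (V Y)
  rw [← hFY] at hHle
  rw [hEint, hE0]
  have := energy_amplitude_bound hY hκ (norm_nonneg (τ m)) (norm_nonneg c)
    (norm_nonneg (V Y m)) hEbound (hmono.trans (by linarith))
  linarith

end ModeBound

section ModeExistence

variable {ι : Type*} [Fintype ι] {d : ι → ℝ} {τ : ι → ℂ}
  {Q P : ℝ → ι → ι → ℂ} {Y κ : ℝ}

/-- The first-order form of the mode system `V'' = Q V - d V`. -/
noncomputable def modeGenerator (d : ι → ℝ) (B : ι → ι → ℂ) :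
    ((ι → ℂ) × (ι → ℂ)) →L[ℝ] ((ι → ℂ) × (ι → ℂ)) :=
  LinearMap.toContinuousLinearMap
    { toFun := fun z => (z.2, fun j => ∑ l, B j l * z.1 l - d j * z.1 j)
      map_add' := fun z w => by
        refine Prod.ext rfl (funext fun j => ?_)
        simp only [Prod.fst_add, Prod.snd_add, Pi.add_apply, mul_add, Finset.sum_add_distrib]
        ring
      map_smul' := fun r z => by
        refine Prod.ext rfl (funext fun j => ?_)
        simp only [Prod.smul_fst, Prod.smul_snd, Pi.smul_apply, Complex.real_smul,
          RingHom.id_apply, mul_sub, Finset.mul_sum]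
        congr 1
        · exact Finset.sum_congr rfl fun l _ => by ring
        · ring }

theorem exists_mode_flow (hQ : ∀ j l, Continuous fun y => Q y j l) (hY : 0 ≤ Y) (a : ι → ℂ) :
    ∃ V V' : ℝ → ι → ℂ, V 0 = 0 ∧ V' 0 = a ∧
      (∀ y ∈ Set.Icc 0 Y, ∀ j, HasDerivAt (fun t => V t j) (V' y j) y) ∧
      ∀ y ∈ Set.Icc 0 Y, ∀ j,
        HasDerivAt (fun t => V' t j) (∑ l, Q y j l * V y l - d j * V y j) y := by
  have hA : Continuous fun y => modeGenerator d (Q y) := by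
    rw [continuous_clm_apply]
    intro z
    refine Continuous.prodMk continuous_const (continuous_pi fun j => ?_)
    exact (continuous_finsetSum _ fun l _ => (hQ j l).mul continuous_const).sub continuous_const
  obtain ⟨u, hu0, hu⟩ := exists_linear_ode_solution hA hY ((0 : ι → ℂ), a)
  refine ⟨fun y => (u y).1, fun y => (u y).2, by simp [hu0], by simp [hu0], fun y hy j => ?_,
    fun y hy j => ?_⟩
  · exact hasDerivAt_pi.1 (hu y hy).fst j
  · exact hasDerivAt_pi.1 (hu y hy).snd j

variable [DecidableEq ι]

/-- Solvability of the two-point boundary value problem for the mode system. -/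
theorem exists_mode_solution (hY : 0 < Y) (hκ : 0 ≤ κ)
    (hτ : ∀ j, ‖τ j‖ ^ 2 + d j ≤ 2 * κ * (-(τ j).im)) (hτre : ∀ j, (τ j).re ≤ 0)
    (hQ : ∀ y j l, HasDerivAt (fun t => Q t j l) (-P y j l) y)
    (hherm : ∀ y j l, star (Q y j l) = Q y l j)
    (hPcont : ∀ j l, Continuous fun y => P y j l)
    (hP : ∀ y z, 0 ≤ (sesq (P y) z).re) (hQY : Q Y = 0) (m : ι) :
    ∃ V V' : ℝ → ι → ℂ, V 0 = 0 ∧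
      (∀ y ∈ Set.Icc 0 Y, ∀ j, HasDerivAt (fun t => V t j) (V' y j) y) ∧
      (∀ y ∈ Set.Icc 0 Y, ∀ j,
        HasDerivAt (fun t => V' t j) (∑ l, Q y j l * V y l - d j * V y j) y) ∧
      (∀ j, V' Y j = τ j * V Y j + if j = m then 1 else 0) ∧
      ∫ y in (0 : ℝ)..Y, (sesq (P y) (V y)).re ≤ (2 * Y * (κ + ‖τ m‖) + 1) ^ 2 := by
  have hQc : ∀ j l, Continuous fun y => Q y j l := fun j l =>
    continuous_iff_continuousAt.2 fun y => (hQ y j l).continuousAt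
  choose U U' hU0 hU0' hU hU' using fun i : ι =>
    exists_mode_flow (d := d) hQc hY.le (Pi.single i (1 : ℂ))
  let V : (ι → ℂ) → ℝ → ι → ℂ := fun ξ y j => ∑ i, ξ i * U i y j
  let V' : (ι → ℂ) → ℝ → ι → ℂ := fun ξ y j => ∑ i, ξ i * U' i y j
  have hV0 : ∀ ξ, V ξ 0 = 0 := fun ξ => by ext j; simp [V, hU0]
  have hV0' : ∀ ξ, V' ξ 0 = ξ := fun ξ => by
    ext j; simp [V', hU0', Pi.single_apply]
  have hV : ∀ ξ, ∀ y ∈ Set.Icc 0 Y, ∀ j, HasDerivAt (fun t => V ξ t j) (V' ξ y j) y :=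
    fun ξ y hy j => HasDerivAt.fun_sum fun i _ => (hU i y hy j).const_mul _
  have hV' : ∀ ξ, ∀ y ∈ Set.Icc 0 Y, ∀ j,
      HasDerivAt (fun t => V' ξ t j) (∑ l, Q y j l * V ξ y l - d j * V ξ y j) y :=
    fun ξ y hy j => by
      refine (HasDerivAt.fun_sum fun i (_ : i ∈ Finset.univ) =>
        (hU' i y hy j).const_mul (ξ i)).congr_deriv ?_
      simp only [V, mul_sub, Finset.sum_sub_distrib, Finset.mul_sum]
      rw [Finset.sum_comm]
      congr 1
      · exact Finset.sum_congr rfl fun l _ => Finset.sum_congr rfl fun i _ => by ring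
      · exact Finset.sum_congr rfl fun i _ => by ring
  let T : (ι → ℂ) →ₗ[ℂ] (ι → ℂ) :=
    { toFun := fun ξ j => V' ξ Y j - τ j * V ξ Y j
      map_add' := fun ξ η => by
        ext j
        simp only [V, V', Pi.add_apply, add_mul, Finset.sum_add_distrib]
        ring
      map_smul' := fun r ξ => by
        ext j
        simp only [V, V', Pi.smul_apply, smul_eq_mul, RingHom.id_apply, mul_assoc,
          ← Finset.mul_sum]
        ring }
  have hinj : Function.Injective T := by
    rw [injective_iff_map_eq_zero]
    intro ξ hξ
    have hbc : ∀ j, V' ξ Y j = τ j * V ξ Y j + if j = m then 0 else 0 := fun j => by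
      have h := congrFun hξ j
      have h' : V' ξ Y j - τ j * V ξ Y j = 0 := h
      simpa [sub_eq_zero] using h'
    have h := mode_system_bound hY hκ hτ hτre hQ hherm hPcont hP hQY (hV ξ) (hV' ξ) (hV0 ξ) hbc
    have hint : 0 ≤ ∫ y in (0 : ℝ)..Y, (sesq (P y) (V ξ y)).re :=
      intervalIntegral.integral_nonneg hY.le fun y _ => hP y _
    rw [hV0', norm_zero] at h
    have hs : ∑ j, ‖ξ j‖ ^ 2 ≤ 0 := by nlinarith
    have hs0 := (Finset.sum_eq_zero_iff_of_nonneg fun j _ => sq_nonneg ‖ξ j‖).1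
      (le_antisymm hs (Finset.sum_nonneg fun j _ => sq_nonneg _))
    ext j
    simpa using hs0 j (Finset.mem_univ j)
  obtain ⟨ξ, hξ⟩ := LinearMap.injective_iff_surjective.1 hinj fun j => if j = m then 1 else 0
  have hbc : ∀ j, V' ξ Y j = τ j * V ξ Y j + if j = m then 1 else 0 := fun j => by
    rw [← congrFun hξ j]
    exact (add_sub_cancel _ _).symm
  refine ⟨V ξ, V' ξ, hV0 ξ, hV ξ, hV' ξ, hbc, ?_⟩
  have h := mode_system_bound hY hκ hτ hτre hQ hherm hPcont hP hQY (hV ξ) (hV' ξ) (hV0 ξ) hbc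
  have hs : 0 ≤ ∑ j, ‖V' ξ 0 j‖ ^ 2 := Finset.sum_nonneg fun j _ => sq_nonneg _
  rw [norm_one] at h
  linarith

end ModeExistence

section Potential

theorem hasDerivAt_integral_of_continuous {E : Type*} [NormedAddCommGroup E] [NormedSpace ℝ E]
    {F F' : ℝ × ℝ → E} (hF : ∀ y, Continuous fun x => F (x, y))
    (hF' : Continuous F') (h : ∀ x y, HasDerivAt (fun t => F (x, t)) (F' (x, y)) y)
    (a b y : ℝ) :
    HasDerivAt (fun t => ∫ x in a..b, F (x, t)) (∫ x in a..b, F' (x, y)) y := by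
  obtain ⟨C, hC⟩ := ((isCompact_uIcc (a := a) (b := b)).prod
    (isCompact_closedBall y 1)).exists_bound_of_continuousOn hF'.continuousOn
  refine (intervalIntegral.hasDerivAt_integral_of_dominated_loc_of_deriv_le (bound := fun _ => C)
    (F := fun t x => F (x, t)) (F' := fun t x => F' (x, t))
    (Metric.ball_mem_nhds y one_pos) (.of_forall fun t => (hF t).aestronglyMeasurable)
    ((hF y).intervalIntegrable _ _)
    (hF'.comp (Continuous.prodMk_left y)).aestronglyMeasurable
    (.of_forall fun x hx t ht => ?_) (by simp) (.of_forall fun x _ t _ => h x t)).2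
  exact hC (x, t) ⟨Set.uIoc_subset_uIcc hx, Metric.ball_subset_closedBall ht⟩

variable {ι : Type*}

/-- The matrix of multiplication by `q (·, y)` with respect to the functions `ψ j`. -/
noncomputable def potentialMatrix (L : ℝ) (ψ : ι → ℝ → ℂ) (q : ℝ × ℝ → ℝ) (y : ℝ) (j l : ι) : ℂ :=
  ∫ x in (0 : ℝ)..L, (q (x, y) : ℂ) * (ψ l x * star (ψ j x))

variable {L : ℝ} {ψ : ι → ℝ → ℂ} {q ρ : ℝ × ℝ → ℝ}

theorem continuous_potentialMatrix (hψ : ∀ j, Continuous (ψ j)) (hq : Continuous q) (j l : ι) :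
    Continuous fun y => potentialMatrix L ψ q y j l := by
  refine intervalIntegral.continuous_parametric_intervalIntegral_of_continuous'
    (f := fun y x => (q (x, y) : ℂ) * (ψ l x * star (ψ j x))) ?_ 0 L
  have h1 := hψ j
  have h2 := hψ l
  simp only [Function.uncurry_def]
  fun_prop

theorem hasDerivAt_potentialMatrix (hψ : ∀ j, Continuous (ψ j)) (hq : Continuous q)
    (hρ : Continuous ρ) (hqρ : ∀ x y, HasDerivAt (fun t => q (x, t)) (-ρ (x, y)) y)
    (y : ℝ) (j l : ι) :
    HasDerivAt (fun t => potentialMatrix L ψ q t j l) (-potentialMatrix L ψ ρ y j l) y := by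
  have h1 := hψ j
  have h2 := hψ l
  have h := hasDerivAt_integral_of_continuous
    (F := fun p => (q p : ℂ) * (ψ l p.1 * star (ψ j p.1)))
    (F' := fun p => ((-ρ p : ℝ) : ℂ) * (ψ l p.1 * star (ψ j p.1)))
    (fun y => by fun_prop) (by fun_prop)
    (fun x y => (HasDerivAt.ofReal_comp (hqρ x y)).mul_const (ψ l x * star (ψ j x))) 0 L y
  refine h.congr_deriv ?_
  simp [potentialMatrix, intervalIntegral.integral_neg]

theorem star_potentialMatrix (y : ℝ) (j l : ι) :
    star (potentialMatrix L ψ q y j l) = potentialMatrix L ψ q y l j := by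
  unfold potentialMatrix
  have := (intervalIntegral.intervalIntegral_conj (μ := volume) (a := 0) (b := L)
    (f := fun x => (q (x, y) : ℂ) * (ψ l x * star (ψ j x))))
  refine this.symm.trans (intervalIntegral.integral_congr fun x _ => ?_)
  simp [mul_comm]

variable [Fintype ι]

theorem sum_potentialMatrix_mul (hψ : ∀ j, Continuous (ψ j)) (hq : Continuous q) (y : ℝ)
    (z : ι → ℂ) (j : ι) :
    ∑ l, potentialMatrix L ψ q y j l * z l
      = ∫ x in (0 : ℝ)..L, (q (x, y) : ℂ) * (∑ l, z l * ψ l x) * star (ψ j x) := by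
  unfold potentialMatrix
  simp_rw [← intervalIntegral.integral_mul_const]
  rw [← intervalIntegral.integral_finsetSum]
  · refine intervalIntegral.integral_congr fun x _ => ?_
    simp only [Finset.mul_sum, Finset.sum_mul]
    exact Finset.sum_congr rfl fun l _ => by ring
  · intro l _
    have h1 := hψ j
    have h2 := hψ l
    exact Continuous.intervalIntegrable (by fun_prop) _ _

theorem sesq_potentialMatrix (hψ : ∀ j, Continuous (ψ j)) (hq : Continuous q) (y : ℝ)
    (z : ι → ℂ) :
    sesq (potentialMatrix L ψ q y) z
      = ((∫ x in (0 : ℝ)..L, q (x, y) * ‖∑ l, z l * ψ l x‖ ^ 2 : ℝ) : ℂ) := by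
  have h : ∀ j, ∑ l, star (z j) * potentialMatrix L ψ q y j l * z l
      = ∫ x in (0 : ℝ)..L, star (z j)
        * ((q (x, y) : ℂ) * (∑ l, z l * ψ l x) * star (ψ j x)) := fun j => by
    rw [intervalIntegral.integral_const_mul, ← sum_potentialMatrix_mul hψ hq, Finset.mul_sum]
    exact Finset.sum_congr rfl fun l _ => by ring
  unfold sesq
  rw [Finset.sum_congr rfl fun j _ => h j, ← intervalIntegral.integral_finsetSum,
    ← intervalIntegral.integral_ofReal]
  · refine intervalIntegral.integral_congr fun x _ => ?_
    have e : ((‖∑ l, z l * ψ l x‖ ^ 2 : ℝ) : ℂ)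
        = star (∑ l, z l * ψ l x) * (∑ l, z l * ψ l x) := by
      push_cast
      exact (Complex.conj_mul' _).symm
    simp only [Complex.ofReal_mul, e]
    rw [star_sum]
    simp only [Finset.sum_mul, Finset.mul_sum, star_mul']
    rw [Finset.sum_comm]
    exact Finset.sum_congr rfl fun l _ => Finset.sum_congr rfl fun j _ => by ring
  · intro j _
    exact Continuous.intervalIntegrable (by fun_prop) _ _

end Potential

section Duality

variable {ι : Type*} [Fintype ι] [DecidableEq ι] {d : ι → ℝ} {τ : ι → ℂ} {L Y κ : ℝ}
  {ψ : ι → ℝ → ℂ} {q ρ h : ℝ × ℝ → ℝ} {G : ℝ × ℝ → ℂ} {W W' : ℝ → ι → ℂ}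

/-- Weighted duality estimate for the modes of a forced outgoing field. -/
theorem norm_mode_le_of_weight (hL : 0 < L) (hY : 0 < Y) (hκ : 0 ≤ κ)
    (hτ : ∀ j, ‖τ j‖ ^ 2 + d j ≤ 2 * κ * (-(τ j).im)) (hτre : ∀ j, (τ j).re ≤ 0)
    (hψ : ∀ j, Continuous (ψ j)) (hq : Continuous q) (hρ : Continuous ρ)
    (hqρ : ∀ x y, HasDerivAt (fun t => q (x, t)) (-ρ (x, y)) y)
    (hρ0 : ∀ p, 0 ≤ ρ p) (hqY : ∀ x, q (x, Y) = 0)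
    (hG : Continuous G) (hh : Continuous h)
    (hW : ∀ y ∈ Set.Icc 0 Y, ∀ j, HasDerivAt (fun t => W t j) (W' y j) y)
    (hW' : ∀ y ∈ Set.Icc 0 Y, ∀ j, HasDerivAt (fun t => W' t j)
      ((∫ x in (0 : ℝ)..L, G (x, y) * star (ψ j x)) - d j * W y j) y)
    (hW0 : W 0 = 0) (hW0' : W' 0 = 0) (hWY : ∀ j, W' Y j = star (τ j) * W Y j)
    (hbound : ∀ x ∈ Set.Icc 0 L, ∀ y ∈ Set.Icc 0 Y,
      ‖G (x, y) - q (x, y) * ∑ j, W y j * ψ j x‖ ^ 2 ≤ h (x, y) * ρ (x, y))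
    (hh0 : ∀ p, 0 ≤ h p) {δ : ℝ} (hδ : 0 < δ)
    (hint : ∫ y in (0 : ℝ)..Y, ∫ x in (0 : ℝ)..L, h (x, y) ≤ δ ^ 2) (m : ι) :
    ‖W Y m‖ ≤ (2 * Y * (κ + ‖τ m‖) + 1) * δ := by
  let Q := potentialMatrix L ψ q
  let P := potentialMatrix L ψ ρ
  have hPre : ∀ y z, (sesq (P y) z).re
      = ∫ x in (0 : ℝ)..L, ρ (x, y) * ‖∑ l, z l * ψ l x‖ ^ 2 := fun y z => by
    rw [sesq_potentialMatrix hψ hρ, Complex.ofReal_re]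
  have hQY : Q Y = 0 := by
    ext j l
    simp [Q, potentialMatrix, hqY]
  obtain ⟨V, V', hV0, hV, hV', hVY, hVint⟩ := exists_mode_solution (Q := Q) (P := P) hY hκ hτ hτre
    (hasDerivAt_potentialMatrix hψ hq hρ hqρ) star_potentialMatrix
    (continuous_potentialMatrix hψ hρ)
    (fun y z => by
      rw [hPre]
      exact intervalIntegral.integral_nonneg hL.le fun x _ => mul_nonneg (hρ0 _) (sq_nonneg _))
    hQY m
  have hQc := continuous_potentialMatrix (L := L) hψ hq
  have hPc := continuous_potentialMatrix (L := L) hψ hρ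
  have hVc : ∀ j, ContinuousOn (fun t => V t j) (Set.Icc 0 Y) := fun j y hy =>
    (hV y hy j).continuousAt.continuousWithinAt
  have hWc : ∀ j, ContinuousOn (fun t => W t j) (Set.Icc 0 Y) := fun j y hy =>
    (hW y hy j).continuousAt.continuousWithinAt
  have hGc : ∀ j, Continuous fun y => ∫ x in (0 : ℝ)..L, G (x, y) * star (ψ j x) := fun j => by
    refine intervalIntegral.continuous_parametric_intervalIntegral_of_continuous'
      (f := fun y x => G (x, y) * star (ψ j x)) ?_ 0 L
    have h1 := hψ j
    simp only [Function.uncurry_def]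
    fun_prop
  let Φ : ℝ → ℂ := fun y => ∑ j, (W' y j * star (V y j) - W y j * star (V' y j))
  let Φ' : ℝ → ℂ := fun y => ∑ j, ((∫ x in (0 : ℝ)..L, G (x, y) * star (ψ j x)) * star (V y j)
    - W y j * star (∑ l, Q y j l * V y l))
  have hΦ : ∀ y ∈ Set.Icc 0 Y, HasDerivAt Φ (Φ' y) y := fun y hy => by
    refine (HasDerivAt.fun_sum fun j (_ : j ∈ Finset.univ) =>
      ((hW' y hy j).mul (hV y hy j).star).sub ((hW y hy j).mul (hV' y hy j).star)).congr_deriv ?_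
    refine Finset.sum_congr rfl fun j _ => ?_
    have hd : star ((d j : ℝ) : ℂ) = (d j : ℂ) := Complex.conj_ofReal _
    rw [star_sub, star_mul', hd]
    ring
  have hΦ'c : ContinuousOn Φ' (Set.Icc 0 Y) := by
    refine continuousOn_finsetSum _ fun j _ => ((hGc j).continuousOn.mul (hVc j).star).sub
      ((hWc j).mul (ContinuousOn.star ?_))
    exact continuousOn_finsetSum _ fun l _ => (hQc j l).continuousOn.mul (hVc l)
  have hΦ0 : Φ 0 = 0 := by simp [Φ, hW0, hW0', hV0]
  have hΦY : Φ Y = -W Y m := by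
    have : ∀ j, W' Y j * star (V Y j) - W Y j * star (V' Y j)
        = if j = m then -W Y m else 0 := fun j => by
      rw [hWY, hVY, star_add, star_mul']
      split_ifs with hj
      · subst hj
        rw [star_one]; ring
      · rw [star_zero]; ring
    simp only [Φ, this, Finset.sum_ite_eq' Finset.univ m, Finset.mem_univ, if_true]
  have hFTC : ∫ y in (0 : ℝ)..Y, Φ' y = -W Y m := by
    rw [intervalIntegral.integral_eq_sub_of_hasDerivAt (f := Φ), hΦ0, hΦY, sub_zero]
    · intro y hy
      exact hΦ y (by rwa [Set.uIcc_of_le hY.le] at hy)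
    · exact ContinuousOn.intervalIntegrable (by rwa [Set.uIcc_of_le hY.le])
  have hΦ'eq : ∀ y, Φ' y = ∫ x in (0 : ℝ)..L,
      (G (x, y) - q (x, y) * ∑ j, W y j * ψ j x) * star (∑ j, V y j * ψ j x) := fun y => by
    have e1 : ∑ j, W y j * star (∑ l, Q y j l * V y l)
        = ∑ j, (∫ x in (0 : ℝ)..L, (q (x, y) : ℂ) * (∑ l, W y l * ψ l x) * star (ψ j x))
          * star (V y j) := by
      simp_rw [← sum_potentialMatrix_mul hψ hq, star_sum, star_mul', Q, star_potentialMatrix,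
        Finset.mul_sum, Finset.sum_mul]
      rw [Finset.sum_comm]
      exact Finset.sum_congr rfl fun l _ => Finset.sum_congr rfl fun j _ => by ring
    have e2 : ∀ j, (∫ x in (0 : ℝ)..L, G (x, y) * star (ψ j x)) * star (V y j)
        - (∫ x in (0 : ℝ)..L, (q (x, y) : ℂ) * (∑ l, W y l * ψ l x) * star (ψ j x))
          * star (V y j)
        = ∫ x in (0 : ℝ)..L, (G (x, y) - q (x, y) * ∑ l, W y l * ψ l x)
          * (star (ψ j x) * star (V y j)) := fun j => by
      have h1 := hψ j
      rw [← intervalIntegral.integral_mul_const, ← intervalIntegral.integral_mul_const,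
        ← intervalIntegral.integral_sub]
      · exact intervalIntegral.integral_congr fun x _ => by ring
      · exact Continuous.intervalIntegrable (by fun_prop) _ _
      · exact Continuous.intervalIntegrable (by fun_prop) _ _
    simp only [Φ', Finset.sum_sub_distrib]
    rw [e1, ← Finset.sum_sub_distrib, Finset.sum_congr rfl fun j _ => e2 j,
      ← intervalIntegral.integral_finsetSum]
    · refine intervalIntegral.integral_congr fun x _ => ?_
      simp only [star_sum, star_mul', Finset.mul_sum]
      exact Finset.sum_congr rfl fun l _ => by ring
    · intro j _
      have h1 := hψ j
      exact Continuous.intervalIntegrable (by fun_prop) _ _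
  obtain ⟨C, hC⟩ : ∃ C, C = 2 * Y * (κ + ‖τ m‖) + 1 := ⟨_, rfl⟩
  have hC0 : 0 < C := by rw [hC]; positivity
  rw [← hC] at hVint ⊢
  have hpt : ∀ y ∈ Set.Icc 0 Y, ‖Φ' y‖ ≤ C / δ / 2 * (∫ x in (0 : ℝ)..L, h (x, y))
      + δ / C / 2 * (sesq (P y) (V y)).re := fun y hy => by
    rw [hΦ'eq, hPre, ← intervalIntegral.integral_const_mul, ← intervalIntegral.integral_const_mul,
      ← intervalIntegral.integral_add]
    · refine intervalIntegral.norm_integral_le_of_norm_le hL.le (.of_forall fun x hx => ?_) ?_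
      · have hb := hbound x (Set.Ioc_subset_Icc_self hx) y hy
        rw [norm_mul, norm_star]
        have hr := hρ0 (x, y)
        have hhp := hh0 (x, y)
        have h1 : ‖G (x, y) - q (x, y) * ∑ j, W y j * ψ j x‖
            ≤ Real.sqrt (h (x, y)) * Real.sqrt (ρ (x, y)) := by
          rw [← Real.sqrt_mul hhp]
          exact Real.le_sqrt_of_sq_le hb
        refine (mul_le_mul_of_nonneg_right h1 (norm_nonneg _)).trans ?_
        obtain ⟨n, hn⟩ : ∃ n, n = ‖∑ j, V y j * ψ j x‖ := ⟨_, rfl⟩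
        rw [← hn]
        have hD : 0 < C / δ := by positivity
        have hinv : δ / C = (C / δ)⁻¹ := (inv_div _ _).symm
        rw [hinv]
        have hs1 := Real.sq_sqrt hhp
        have hs2 := Real.sq_sqrt hr
        have key : Real.sqrt (h (x, y)) * Real.sqrt (ρ (x, y)) * n
            ≤ (C / δ) / 2 * Real.sqrt (h (x, y)) ^ 2
              + (C / δ)⁻¹ / 2 * (Real.sqrt (ρ (x, y)) ^ 2 * n ^ 2) := by
          have h3 : (C / δ) / 2 * Real.sqrt (h (x, y)) ^ 2
              + (C / δ)⁻¹ / 2 * (Real.sqrt (ρ (x, y)) ^ 2 * n ^ 2)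
              - Real.sqrt (h (x, y)) * Real.sqrt (ρ (x, y)) * n
              = (C / δ)⁻¹ / 2 *
                (C / δ * Real.sqrt (h (x, y)) - Real.sqrt (ρ (x, y)) * n) ^ 2 := by
            field_simp
            ring
          have h4 : 0 ≤ (C / δ)⁻¹ / 2 *
                (C / δ * Real.sqrt (h (x, y)) - Real.sqrt (ρ (x, y)) * n) ^ 2 := by positivity
          linarith
        rwa [hs1, hs2] at key
      · exact Continuous.intervalIntegrable (by fun_prop) _ _
    · exact Continuous.intervalIntegrable (by fun_prop) _ _
    · exact Continuous.intervalIntegrable (by fun_prop) _ _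
  have hPVc : ContinuousOn (fun y => (sesq (P y) (V y)).re) (Set.Icc 0 Y) := by
    refine Complex.continuous_re.comp_continuousOn ?_
    unfold sesq
    refine continuousOn_finsetSum _ fun j _ => continuousOn_finsetSum _ fun l _ => ?_
    exact (((hVc j).star).mul (hPc j l).continuousOn).mul (hVc l)
  have hHc : Continuous fun y => ∫ x in (0 : ℝ)..L, h (x, y) := by
    refine intervalIntegral.continuous_parametric_intervalIntegral_of_continuous'
      (f := fun y x => h (x, y)) ?_ 0 L
    simp only [Function.uncurry_def]
    fun_prop
  have hi1 := (hHc.intervalIntegrable (μ := volume) 0 Y).const_mul (C / δ / 2)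
  have hi2 : IntervalIntegrable (fun y => δ / C / 2 * (sesq (P y) (V y)).re) volume 0 Y :=
    (ContinuousOn.intervalIntegrable (by rwa [Set.uIcc_of_le hY.le])).const_mul _
  have hfin := intervalIntegral.norm_integral_le_of_norm_le hY.le
    (.of_forall fun y hy => hpt y (Set.Ioc_subset_Icc_self hy)) (hi1.add hi2)
  rw [hFTC, norm_neg, intervalIntegral.integral_add hi1 hi2, intervalIntegral.integral_const_mul,
    intervalIntegral.integral_const_mul] at hfin
  refine hfin.trans ?_
  have h1 : C / δ / 2 * (∫ y in (0 : ℝ)..Y, ∫ x in (0 : ℝ)..L, h (x, y)) ≤ C / δ / 2 * δ ^ 2 :=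
    mul_le_mul_of_nonneg_left hint (by positivity)
  have h2 : δ / C / 2 * (∫ y in (0 : ℝ)..Y, (sesq (P y) (V y)).re) ≤ δ / C / 2 * C ^ 2 :=
    mul_le_mul_of_nonneg_left hVint (by positivity)
  have h3 : C / δ / 2 * δ ^ 2 + δ / C / 2 * C ^ 2 = C * δ := by
    field_simp
    ring
  linarith

end Duality

section Steklov

/-- The forward average of `g` over an interval of length `s`. -/
noncomputable def steklov (s : ℝ) (g : ℝ → ℝ) (x : ℝ) : ℝ := (∫ t in (0 : ℝ)..s, g (x + t)) / s

variable {s K L : ℝ} {g : ℝ → ℝ}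

theorem hasDerivAt_steklov (hg : Continuous g) (x : ℝ) :
    HasDerivAt (steklov s g) ((g (x + s) - g x) / s) x := by
  have h0 : ∀ y, steklov s g y = ((∫ t in (0 : ℝ)..(y + s), g t) - ∫ t in (0 : ℝ)..y, g t) / s :=
    fun y => by
      unfold steklov
      rw [intervalIntegral.integral_comp_add_left (fun t => g t), add_zero,
        intervalIntegral.integral_interval_sub_left (hg.intervalIntegrable _ _)
          (hg.intervalIntegrable _ _)]
  have h1 : HasDerivAt (fun y => ∫ t in (0 : ℝ)..y, g t) (g x) x :=
    (hg.integral_hasStrictDerivAt 0 x).hasDerivAt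
  have h2 : HasDerivAt (fun y => ∫ t in (0 : ℝ)..(y + s), g t) (g (x + s)) x := by
    have := (hg.integral_hasStrictDerivAt 0 (x + s)).hasDerivAt
    exact this.comp_add_const x s
  rw [funext h0]
  exact (h2.sub h1).div_const s

theorem abs_steklov_sub_steklov_le (hs : 0 < s) (hg : Continuous g)
    (hK : ∀ x y, |g x - g y| ≤ K * |x - y|) (x y : ℝ) :
    |steklov s g x - steklov s g y| ≤ K * |x - y| := by
  unfold steklov
  rw [← sub_div, ← intervalIntegral.integral_sub, abs_div, abs_of_pos hs, div_le_iff₀ hs]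
  · have := intervalIntegral.norm_integral_le_of_norm_le_const (a := 0) (b := s)
      (f := fun t => g (x + t) - g (y + t)) (C := K * |x - y|) fun t _ => by
        simpa using hK (x + t) (y + t)
    simpa [abs_of_pos hs] using this
  · exact Continuous.intervalIntegrable (by fun_prop) _ _
  · exact Continuous.intervalIntegrable (by fun_prop) _ _

theorem abs_steklov_sub_le (hs : 0 < s) (hg : Continuous g) (hK0 : 0 ≤ K)
    (hK : ∀ x y, |g x - g y| ≤ K * |x - y|) (x : ℝ) :
    |steklov s g x - g x| ≤ K * s := by
  have h : steklov s g x - g x = (∫ t in (0 : ℝ)..s, (g (x + t) - g x)) / s := by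
    unfold steklov
    rw [intervalIntegral.integral_sub (Continuous.intervalIntegrable (by fun_prop) _ _) (by simp)]
    simp only [intervalIntegral.integral_const, sub_zero, smul_eq_mul]
    field_simp
  rw [h, abs_div, abs_of_pos hs, div_le_iff₀ hs]
  have := intervalIntegral.norm_integral_le_of_norm_le_const (a := 0) (b := s)
    (f := fun t => g (x + t) - g x) (C := K * s) fun t ht => by
      rw [Set.uIoc_of_le hs.le] at ht
      refine (hK (x + t) x).trans ?_
      rw [add_sub_cancel_left, abs_of_pos ht.1]
      exact mul_le_mul_of_nonneg_left ht.2 hK0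
  simpa [abs_of_pos hs] using this

/-- A twice differentiable periodic function squeezed above a Lipschitz periodic function. -/
theorem exists_smooth_majorant (hs : 0 < s) (hK0 : 0 ≤ K)
    (hK : ∀ x y, |g x - g y| ≤ K * |x - y|) (hg : Continuous g) (hper : ∀ x, g (x + L) = g x) :
    ∃ F F' F'' : ℝ → ℝ, (∀ x, HasDerivAt F (F' x) x) ∧ (∀ x, HasDerivAt F' (F'' x) x) ∧
      Continuous F'' ∧ (∀ x, F (x + L) = F x) ∧ (∀ x, F' (x + L) = F' x) ∧
      (∀ x, g x + s ≤ F x) ∧ (∀ x, F x ≤ g x + (4 * K + 1) * s) ∧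
      (∀ x, |F' x| ≤ K) ∧ ∀ x, |F'' x| ≤ 2 * K / s := by
  have hc1 : Continuous (steklov s g) :=
    continuous_iff_continuousAt.2 fun x => (hasDerivAt_steklov hg x).continuousAt
  have hK1 := abs_steklov_sub_steklov_le hs hg hK
  have hp1 : ∀ x, steklov s g (x + L) = steklov s g x := fun x => by
    unfold steklov
    simp only [add_right_comm x L, hper]
  have hp2 : ∀ x, steklov s (steklov s g) (x + L) = steklov s (steklov s g) x := fun x => by
    rw [steklov, steklov]
    simp only [add_right_comm x L, hp1]
  have hd : ∀ (h : ℝ → ℝ), (∀ x y, |h x - h y| ≤ K * |x - y|) →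
      ∀ x, |(h (x + s) - h x) / s| ≤ K := fun h hh x => by
    rw [abs_div, abs_of_pos hs, div_le_iff₀ hs]
    simpa [abs_of_pos hs] using hh (x + s) x
  refine ⟨fun x => steklov s (steklov s g) x + (2 * K + 1) * s,
    fun x => (steklov s g (x + s) - steklov s g x) / s,
    fun x => ((g (x + s + s) - g (x + s)) / s - (g (x + s) - g x) / s) / s,
    fun x => (hasDerivAt_steklov hc1 x).add_const _, fun x => ?_, by fun_prop,
    fun x => by simp only [hp2], fun x => by simp only [add_right_comm x L, hp1],
    fun x => ?_, fun x => ?_, hd _ hK1, fun x => ?_⟩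
  · exact (((hasDerivAt_steklov hg (x + s)).comp_add_const x s).sub
      (hasDerivAt_steklov hg x)).div_const s
  · have h1 := abs_le.1 (abs_steklov_sub_le hs hg hK0 hK x)
    have h2 := abs_le.1 (abs_steklov_sub_le hs hc1 hK0 hK1 x)
    linarith [h1.1, h2.1]
  · have h1 := abs_le.1 (abs_steklov_sub_le hs hg hK0 hK x)
    have h2 := abs_le.1 (abs_steklov_sub_le hs hc1 hK0 hK1 x)
    linarith [h1.2, h2.2]
  · rw [abs_div, abs_of_pos hs]
    gcongr
    have h1 := abs_le.1 (hd g hK (x + s))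
    have h2 := abs_le.1 (hd g hK x)
    exact abs_le.2 ⟨by linarith [h1.1, h2.2], by linarith [h1.2, h2.1]⟩

end Steklov

section Cutoff

/-- `g` is a twice continuously differentiable profile with first and second derivatives `g'`,
`g''` which are bounded by `C` and vanish outside `[a, b]`. -/
structure IsProfile (g g' g'' : ℝ → ℝ) (a b C : ℝ) : Prop where
  hasDerivAt : ∀ t, HasDerivAt g (g' t) t
  hasDerivAt' : ∀ t, HasDerivAt g' (g'' t) t
  continuous : Continuous g''
  deriv_eq_zero : ∀ t, t < a ∨ b < t → g' t = 0 ∧ g'' t = 0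
  abs_le : ∀ t, |g' t| ≤ C ∧ |g'' t| ≤ C

theorem exists_isProfile {g : ℝ → ℝ} (hg : ContDiff ℝ 2 g) {a b c₁ c₂ : ℝ}
    (h1 : ∀ t < a, g t = c₁) (h2 : ∀ t, b < t → g t = c₂) :
    ∃ g' g'' C, 0 ≤ C ∧ IsProfile g g' g'' a b C := by
  have hg1 : ContDiff ℝ 1 (deriv g) := (contDiff_succ_iff_deriv (n := 1)).1 hg |>.2.2
  have hc1 : Continuous (deriv g) := hg1.continuous
  have hc2 : Continuous (deriv (deriv g)) := hg1.continuous_deriv le_rfl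
  have hz : ∀ t, t < a ∨ b < t → deriv g t = 0 := fun t ht => by
    rcases ht with ht | ht
    · have : g =ᶠ[nhds t] fun _ => c₁ := by
        filter_upwards [Iio_mem_nhds ht] with u hu using h1 u hu
      rw [this.deriv_eq]; simp
    · have : g =ᶠ[nhds t] fun _ => c₂ := by
        filter_upwards [Ioi_mem_nhds ht] with u hu using h2 u hu
      rw [this.deriv_eq]; simp
  have hz2 : ∀ t, t < a ∨ b < t → deriv (deriv g) t = 0 := fun t ht => by
    have : deriv g =ᶠ[nhds t] fun _ => 0 := by
      rcases ht with ht | ht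
      · filter_upwards [Iio_mem_nhds ht] with u hu using hz u (.inl hu)
      · filter_upwards [Ioi_mem_nhds ht] with u hu using hz u (.inr hu)
    rw [this.deriv_eq]; simp
  obtain ⟨C₁, hC₁⟩ := (isCompact_Icc (a := a) (b := b)).exists_bound_of_continuousOn
    hc1.continuousOn
  obtain ⟨C₂, hC₂⟩ := (isCompact_Icc (a := a) (b := b)).exists_bound_of_continuousOn
    hc2.continuousOn
  refine ⟨deriv g, deriv (deriv g), max 0 (max C₁ C₂), le_max_left _ _, ?_, ?_, hc2,
    fun t ht => ⟨hz t ht, hz2 t ht⟩, fun t => ?_⟩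
  · exact fun t => (hg.differentiable (by norm_num) t).hasDerivAt
  · exact fun t => (hg1.differentiable (by norm_num) t).hasDerivAt
  · by_cases ht : t < a ∨ b < t
    · simp [hz t ht, hz2 t ht]
    · push Not at ht
      exact ⟨(hC₁ t ht).trans ((le_max_left _ _).trans (le_max_right _ _)),
        (hC₂ t ht).trans ((le_max_right _ _).trans (le_max_right _ _))⟩

/-- Partial derivatives up to order two of a function on the plane, all continuous. -/
structure IsC2 {E : Type*} [NormedAddCommGroup E] [NormedSpace ℝ E]
    (u u1 u2 u11 u22 : ℝ × ℝ → E) : Prop where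
  cont : Continuous u
  cont1 : Continuous u1
  cont2 : Continuous u2
  cont11 : Continuous u11
  cont22 : Continuous u22
  deriv1 : ∀ p : ℝ × ℝ, HasDerivAt (fun t => u (t, p.2)) (u1 p) p.1
  deriv2 : ∀ p : ℝ × ℝ, HasDerivAt (fun t => u (p.1, t)) (u2 p) p.2
  deriv11 : ∀ p : ℝ × ℝ, HasDerivAt (fun t => u1 (t, p.2)) (u11 p) p.1
  deriv22 : ∀ p : ℝ × ℝ, HasDerivAt (fun t => u2 (p.1, t)) (u22 p) p.2

/-- Composition of a profile with the rescaled height above a graph. -/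
theorem IsProfile.isC2 {g g' g'' F F' F'' : ℝ → ℝ} {a b C s : ℝ}
    (hg : IsProfile g g' g'' a b C) (hF : ∀ x, HasDerivAt F (F' x) x)
    (hF' : ∀ x, HasDerivAt F' (F'' x) x) (hFc : Continuous F'') :
    IsC2 (fun p : ℝ × ℝ => g ((p.2 - F p.1) / s))
      (fun p => g' ((p.2 - F p.1) / s) * (-F' p.1 / s))
      (fun p => g' ((p.2 - F p.1) / s) * (1 / s))
      (fun p => g'' ((p.2 - F p.1) / s) * (-F' p.1 / s) * (-F' p.1 / s)
        + g' ((p.2 - F p.1) / s) * (-F'' p.1 / s))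
      (fun p => g'' ((p.2 - F p.1) / s) * (1 / s) * (1 / s)) := by
  have c0 : Continuous g := continuous_iff_continuousAt.2 fun x => (hg.hasDerivAt x).continuousAt
  have c1 : Continuous g' := continuous_iff_continuousAt.2 fun x => (hg.hasDerivAt' x).continuousAt
  have c2 := hg.continuous
  have d0 : Continuous F := continuous_iff_continuousAt.2 fun x => (hF x).continuousAt
  have d1 : Continuous F' := continuous_iff_continuousAt.2 fun x => (hF' x).continuousAt
  have hx : ∀ p : ℝ × ℝ, HasDerivAt (fun t => (p.2 - F t) / s) (-F' p.1 / s) p.1 := fun p =>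
    ((hF p.1).const_sub p.2).div_const s
  have hy : ∀ p : ℝ × ℝ, HasDerivAt (fun t => (t - F p.1) / s) (1 / s) p.2 := fun p =>
    ((hasDerivAt_id p.2).sub_const _).div_const s
  refine ⟨by fun_prop, by fun_prop, by fun_prop, by fun_prop, by fun_prop, fun p => ?_, fun p => ?_,
    fun p => ?_, fun p => ?_⟩
  · exact (hg.hasDerivAt _).comp p.1 (hx p)
  · exact (hg.hasDerivAt _).comp p.2 (hy p)
  · exact ((hg.hasDerivAt' _).comp p.1 (hx p)).mul ((hF' p.1).neg.div_const s)
  · exact ((hg.hasDerivAt' _).comp p.2 (hy p)).mul_const (1 / s)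

end Cutoff

section LayerCutoff

theorem IsProfile.layer_bound {g g' g'' F' F'' : ℝ → ℝ} {a b C s K : ℝ}
    (hg : IsProfile g g' g'' a b C) (hs : 0 < s) (hC : 0 ≤ C) (hK : 0 ≤ K)
    (hF' : ∀ x, |F' x| ≤ K) (hF'' : ∀ x, |F'' x| ≤ 2 * K / s) (x t : ℝ) :
    |g' t * (-F' x / s)| ≤ C * (K + 1) ^ 2 / s ∧ |g' t * (1 / s)| ≤ C * (K + 1) ^ 2 / s ∧
      |g'' t * (-F' x / s) * (-F' x / s) + g' t * (-F'' x / s) + g'' t * (1 / s) * (1 / s)|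
        ≤ C * (K + 1) ^ 2 / s ^ 2 := by
  obtain ⟨h1, h2⟩ := hg.abs_le t
  refine ⟨?_, ?_, ?_⟩
  · rw [abs_mul, abs_div, abs_neg, abs_of_pos hs, ← mul_div_assoc]
    gcongr ?_ / s
    calc |g' t| * |F' x| ≤ C * K := mul_le_mul h1 (hF' x) (abs_nonneg _) hC
      _ ≤ C * (K + 1) ^ 2 := by gcongr; nlinarith
  · rw [abs_mul, abs_div, abs_of_pos hs, abs_one, ← mul_div_assoc, mul_one]
    gcongr ?_ / s
    nlinarith [mul_nonneg hC hK, mul_nonneg hC (sq_nonneg K)]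
  · have e : g'' t * (-F' x / s) * (-F' x / s) + g' t * (-F'' x / s) + g'' t * (1 / s) * (1 / s)
        = (g'' t * (F' x * F' x) + g' t * (-(s * F'' x)) + g'' t) / s ^ 2 := by
      field_simp
    rw [e, abs_div, abs_of_pos (pow_pos hs 2)]
    gcongr ?_ / s ^ 2
    have h3 : |F' x * F' x| ≤ K * K := by
      rw [abs_mul]; exact mul_le_mul (hF' x) (hF' x) (abs_nonneg _) hK
    have h4 : |-(s * F'' x)| ≤ 2 * K := by
      rw [abs_neg, abs_mul, abs_of_pos hs]
      calc s * |F'' x| ≤ s * (2 * K / s) := mul_le_mul_of_nonneg_left (hF'' x) hs.le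
        _ = 2 * K := by field_simp
    calc |g'' t * (F' x * F' x) + g' t * (-(s * F'' x)) + g'' t|
        ≤ |g'' t * (F' x * F' x)| + |g' t * (-(s * F'' x))| + |g'' t| := abs_add_three _ _ _
      _ ≤ C * (K * K) + C * (2 * K) + C := by
          have e1 := mul_le_mul h2 h3 (abs_nonneg _) hC
          have e2 := mul_le_mul h1 h4 (abs_nonneg _) hC
          rw [← abs_mul] at e1 e2
          linarith
      _ = C * (K + 1) ^ 2 := by ring

/-- A cutoff `X` to the region above a layer of width `B s` over the graph of `f`, together with
a bump `Z` which is supported in the layer and equals one where `X` varies. -/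
structure LayerCutoff (f : ℝ → ℝ) (L B s C : ℝ)
    (X X1 X2 X11 X22 Z Z1 Z2 Z11 Z22 : ℝ × ℝ → ℝ) : Prop where
  isC2 : IsC2 X X1 X2 X11 X22
  isC2_bump : IsC2 Z Z1 Z2 Z11 Z22
  per : ∀ p : ℝ × ℝ, X (p.1 + L, p.2) = X p
  per1 : ∀ p : ℝ × ℝ, X1 (p.1 + L, p.2) = X1 p
  per_bump : ∀ p : ℝ × ℝ, Z (p.1 + L, p.2) = Z p
  per1_bump : ∀ p : ℝ × ℝ, Z1 (p.1 + L, p.2) = Z1 p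
  low : ∀ p : ℝ × ℝ, p.2 < f p.1 + s → X p = 0
  high : ∀ p : ℝ × ℝ, f p.1 + (B - 2) * s ≤ p.2 → X p = 1
  nonneg : ∀ p, 0 ≤ X p
  le_one : ∀ p, X p ≤ 1
  low_bump : ∀ p : ℝ × ℝ, p.2 < f p.1 + s → Z p = 0 ∧ Z11 p + Z22 p = 0
  high_bump : ∀ p : ℝ × ℝ, f p.1 + B * s < p.2 → Z p = 0 ∧ Z11 p + Z22 p = 0
  nonneg_bump : ∀ p, 0 ≤ Z p
  le_one_bump : ∀ p, Z p ≤ 1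
  bound1 : ∀ p, |X1 p| ≤ C / s * Z p
  bound2 : ∀ p, |X2 p| ≤ C / s * Z p
  bound_lap : ∀ p, |X11 p + X22 p| ≤ C / s ^ 2 * Z p
  bound_lap_bump : ∀ p, |Z11 p + Z22 p| ≤ C / s ^ 2
  deriv_high : ∀ p : ℝ × ℝ, f p.1 + (B - 2) * s < p.2 → X1 p = 0 ∧ X2 p = 0 ∧ X11 p + X22 p = 0

theorem exists_layerCutoff {K : ℝ} (hK0 : 0 ≤ K) :
    ∃ C, 0 < C ∧ ∀ (f : ℝ → ℝ) (L s : ℝ), (∀ x y, |f x - f y| ≤ K * |x - y|) → Continuous f →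
      (∀ x, f (x + L) = f x) → 0 < s →
      ∃ X X1 X2 X11 X22 Z Z1 Z2 Z11 Z22,
        LayerCutoff f L (4 * K + 5) s C X X1 X2 X11 X22 Z Z1 Z2 Z11 Z22 := by
  obtain ⟨χ', χ'', C₁, hC₁, hχ⟩ := exists_isProfile (g := fun t => Real.smoothTransition (t - 1))
    (a := 1) (b := 2) (c₁ := 0) (c₂ := 1)
    (Real.smoothTransition.contDiff.comp (contDiff_id.sub contDiff_const))
    (fun t ht => Real.smoothTransition.zero_of_nonpos (by linarith))
    (fun t ht => Real.smoothTransition.one_of_one_le (by linarith))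
  obtain ⟨η', η'', C₂, hC₂, hη⟩ := exists_isProfile
    (g := fun t => Real.smoothTransition t * Real.smoothTransition (3 - t))
    (a := 0) (b := 3) (c₁ := 0) (c₂ := 0)
    (Real.smoothTransition.contDiff.mul
      (Real.smoothTransition.contDiff.comp (contDiff_const.sub contDiff_id)))
    (fun t ht => by simp [Real.smoothTransition.zero_of_nonpos ht.le])
    (fun t ht => by
      simp [Real.smoothTransition.zero_of_nonpos (show 3 - t ≤ 0 by linarith)])
  refine ⟨(C₁ + C₂ + 1) * (K + 1) ^ 2, by positivity, fun f L s hK hf hper hs => ?_⟩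
  obtain ⟨F, F', F'', hF, hF', hFc, hFp, hFp', hFlo, hFhi, hFb, hFb'⟩ :=
    exists_smooth_majorant hs hK0 hK hf hper
  have hX := hχ.layer_bound hs hC₁ hK0 hFb hFb'
  have hZ := hη.layer_bound hs hC₂ hK0 hFb hFb'
  have hτlo : ∀ p : ℝ × ℝ, p.2 < f p.1 + s → (p.2 - F p.1) / s < 0 := fun p hp =>
    div_neg_of_neg_of_pos (by linarith [hFlo p.1]) hs
  have hτhi : ∀ (p : ℝ × ℝ) (n : ℝ), f p.1 + (4 * K + 1 + n) * s < p.2 → n < (p.2 - F p.1) / s :=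
    fun p n hp => by
      rw [lt_div_iff₀ hs]
      nlinarith [hFhi p.1]
  have hτhi' : ∀ (p : ℝ × ℝ) (n : ℝ), f p.1 + (4 * K + 1 + n) * s ≤ p.2 →
      n ≤ (p.2 - F p.1) / s :=
    fun p n hp => by
      rw [le_div_iff₀ hs]
      nlinarith [hFhi p.1]
  have hle1 : C₁ * (K + 1) ^ 2 ≤ (C₁ + C₂ + 1) * (K + 1) ^ 2 := by gcongr; linarith
  have hle2 : C₂ * (K + 1) ^ 2 ≤ (C₁ + C₂ + 1) * (K + 1) ^ 2 := by gcongr; linarith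
  have hη0 : ∀ t, 0 ≤ Real.smoothTransition t * Real.smoothTransition (3 - t) := fun t =>
    mul_nonneg (Real.smoothTransition.nonneg _) (Real.smoothTransition.nonneg _)
  have hη1 : ∀ t, 1 ≤ t → t ≤ 2 →
      Real.smoothTransition t * Real.smoothTransition (3 - t) = 1 := fun t h1 h2 => by
    rw [Real.smoothTransition.one_of_one_le h1,
      Real.smoothTransition.one_of_one_le (by linarith), one_mul]
  have hsupp : ∀ (t u A : ℝ), 0 ≤ A → |u| ≤ A → (t < 1 ∨ 2 < t → u = 0) →
      |u| ≤ A * (Real.smoothTransition t * Real.smoothTransition (3 - t)) :=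
    fun t u A hA hu h0 => by
      by_cases ht : t < 1 ∨ 2 < t
      · rw [h0 ht, abs_zero]
        exact mul_nonneg hA (hη0 t)
      · push Not at ht
        rwa [hη1 t ht.1 ht.2, mul_one]
  refine ⟨_, _, _, _, _, _, _, _, _, _, hχ.isC2 (s := s) hF hF' hFc, hη.isC2 (s := s) hF hF' hFc,
    fun p => by simp only [hFp], fun p => by simp only [hFp, hFp'], fun p => by simp only [hFp],
    fun p => by simp only [hFp, hFp'], fun p hp => ?_, fun p hp => ?_,
    fun p => Real.smoothTransition.nonneg _, fun p => Real.smoothTransition.le_one _,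
    fun p hp => ?_, fun p hp => ?_, fun p => hη0 _, fun p => ?_, fun p => ?_, fun p => ?_,
    fun p => ?_, fun p => ?_, fun p hp => ?_⟩
  · exact Real.smoothTransition.zero_of_nonpos (by linarith [hτlo p hp])
  · have := hτhi' p 2 (by linarith)
    exact Real.smoothTransition.one_of_one_le (by linarith)
  · have h := hτlo p hp
    obtain ⟨h1, h2⟩ := hη.deriv_eq_zero _ (.inl h)
    simp [h1, h2, Real.smoothTransition.zero_of_nonpos h.le]
  · have h := hτhi p 3 (by nlinarith)
    obtain ⟨h1, h2⟩ := hη.deriv_eq_zero _ (.inr h)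
    simp [h1, h2, Real.smoothTransition.zero_of_nonpos (show 3 - (p.2 - F p.1) / s ≤ 0 by linarith)]
  · exact mul_le_one₀ (Real.smoothTransition.le_one _) (Real.smoothTransition.nonneg _)
      (Real.smoothTransition.le_one _)
  · refine hsupp _ _ _ (by positivity) (((hX p.1 _).1).trans (by gcongr)) fun h => ?_
    rw [(hχ.deriv_eq_zero _ h).1, zero_mul]
  · refine hsupp _ _ _ (by positivity) (((hX p.1 _).2.1).trans (by gcongr)) fun h => ?_
    rw [(hχ.deriv_eq_zero _ h).1, zero_mul]
  · refine hsupp _ _ _ (by positivity) (((hX p.1 _).2.2).trans (by gcongr)) fun h => ?_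
    rw [(hχ.deriv_eq_zero _ h).1, (hχ.deriv_eq_zero _ h).2]; ring
  · exact ((hZ p.1 _).2.2).trans (by gcongr)
  · obtain ⟨h1, h2⟩ := hχ.deriv_eq_zero _ (.inr (hτhi p 2 (by linarith)))
    simp [h1, h2]

end LayerCutoff

section Extension

variable {E : Type*} [NormedAddCommGroup E] [NormedSpace ℝ E] {f : ℝ → ℝ} {s : ℝ}

/-- Continuous partial derivatives up to order two in the region strictly above the graph of `f`. -/
structure IsC2Above (f : ℝ → ℝ) (u u1 u2 u11 u22 : ℝ × ℝ → E) : Prop where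
  cont : ContinuousOn u {p : ℝ × ℝ | f p.1 < p.2}
  cont1 : ContinuousOn u1 {p : ℝ × ℝ | f p.1 < p.2}
  cont2 : ContinuousOn u2 {p : ℝ × ℝ | f p.1 < p.2}
  cont11 : ContinuousOn u11 {p : ℝ × ℝ | f p.1 < p.2}
  cont22 : ContinuousOn u22 {p : ℝ × ℝ | f p.1 < p.2}
  deriv1 : ∀ p : ℝ × ℝ, f p.1 < p.2 → HasDerivAt (fun t => u (t, p.2)) (u1 p) p.1
  deriv2 : ∀ p : ℝ × ℝ, f p.1 < p.2 → HasDerivAt (fun t => u (p.1, t)) (u2 p) p.2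
  deriv11 : ∀ p : ℝ × ℝ, f p.1 < p.2 → HasDerivAt (fun t => u1 (t, p.2)) (u11 p) p.1
  deriv22 : ∀ p : ℝ × ℝ, f p.1 < p.2 → HasDerivAt (fun t => u2 (p.1, t)) (u22 p) p.2

theorem eventually_fst_lt (hf : Continuous f) {p : ℝ × ℝ} {r : ℝ} (hp : p.2 < f p.1 + r) :
    ∀ᶠ t in nhds p.1, p.2 < f t + r :=
  (continuous_const.continuousAt).eventually_lt (by fun_prop) hp

theorem eventually_snd_lt {p : ℝ × ℝ} {r : ℝ} (hp : p.2 < f p.1 + r) :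
    ∀ᶠ t in nhds p.2, t < f p.1 + r := Iio_mem_nhds hp

theorem continuous_cutoff_smul (hf : Continuous f) (hs : 0 < s) {X : ℝ × ℝ → ℝ}
    (hX : Continuous X) (hX0 : ∀ p : ℝ × ℝ, p.2 < f p.1 + s → X p = 0) {u : ℝ × ℝ → E}
    (hu : ContinuousOn u {p : ℝ × ℝ | f p.1 < p.2}) : Continuous fun p => X p • u p := by
  rw [continuous_iff_continuousAt]
  intro p
  by_cases hp : f p.1 < p.2
  · have ho : IsOpen {p : ℝ × ℝ | f p.1 < p.2} := isOpen_lt (by fun_prop) (by fun_prop)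
    exact hX.continuousAt.smul (hu.continuousAt (ho.mem_nhds hp))
  · have hp' : p.2 < f p.1 + s := by linarith [not_lt.1 hp]
    have ho : IsOpen {p : ℝ × ℝ | p.2 < f p.1 + s} := isOpen_lt (by fun_prop) (by fun_prop)
    have : (fun p => X p • u p) =ᶠ[nhds p] fun _ => 0 := by
      filter_upwards [ho.mem_nhds hp'] with q hq
      rw [hX0 q hq, zero_smul]
    exact continuousAt_const.congr this.symm

theorem deriv_fst_eq_zero_of_low (hf : Continuous f) {X X1 : ℝ × ℝ → ℝ}
    (hX0 : ∀ p : ℝ × ℝ, p.2 < f p.1 + s → X p = 0)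
    (hX1 : ∀ p : ℝ × ℝ, HasDerivAt (fun t => X (t, p.2)) (X1 p) p.1)
    (p : ℝ × ℝ) (hp : p.2 < f p.1 + s) : X1 p = 0 := by
  refine (hX1 p).unique ((hasDerivAt_const p.1 (0 : ℝ)).congr_of_eventuallyEq ?_)
  filter_upwards [eventually_fst_lt hf hp] with t ht using hX0 (t, p.2) ht

theorem deriv_snd_eq_zero_of_low {X X2 : ℝ × ℝ → ℝ}
    (hX0 : ∀ p : ℝ × ℝ, p.2 < f p.1 + s → X p = 0)
    (hX2 : ∀ p : ℝ × ℝ, HasDerivAt (fun t => X (p.1, t)) (X2 p) p.2)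
    (p : ℝ × ℝ) (hp : p.2 < f p.1 + s) : X2 p = 0 := by
  refine (hX2 p).unique ((hasDerivAt_const p.2 (0 : ℝ)).congr_of_eventuallyEq ?_)
  filter_upwards [eventually_snd_lt hp] with t ht using hX0 (p.1, t) ht

theorem hasDerivAt_cutoff_smul_fst (hf : Continuous f) (hs : 0 < s) {X X1 : ℝ × ℝ → ℝ}
    (hX0 : ∀ p : ℝ × ℝ, p.2 < f p.1 + s → X p = 0)
    (hX1 : ∀ p : ℝ × ℝ, HasDerivAt (fun t => X (t, p.2)) (X1 p) p.1) {u u1 : ℝ × ℝ → E}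
    (hu : ∀ p : ℝ × ℝ, f p.1 < p.2 → HasDerivAt (fun t => u (t, p.2)) (u1 p) p.1) (p : ℝ × ℝ) :
    HasDerivAt (fun t => X (t, p.2) • u (t, p.2)) (X p • u1 p + X1 p • u p) p.1 := by
  by_cases hp : f p.1 < p.2
  · exact (hX1 p).smul (hu p hp)
  · have hp' : p.2 < f p.1 + s := by linarith [not_lt.1 hp]
    rw [hX0 p hp', deriv_fst_eq_zero_of_low hf hX0 hX1 p hp', zero_smul, zero_smul, add_zero]
    refine (hasDerivAt_const p.1 (0 : E)).congr_of_eventuallyEq ?_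
    filter_upwards [eventually_fst_lt hf hp'] with t ht
    rw [hX0 (t, p.2) ht, zero_smul]

theorem hasDerivAt_cutoff_smul_snd (hs : 0 < s) {X X2 : ℝ × ℝ → ℝ}
    (hX0 : ∀ p : ℝ × ℝ, p.2 < f p.1 + s → X p = 0)
    (hX2 : ∀ p : ℝ × ℝ, HasDerivAt (fun t => X (p.1, t)) (X2 p) p.2) {u u2 : ℝ × ℝ → E}
    (hu : ∀ p : ℝ × ℝ, f p.1 < p.2 → HasDerivAt (fun t => u (p.1, t)) (u2 p) p.2) (p : ℝ × ℝ) :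
    HasDerivAt (fun t => X (p.1, t) • u (p.1, t)) (X p • u2 p + X2 p • u p) p.2 := by
  by_cases hp : f p.1 < p.2
  · exact (hX2 p).smul (hu p hp)
  · have hp' : p.2 < f p.1 + s := by linarith [not_lt.1 hp]
    rw [hX0 p hp', deriv_snd_eq_zero_of_low hX0 hX2 p hp', zero_smul, zero_smul, add_zero]
    refine (hasDerivAt_const p.2 (0 : E)).congr_of_eventuallyEq ?_
    filter_upwards [eventually_snd_lt hp'] with t ht
    rw [hX0 (p.1, t) ht, zero_smul]

theorem IsC2.eq_zero_of_low {X X1 X2 X11 X22 : ℝ × ℝ → ℝ} (hX : IsC2 X X1 X2 X11 X22)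
    (hf : Continuous f) (hX0 : ∀ p : ℝ × ℝ, p.2 < f p.1 + s → X p = 0) (p : ℝ × ℝ)
    (hp : p.2 < f p.1 + s) : X1 p = 0 ∧ X2 p = 0 ∧ X11 p = 0 ∧ X22 p = 0 :=
  ⟨deriv_fst_eq_zero_of_low hf hX0 hX.deriv1 p hp, deriv_snd_eq_zero_of_low hX0 hX.deriv2 p hp,
    deriv_fst_eq_zero_of_low hf (deriv_fst_eq_zero_of_low hf hX0 hX.deriv1) hX.deriv11 p hp,
    deriv_snd_eq_zero_of_low (deriv_snd_eq_zero_of_low hX0 hX.deriv2) hX.deriv22 p hp⟩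

/-- The extension by zero of a cut-off `C²` function is `C²`. -/
theorem IsC2.smul_above {X X1 X2 X11 X22 : ℝ × ℝ → ℝ} (hX : IsC2 X X1 X2 X11 X22)
    (hf : Continuous f) (hs : 0 < s) (hX0 : ∀ p : ℝ × ℝ, p.2 < f p.1 + s → X p = 0)
    {u u1 u2 u11 u22 : ℝ × ℝ → E} (hu : IsC2Above f u u1 u2 u11 u22) :
    IsC2 (fun p => X p • u p) (fun p => X p • u1 p + X1 p • u p)
      (fun p => X p • u2 p + X2 p • u p)
      (fun p => (X p • u11 p + X1 p • u1 p) + (X1 p • u1 p + X11 p • u p))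
      (fun p => (X p • u22 p + X2 p • u2 p) + (X2 p • u2 p + X22 p • u p)) := by
  have h1 := fun p hp => (hX.eq_zero_of_low hf hX0 p hp).1
  have h2 := fun p hp => (hX.eq_zero_of_low hf hX0 p hp).2.1
  have h11 := fun p hp => (hX.eq_zero_of_low hf hX0 p hp).2.2.1
  have h22 := fun p hp => (hX.eq_zero_of_low hf hX0 p hp).2.2.2
  exact
    { cont := continuous_cutoff_smul hf hs hX.cont hX0 hu.cont
      cont1 := (continuous_cutoff_smul hf hs hX.cont hX0 hu.cont1).add
        (continuous_cutoff_smul hf hs hX.cont1 h1 hu.cont)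
      cont2 := (continuous_cutoff_smul hf hs hX.cont hX0 hu.cont2).add
        (continuous_cutoff_smul hf hs hX.cont2 h2 hu.cont)
      cont11 := ((continuous_cutoff_smul hf hs hX.cont hX0 hu.cont11).add
        (continuous_cutoff_smul hf hs hX.cont1 h1 hu.cont1)).add
        ((continuous_cutoff_smul hf hs hX.cont1 h1 hu.cont1).add
        (continuous_cutoff_smul hf hs hX.cont11 h11 hu.cont))
      cont22 := ((continuous_cutoff_smul hf hs hX.cont hX0 hu.cont22).add
        (continuous_cutoff_smul hf hs hX.cont2 h2 hu.cont2)).add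
        ((continuous_cutoff_smul hf hs hX.cont2 h2 hu.cont2).add
        (continuous_cutoff_smul hf hs hX.cont22 h22 hu.cont))
      deriv1 := hasDerivAt_cutoff_smul_fst hf hs hX0 hX.deriv1 hu.deriv1
      deriv2 := hasDerivAt_cutoff_smul_snd hs hX0 hX.deriv2 hu.deriv2
      deriv11 := fun p => (hasDerivAt_cutoff_smul_fst hf hs hX0 hX.deriv1 hu.deriv11 p).add
        (hasDerivAt_cutoff_smul_fst hf hs h1 hX.deriv11 hu.deriv1 p)
      deriv22 := fun p => (hasDerivAt_cutoff_smul_snd hs hX0 hX.deriv2 hu.deriv22 p).add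
        (hasDerivAt_cutoff_smul_snd hs h2 hX.deriv22 hu.deriv2 p) }

end Extension

section LayerIntegral

theorem integral_integral_swap_of_continuous {H : ℝ × ℝ → ℝ} (hH : Continuous H) (L Y : ℝ) :
    ∫ y in (0 : ℝ)..Y, ∫ x in (0 : ℝ)..L, H (x, y)
      = ∫ x in (0 : ℝ)..L, ∫ y in (0 : ℝ)..Y, H (x, y) := by
  have hc : Continuous (Function.uncurry fun y x => H (x, y)) := by
    simp only [Function.uncurry_def]
    fun_prop
  exact intervalIntegral_intervalIntegral_swap
    ((hc.continuousOn.integrableOn_compact (isCompact_uIcc.prod isCompact_uIcc)).mono_set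
      (Set.prod_mono Set.uIoc_subset_uIcc Set.uIoc_subset_uIcc))

theorem integral_le_of_le_on_Icc {h : ℝ → ℝ} (hh : Continuous h) {Y a l c : ℝ} (hY : 0 ≤ Y)
    (hl : 0 ≤ l) (hc : 0 ≤ c) (h1 : ∀ y ∈ Set.Icc 0 Y, a ≤ y → y ≤ a + l → h y ≤ c)
    (h2 : ∀ y ∈ Set.Icc 0 Y, y < a ∨ a + l < y → h y ≤ 0) :
    ∫ y in (0 : ℝ)..Y, h y ≤ l * c := by
  have hint : Integrable ((Set.Icc a (a + l)).indicator fun _ => c) :=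
    (integrable_indicator_iff measurableSet_Icc).2 (integrableOn_const (by simp))
  calc ∫ y in (0 : ℝ)..Y, h y
      ≤ ∫ y in (0 : ℝ)..Y, (Set.Icc a (a + l)).indicator (fun _ => c) y := by
        refine intervalIntegral.integral_mono_on hY (hh.intervalIntegrable _ _)
          hint.intervalIntegrable fun y hy => ?_
        by_cases hy' : y ∈ Set.Icc a (a + l)
        · rw [Set.indicator_of_mem hy']
          exact h1 y hy hy'.1 hy'.2
        · rw [Set.indicator_of_notMem hy']
          refine h2 y hy ?_
          by_contra hcon
          push Not at hcon
          exact hy' hcon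
    _ ≤ ∫ y, (Set.Icc a (a + l)).indicator (fun _ => c) y := by
        rw [intervalIntegral.integral_of_le hY]
        exact setIntegral_le_integral hint
          (.of_forall fun y => Set.indicator_nonneg (fun _ _ => hc) y)
    _ = l * c := by
        rw [integral_indicator measurableSet_Icc]
        simp [hl]

theorem layer_integral_le {H : ℝ × ℝ → ℝ} (hH : Continuous H) {f g : ℝ → ℝ} (hg : Continuous g)
    {L Y l : ℝ} (hL : 0 ≤ L) (hY : 0 ≤ Y) (hl : 0 ≤ l) (hg0 : ∀ x, 0 ≤ g x)
    (h1 : ∀ x y, f x ≤ y → y ≤ f x + l → H (x, y) ≤ g x)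
    (h2 : ∀ x y, y < f x ∨ f x + l < y → H (x, y) ≤ 0) :
    ∫ y in (0 : ℝ)..Y, ∫ x in (0 : ℝ)..L, H (x, y) ≤ l * ∫ x in (0 : ℝ)..L, g x := by
  rw [integral_integral_swap_of_continuous hH, ← intervalIntegral.integral_const_mul]
  refine intervalIntegral.integral_mono_on hL ?_ ((hg.intervalIntegrable _ _).const_mul l)
    fun x _ => ?_
  · exact (intervalIntegral.continuous_parametric_intervalIntegral_of_continuous'
      (f := fun x y => H (x, y)) (by simpa [Function.uncurry_def] using hH) 0 Y).intervalIntegrable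
        _ _
  · exact integral_le_of_le_on_Icc (hH.comp (Continuous.prodMk_right x)) hY hl (hg0 x)
      (fun y _ ha hb => h1 x y ha hb) fun y _ h => h2 x y h

end LayerIntegral

section Caccioppoli

theorem intervalIntegrable_fst_of_continuous {E : Type*} [NormedAddCommGroup E]
    {H : ℝ × ℝ → E} (hH : Continuous H) (a b y : ℝ) :
    IntervalIntegrable (fun x => H (x, y)) volume a b :=
  (hH.comp (Continuous.prodMk_left y)).intervalIntegrable a b

theorem intervalIntegrable_snd_of_continuous {E : Type*} [NormedAddCommGroup E]
    {H : ℝ × ℝ → E} (hH : Continuous H) (a b x : ℝ) :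
    IntervalIntegrable (fun y => H (x, y)) volume a b :=
  (hH.comp (Continuous.prodMk_right x)).intervalIntegrable a b

variable {f : ℝ → ℝ} {s L Y B C : ℝ} {X X1 X2 X11 X22 Z Z1 Z2 Z11 Z22 : ℝ × ℝ → ℝ}

theorem LayerCutoff.integral_bump_mul_laplacian
    (hZ : LayerCutoff f L B s C X X1 X2 X11 X22 Z Z1 Z2 Z11 Z22) (hf : Continuous f) (hs : 0 < s)
    (hf0 : ∀ x, 0 ≤ f x) (hY : ∀ x, f x + B * s < Y) {u u1 u2 u11 u22 : ℝ × ℝ → ℝ}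
    (hu : IsC2Above f u u1 u2 u11 u22)
    (hper : ∀ p : ℝ × ℝ, f p.1 < p.2 → u (p.1 + L, p.2) = u p)
    (hper1 : ∀ p : ℝ × ℝ, f p.1 < p.2 → u1 (p.1 + L, p.2) = u1 p) :
    ∫ y in (0 : ℝ)..Y, ∫ x in (0 : ℝ)..L, Z (x, y) * (u11 (x, y) + u22 (x, y))
      = ∫ y in (0 : ℝ)..Y, ∫ x in (0 : ℝ)..L, (Z11 (x, y) + Z22 (x, y)) * u (x, y) := by
  have hC2 := hZ.isC2_bump
  have z0 : ∀ p : ℝ × ℝ, p.2 < f p.1 + s → Z p = 0 := fun p hp => (hZ.low_bump p hp).1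
  have z1 := fun p hp => (hC2.eq_zero_of_low hf z0 p hp).1
  have z2 := fun p hp => (hC2.eq_zero_of_low hf z0 p hp).2.1
  have z11 := fun p hp => (hC2.eq_zero_of_low hf z0 p hp).2.2.1
  have z22 := fun p hp => (hC2.eq_zero_of_low hf z0 p hp).2.2.2
  have c1 := continuous_cutoff_smul hf hs hC2.cont z0 hu.cont11
  have c2 := continuous_cutoff_smul hf hs hC2.cont z0 hu.cont22
  have c3 := continuous_cutoff_smul hf hs hC2.cont11 z11 hu.cont
  have c4 := continuous_cutoff_smul hf hs hC2.cont22 z22 hu.cont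
  simp only [smul_eq_mul] at c1 c2 c3 c4
  have hT1 : ∀ p : ℝ × ℝ, HasDerivAt (fun t => Z (t, p.2) * u1 (t, p.2) - Z1 (t, p.2) * u (t, p.2))
      (Z p * u11 p - Z11 p * u p) p.1 := fun p => by
    have h1 := hasDerivAt_cutoff_smul_fst hf hs z0 hC2.deriv1 hu.deriv11 p
    have h2 := hasDerivAt_cutoff_smul_fst hf hs z1 hC2.deriv11 hu.deriv1 p
    refine (h1.sub h2).congr_deriv ?_
    simp only [smul_eq_mul]
    ring
  have hT2 : ∀ p : ℝ × ℝ, HasDerivAt (fun t => Z (p.1, t) * u2 (p.1, t) - Z2 (p.1, t) * u (p.1, t))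
      (Z p * u22 p - Z22 p * u p) p.2 := fun p => by
    have h1 := hasDerivAt_cutoff_smul_snd hs z0 hC2.deriv2 hu.deriv22 p
    have h2 := hasDerivAt_cutoff_smul_snd hs z2 hC2.deriv22 hu.deriv2 p
    refine (h1.sub h2).congr_deriv ?_
    simp only [smul_eq_mul]
    ring
  have hA : Continuous fun p => Z p * u11 p - Z11 p * u p := c1.sub c3
  have hB : Continuous fun p => Z p * u22 p - Z22 p * u p := c2.sub c4
  have hfper : ∀ y, Z ((0 : ℝ) + L, y) * u1 ((0 : ℝ) + L, y) - Z1 ((0 : ℝ) + L, y) * u ((0 : ℝ) + L, y)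
      = Z (0, y) * u1 (0, y) - Z1 (0, y) * u (0, y) := fun y => by
    have e1 := hZ.per_bump (0, y)
    have e2 := hZ.per1_bump (0, y)
    simp only at e1 e2
    rw [e1, e2]
    by_cases hy : f 0 < y
    · have e3 := hper (0, y) hy
      have e4 := hper1 (0, y) hy
      simp only at e3 e4
      rw [e3, e4]
    · have hy' : y < f 0 + s := by linarith [not_lt.1 hy]
      rw [z0 (0, y) hy', z1 (0, y) hy']
      simp
  have hI1 : ∀ y, ∫ x in (0 : ℝ)..L, (Z (x, y) * u11 (x, y) - Z11 (x, y) * u (x, y)) = 0 :=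
    fun y => by
      refine (intervalIntegral.integral_eq_sub_of_hasDerivAt
        (f := fun t => Z (t, y) * u1 (t, y) - Z1 (t, y) * u (t, y)) (fun x _ => hT1 (x, y))
        (intervalIntegrable_fst_of_continuous hA 0 L y)).trans ?_
      have := hfper y
      rw [zero_add] at this
      rw [this, sub_self]
  have hI2 : ∀ x, ∫ y in (0 : ℝ)..Y, (Z (x, y) * u22 (x, y) - Z22 (x, y) * u (x, y)) = 0 :=
    fun x => by
      refine (intervalIntegral.integral_eq_sub_of_hasDerivAt
        (f := fun t => Z (x, t) * u2 (x, t) - Z2 (x, t) * u (x, t)) (fun y _ => hT2 (x, y))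
        (intervalIntegrable_snd_of_continuous hB 0 Y x)).trans ?_
      have h0 : (0 : ℝ) < f x + s := by linarith [hf0 x]
      have hY0 : Z (x, Y) = 0 := (hZ.high_bump (x, Y) (hY x)).1
      have hY2 : Z2 (x, Y) = 0 := by
        refine (hC2.deriv2 (x, Y)).unique
          ((hasDerivAt_const Y (0 : ℝ)).congr_of_eventuallyEq ?_)
        filter_upwards [Ioi_mem_nhds (hY x)] with t ht using (hZ.high_bump (x, t) ht).1
      rw [z0 (x, 0) h0, z2 (x, 0) h0, hY0, hY2]
      simp
  have hc5 : Continuous fun p => Z p * (u11 p + u22 p) := by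
    simp only [mul_add]; exact c1.add c2
  have hc6 : Continuous fun p => (Z11 p + Z22 p) * u p := by
    simp only [add_mul]; exact c3.add c4
  have hsum : ∀ y, (∫ x in (0 : ℝ)..L, Z (x, y) * (u11 (x, y) + u22 (x, y)))
      - ∫ x in (0 : ℝ)..L, (Z11 (x, y) + Z22 (x, y)) * u (x, y)
      = ∫ x in (0 : ℝ)..L, (Z (x, y) * u22 (x, y) - Z22 (x, y) * u (x, y)) := fun y => by
    have h := intervalIntegral.integral_add (intervalIntegrable_fst_of_continuous hB 0 L y)
      (intervalIntegrable_fst_of_continuous hA 0 L y)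
    rw [hI1 y, add_zero] at h
    rw [← h, ← intervalIntegral.integral_sub (intervalIntegrable_fst_of_continuous hc5 0 L y)
      (intervalIntegrable_fst_of_continuous hc6 0 L y)]
    exact intervalIntegral.integral_congr fun x _ => by ring
  have i2 : ∀ {H : ℝ × ℝ → ℝ}, Continuous H →
      IntervalIntegrable (fun y => ∫ x in (0 : ℝ)..L, H (x, y)) volume 0 Y := fun {H} hH =>
    (intervalIntegral.continuous_parametric_intervalIntegral_of_continuous'
      (f := fun y x => H (x, y)) (by simp only [Function.uncurry_def]; fun_prop) 0
        L).intervalIntegrable _ _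
  rw [← sub_eq_zero, ← intervalIntegral.integral_sub (i2 hc5) (i2 hc6)]
  simp only [hsum]
  rw [integral_integral_swap_of_continuous hB]
  simp only [hI2, intervalIntegral.integral_zero]

/-- The squared modulus of a complex `C²` function is `C²`. -/
theorem IsC2Above.star_mul_self {w w1 w2 w11 w22 : ℝ × ℝ → ℂ} (hw : IsC2Above f w w1 w2 w11 w22) :
    IsC2Above f (fun p => (star (w p) * w p).re)
      (fun p => (star (w1 p) * w p + star (w p) * w1 p).re)
      (fun p => (star (w2 p) * w p + star (w p) * w2 p).re)
      (fun p => ((star (w11 p) * w p + star (w1 p) * w1 p)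
        + (star (w1 p) * w1 p + star (w p) * w11 p)).re)
      (fun p => ((star (w22 p) * w p + star (w2 p) * w2 p)
        + (star (w2 p) * w2 p + star (w p) * w22 p)).re) := by
  have c0 := hw.cont
  have c1 := hw.cont1
  have c2 := hw.cont2
  have c11 := hw.cont11
  have c22 := hw.cont22
  refine ⟨?_, ?_, ?_, ?_, ?_, fun p hp => ?_, fun p hp => ?_, fun p hp => ?_, fun p hp => ?_⟩
  · exact Complex.continuous_re.comp_continuousOn (c0.star.mul c0)
  · exact Complex.continuous_re.comp_continuousOn ((c1.star.mul c0).add (c0.star.mul c1))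
  · exact Complex.continuous_re.comp_continuousOn ((c2.star.mul c0).add (c0.star.mul c2))
  · exact Complex.continuous_re.comp_continuousOn
      (((c11.star.mul c0).add (c1.star.mul c1)).add ((c1.star.mul c1).add (c0.star.mul c11)))
  · exact Complex.continuous_re.comp_continuousOn
      (((c22.star.mul c0).add (c2.star.mul c2)).add ((c2.star.mul c2).add (c0.star.mul c22)))
  · exact hasDerivAt_re ((hw.deriv1 p hp).star.mul (hw.deriv1 p hp))
  · exact hasDerivAt_re ((hw.deriv2 p hp).star.mul (hw.deriv2 p hp))
  · exact hasDerivAt_re (((hw.deriv11 p hp).star.mul (hw.deriv1 p hp)).add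
      ((hw.deriv1 p hp).star.mul (hw.deriv11 p hp)))
  · exact hasDerivAt_re (((hw.deriv22 p hp).star.mul (hw.deriv2 p hp)).add
      ((hw.deriv2 p hp).star.mul (hw.deriv22 p hp)))

theorem re_star_mul_self (z : ℂ) : (star z * z).re = ‖z‖ ^ 2 := by
  rw [show star z * z = ((‖z‖ : ℂ)) ^ 2 from Complex.conj_mul' z, ← Complex.ofReal_pow,
    Complex.ofReal_re]

/-- Caccioppoli inequality in the layer for quasi-periodic Helmholtz solutions. -/
theorem LayerCutoff.integral_bump_gradient_le
    (hZ : LayerCutoff f L B s C X X1 X2 X11 X22 Z Z1 Z2 Z11 Z22) (hf : Continuous f) (hs : 0 < s)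
    (hC : 0 ≤ C) (hB : 0 ≤ B) (hL : 0 ≤ L) (hY0 : 0 ≤ Y)
    (hf0 : ∀ x, 0 ≤ f x) (hY : ∀ x, f x + B * s < Y) {w w1 w2 w11 w22 : ℝ × ℝ → ℂ}
    (hw : IsC2Above f w w1 w2 w11 w22) {ν : ℂ} (hν : ‖ν‖ = 1)
    (hper : ∀ p : ℝ × ℝ, f p.1 < p.2 → w (p.1 + L, p.2) = ν * w p)
    (hper1 : ∀ p : ℝ × ℝ, f p.1 < p.2 → w1 (p.1 + L, p.2) = ν * w1 p) {k : ℝ}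
    (heq : ∀ p : ℝ × ℝ, f p.1 < p.2 → w11 p + w22 p + (k : ℂ) ^ 2 * w p = 0) {g : ℝ → ℝ}
    (hg : Continuous g) (hg0 : ∀ x, 0 ≤ g x)
    (hwg : ∀ x y, f x < y → y ≤ f x + B * s → ‖w (x, y)‖ ^ 2 ≤ g x) :
    ∫ y in (0 : ℝ)..Y, ∫ x in (0 : ℝ)..L, Z (x, y) * (‖w1 (x, y)‖ ^ 2 + ‖w2 (x, y)‖ ^ 2)
      ≤ B * s * ((C / s ^ 2 + 2 * k ^ 2) / 2) * ∫ x in (0 : ℝ)..L, g x := by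
  have hC2 := hZ.isC2_bump
  have z0 : ∀ p : ℝ × ℝ, p.2 < f p.1 + s → Z p = 0 := fun p hp => (hZ.low_bump p hp).1
  have hνs : star ν * ν = 1 := by
    rw [show star ν * ν = ((‖ν‖ : ℂ)) ^ 2 from Complex.conj_mul' ν, hν]; simp
  have hphase : ∀ a b : ℂ, star (ν * a) * (ν * b) = star a * b := fun a b => by
    rw [star_mul', show star ν * star a * (ν * b) = star ν * ν * (star a * b) by ring, hνs, one_mul]
  have hint := hZ.integral_bump_mul_laplacian hf hs hf0 hY hw.star_mul_self
    (fun p hp => by simp only [hper p hp, hphase])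
    (fun p hp => by simp only [hper p hp, hper1 p hp, hphase])
  have hlap : ∀ p : ℝ × ℝ, f p.1 < p.2 →
      ((star (w11 p) * w p + star (w1 p) * w1 p) + (star (w1 p) * w1 p + star (w p) * w11 p)).re
      + ((star (w22 p) * w p + star (w2 p) * w2 p) + (star (w2 p) * w2 p + star (w p) * w22 p)).re
      = 2 * (‖w1 p‖ ^ 2 + ‖w2 p‖ ^ 2) - 2 * k ^ 2 * ‖w p‖ ^ 2 := fun p hp => by
    have e : w11 p = -w22 p - (k : ℂ) ^ 2 * w p := by linear_combination heq p hp
    have hk : star ((k : ℂ) ^ 2) = (k : ℂ) ^ 2 := by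
      rw [star_pow]; congr 1; exact Complex.conj_ofReal k
    rw [← Complex.add_re, ← re_star_mul_self, ← re_star_mul_self, ← re_star_mul_self]
    have : 2 * ((star (w1 p) * w1 p).re + (star (w2 p) * w2 p).re)
        - 2 * k ^ 2 * (star (w p) * w p).re
        = (2 * (star (w1 p) * w1 p + star (w2 p) * w2 p)
          - ((2 * k ^ 2 : ℝ) : ℂ) * (star (w p) * w p)).re := by
      rw [Complex.sub_re, Complex.re_ofReal_mul]
      simp [Complex.mul_re]
    rw [this]
    congr 1
    rw [e, star_sub, star_neg, star_mul', hk]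
    push_cast
    ring
  have c1 : Continuous fun p => Z p * (‖w1 p‖ ^ 2 + ‖w2 p‖ ^ 2) :=
    continuous_cutoff_smul hf hs hC2.cont z0
      ((hw.cont1.norm.pow 2).add (hw.cont2.norm.pow 2))
  have c0 : Continuous fun p => (k ^ 2 * Z p) * ‖w p‖ ^ 2 :=
    continuous_cutoff_smul hf hs (hC2.cont.const_mul (k ^ 2))
      (fun p hp => by rw [z0 p hp, mul_zero]) (hw.cont.norm.pow 2)
  have c2 : Continuous fun p => (Z11 p + Z22 p) * ‖w p‖ ^ 2 :=
    continuous_cutoff_smul hf hs (hC2.cont11.add hC2.cont22)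
      (fun p hp => (hZ.low_bump p hp).2) (hw.cont.norm.pow 2)
  have i1 : ∀ {H : ℝ × ℝ → ℝ}, Continuous H → ∀ y,
      IntervalIntegrable (fun x => H (x, y)) volume 0 L := fun {H} hH y =>
    intervalIntegrable_fst_of_continuous hH 0 L y
  have i2 : ∀ {H : ℝ × ℝ → ℝ}, Continuous H →
      IntervalIntegrable (fun y => ∫ x in (0 : ℝ)..L, H (x, y)) volume 0 Y := fun {H} hH =>
    (intervalIntegral.continuous_parametric_intervalIntegral_of_continuous'
      (f := fun y x => H (x, y)) (by simp only [Function.uncurry_def]; fun_prop) 0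
        L).intervalIntegrable _ _
  have e1 : ∀ x y, Z (x, y) * (‖w1 (x, y)‖ ^ 2 + ‖w2 (x, y)‖ ^ 2)
      = 1 / 2 * (Z (x, y) * (((star (w11 (x, y)) * w (x, y) + star (w1 (x, y)) * w1 (x, y))
        + (star (w1 (x, y)) * w1 (x, y) + star (w (x, y)) * w11 (x, y))).re
      + ((star (w22 (x, y)) * w (x, y) + star (w2 (x, y)) * w2 (x, y))
        + (star (w2 (x, y)) * w2 (x, y) + star (w (x, y)) * w22 (x, y))).re))
        + k ^ 2 * Z (x, y) * ‖w (x, y)‖ ^ 2 := fun x y => by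
    by_cases hp : f x < y
    · rw [hlap (x, y) hp]; ring
    · have hz : Z (x, y) = 0 := z0 (x, y) (show y < f x + s by linarith [not_lt.1 hp])
      rw [hz]; ring
  have c3 : Continuous fun p => Z p * (((star (w11 p) * w p + star (w1 p) * w1 p)
        + (star (w1 p) * w1 p + star (w p) * w11 p)).re
      + ((star (w22 p) * w p + star (w2 p) * w2 p)
        + (star (w2 p) * w2 p + star (w p) * w22 p)).re) :=
    continuous_cutoff_smul hf hs hC2.cont z0
      (hw.star_mul_self.cont11.add hw.star_mul_self.cont22)
  have hrew : ∫ y in (0 : ℝ)..Y, ∫ x in (0 : ℝ)..L,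
        Z (x, y) * (‖w1 (x, y)‖ ^ 2 + ‖w2 (x, y)‖ ^ 2)
      = ∫ y in (0 : ℝ)..Y, ∫ x in (0 : ℝ)..L,
        (1 / 2 * ((Z11 (x, y) + Z22 (x, y)) * ‖w (x, y)‖ ^ 2)
          + k ^ 2 * Z (x, y) * ‖w (x, y)‖ ^ 2) := by
    simp only [re_star_mul_self] at hint
    have a1 : ∀ y, ∫ x in (0 : ℝ)..L,
        (1 / 2 * ((Z11 (x, y) + Z22 (x, y)) * ‖w (x, y)‖ ^ 2)
          + k ^ 2 * Z (x, y) * ‖w (x, y)‖ ^ 2)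
        = 1 / 2 * (∫ x in (0 : ℝ)..L, (Z11 (x, y) + Z22 (x, y)) * ‖w (x, y)‖ ^ 2)
          + ∫ x in (0 : ℝ)..L, k ^ 2 * Z (x, y) * ‖w (x, y)‖ ^ 2 := fun y => by
      rw [intervalIntegral.integral_add ((i1 c2 y).const_mul _) (i1 c0 y),
        intervalIntegral.integral_const_mul]
    simp only [e1, a1]
    have a2 : ∀ y, ∫ x in (0 : ℝ)..L,
        (1 / 2 * (Z (x, y) * (((star (w11 (x, y)) * w (x, y) + star (w1 (x, y)) * w1 (x, y))
        + (star (w1 (x, y)) * w1 (x, y) + star (w (x, y)) * w11 (x, y))).re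
      + ((star (w22 (x, y)) * w (x, y) + star (w2 (x, y)) * w2 (x, y))
        + (star (w2 (x, y)) * w2 (x, y) + star (w (x, y)) * w22 (x, y))).re))
        + k ^ 2 * Z (x, y) * ‖w (x, y)‖ ^ 2)
        = 1 / 2 * (∫ x in (0 : ℝ)..L,
          (Z (x, y) * (((star (w11 (x, y)) * w (x, y) + star (w1 (x, y)) * w1 (x, y))
        + (star (w1 (x, y)) * w1 (x, y) + star (w (x, y)) * w11 (x, y))).re
      + ((star (w22 (x, y)) * w (x, y) + star (w2 (x, y)) * w2 (x, y))
        + (star (w2 (x, y)) * w2 (x, y) + star (w (x, y)) * w22 (x, y))).re)))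
          + ∫ x in (0 : ℝ)..L, k ^ 2 * Z (x, y) * ‖w (x, y)‖ ^ 2 := fun y => by
      rw [intervalIntegral.integral_add ((i1 c3 y).const_mul _) (i1 c0 y),
        intervalIntegral.integral_const_mul]
    simp only [a2]
    rw [intervalIntegral.integral_add ((i2 c3).const_mul _) (i2 c0),
      intervalIntegral.integral_add ((i2 c2).const_mul _) (i2 c0),
      intervalIntegral.integral_const_mul, intervalIntegral.integral_const_mul, hint]
  rw [hrew, mul_assoc, ← intervalIntegral.integral_const_mul]
  have c7 : Continuous fun p => 1 / 2 * ((Z11 p + Z22 p) * ‖w p‖ ^ 2) + k ^ 2 * Z p * ‖w p‖ ^ 2 :=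
    (c2.const_mul (1 / 2)).add c0
  refine layer_integral_le (f := f) c7 (hg.const_mul _) hL hY0
    (by positivity) (fun x => mul_nonneg (by positivity) (hg0 x)) (fun x y h1 h2 => ?_)
    fun x y h => ?_
  · by_cases hp : y < f x + s
    · rw [(hZ.low_bump (x, y) hp).2, z0 (x, y) hp]
      have := hg0 x
      simp only [zero_mul, mul_zero, add_zero]
      positivity
    · have hlt : f x < y := by linarith [not_lt.1 hp]
      have b1 := (le_abs_self _).trans (hZ.bound_lap_bump (x, y))
      have b2 := hZ.le_one_bump (x, y)
      have b3 := hwg x y hlt h2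
      have b4 : 0 ≤ ‖w (x, y)‖ ^ 2 := sq_nonneg _
      have b5 : (Z11 (x, y) + Z22 (x, y)) * ‖w (x, y)‖ ^ 2 ≤ C / s ^ 2 * ‖w (x, y)‖ ^ 2 :=
        mul_le_mul_of_nonneg_right b1 b4
      have b6 : k ^ 2 * Z (x, y) * ‖w (x, y)‖ ^ 2 ≤ k ^ 2 * 1 * ‖w (x, y)‖ ^ 2 := by gcongr
      have b7 : (C / s ^ 2 + 2 * k ^ 2) / 2 * ‖w (x, y)‖ ^ 2
          ≤ (C / s ^ 2 + 2 * k ^ 2) / 2 * g x := by gcongr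
      linarith
  · rcases h with h | h
    · have h' : y < f x + s := by linarith
      rw [(hZ.low_bump (x, y) h').2, z0 (x, y) h']
      simp
    · rw [(hZ.high_bump (x, y) h).2, (hZ.high_bump (x, y) h).1]
      simp

end Caccioppoli

section Modes

variable {L a : ℝ} {ν : ℂ} {lam : ℤ → ℝ} {φ : ℤ → ℝ → ℂ}

/-- Quasi-periodic exponentials on an interval of length `L` with phase `a`. -/
structure IsModeFamily (L a : ℝ) (ν : ℂ) (lam : ℤ → ℝ) (φ : ℤ → ℝ → ℂ) : Prop where
  pos : 0 < L
  phase : ν = Complex.exp (Complex.I * a * L)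
  freq : ∀ j : ℤ, lam j = a + 2 * Real.pi * j / L
  mode : ∀ (j : ℤ) (x : ℝ), φ j x = Complex.exp (Complex.I * lam j * x) / Real.sqrt L

namespace IsModeFamily

theorem norm_phase (h : IsModeFamily L a ν lam φ) : ‖ν‖ = 1 := by
  rw [h.phase, show Complex.I * a * L = ((a * L : ℝ) : ℂ) * Complex.I by push_cast; ring]
  exact Complex.norm_exp_ofReal_mul_I _

theorem star_phase_mul (h : IsModeFamily L a ν lam φ) : ν * star ν = 1 := by
  rw [show ν * star ν = ((‖ν‖ : ℂ)) ^ 2 from Complex.mul_conj' ν, h.norm_phase]; simp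

theorem norm_mode (h : IsModeFamily L a ν lam φ) (j : ℤ) (x : ℝ) : ‖φ j x‖ = 1 / Real.sqrt L := by
  rw [h.mode, show Complex.I * lam j * x = ((lam j * x : ℝ) : ℂ) * Complex.I by push_cast; ring,
    norm_div, Complex.norm_exp_ofReal_mul_I, Complex.norm_real, Real.norm_eq_abs,
    abs_of_nonneg (Real.sqrt_nonneg L)]

theorem hasDerivAt (h : IsModeFamily L a ν lam φ) (j : ℤ) (x : ℝ) :
    HasDerivAt (φ j) (Complex.I * lam j * φ j x) x := by
  rw [show φ j = fun x : ℝ => Complex.exp (Complex.I * lam j * x) / Real.sqrt L from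
    funext (h.mode j)]
  have h1 : HasDerivAt (fun x : ℝ => Complex.I * lam j * (x : ℂ)) (Complex.I * lam j) x := by
    simpa using (Complex.ofRealCLM.hasDerivAt (x := x)).const_mul (Complex.I * (lam j : ℂ))
  refine (h1.cexp.div_const _).congr_deriv ?_
  ring

theorem continuous (h : IsModeFamily L a ν lam φ) (j : ℤ) : Continuous (φ j) :=
  continuous_iff_continuousAt.2 fun x => (h.hasDerivAt j x).continuousAt

theorem hasDerivAt_star (h : IsModeFamily L a ν lam φ) (j : ℤ) (x : ℝ) :
    HasDerivAt (fun x => star (φ j x)) (-(Complex.I * lam j) * star (φ j x)) x := by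
  refine (h.hasDerivAt j x).star.congr_deriv ?_
  rw [star_mul', star_mul']
  simp

theorem add_period (h : IsModeFamily L a ν lam φ) (j : ℤ) (x : ℝ) :
    φ j (x + L) = ν * φ j x := by
  have hL : (L : ℂ) ≠ 0 := by exact_mod_cast h.pos.ne'
  rw [h.mode, h.mode, h.phase, mul_div_assoc', ← Complex.exp_add]
  congr 1
  rw [Complex.exp_eq_exp_iff_exists_int]
  refine ⟨j, ?_⟩
  rw [h.freq]
  push_cast
  field_simp
  ring

theorem mode_mul_star (h : IsModeFamily L a ν lam φ) (i j : ℤ) (x : ℝ) :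
    φ i x * star (φ j x) = Complex.exp (2 * Real.pi * Complex.I * (i - j : ℤ) * x / L) / L := by
  have hL : (L : ℂ) ≠ 0 := by exact_mod_cast h.pos.ne'
  have hs : (Real.sqrt L : ℂ) * Real.sqrt L = L := by
    exact_mod_cast Real.mul_self_sqrt h.pos.le
  have e : star (φ j x) = Complex.exp (-(Complex.I * lam j * x)) / Real.sqrt L := by
    rw [h.mode, star_div₀]
    congr 1
    · rw [show star (Complex.exp (Complex.I * lam j * x))
        = (starRingEnd ℂ) (Complex.exp (Complex.I * lam j * x)) from rfl, ← Complex.exp_conj]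
      simp
    · exact Complex.conj_ofReal _
  rw [e, h.mode, div_mul_div_comm, hs, ← Complex.exp_add]
  congr 2
  rw [h.freq, h.freq]
  push_cast
  field_simp
  ring

theorem integral_mode_mul_star (h : IsModeFamily L a ν lam φ) (i j : ℤ) :
    ∫ x in (0 : ℝ)..L, φ i x * star (φ j x) = if i = j then 1 else 0 := by
  have hL : (L : ℂ) ≠ 0 := by exact_mod_cast h.pos.ne'
  simp only [h.mode_mul_star]
  split_ifs with hij
  · subst hij
    simp [hL]
  · have hc : (2 * Real.pi * Complex.I * (i - j : ℤ) / L : ℂ) ≠ 0 := by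
      have : ((i - j : ℤ) : ℂ) ≠ 0 := by exact_mod_cast sub_ne_zero.2 hij
      have hpi : (Real.pi : ℂ) ≠ 0 := by exact_mod_cast Real.pi_ne_zero
      simp [hpi, hL, Complex.I_ne_zero]
      exact_mod_cast this
    rw [intervalIntegral.integral_div]
    have : ∀ x : ℝ, (2 * Real.pi * Complex.I * (i - j : ℤ) * x / L : ℂ)
        = (2 * Real.pi * Complex.I * (i - j : ℤ) / L : ℂ) * x := fun x => by ring
    simp only [this]
    rw [integral_exp_mul_complex hc, div_mul_cancel₀ _ hL,
      show (2 * Real.pi * Complex.I * (i - j : ℤ) : ℂ) = (i - j : ℤ) * (2 * Real.pi * Complex.I) by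
        ring, Complex.exp_int_mul_two_pi_mul_I]
    simp

/-- Two integrations by parts against a mode. -/
theorem integral_second_deriv (h : IsModeFamily L a ν lam φ) {g g1 g11 : ℝ → ℂ}
    (hg : ∀ x, HasDerivAt g (g1 x) x) (hg1 : ∀ x, HasDerivAt g1 (g11 x) x) (hc : Continuous g11)
    (hp : g L = ν * g 0) (hp1 : g1 L = ν * g1 0) (j : ℤ) :
    ∫ x in (0 : ℝ)..L, g11 x * star (φ j x)
      = -((lam j ^ 2 : ℝ) : ℂ) * ∫ x in (0 : ℝ)..L, g x * star (φ j x) := by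
  have hcφ : Continuous fun x => star (φ j x) := (h.continuous j).star
  have hcg : Continuous g := continuous_iff_continuousAt.2 fun x => (hg x).continuousAt
  have hd : ∀ x, HasDerivAt
      (fun x => g1 x * star (φ j x) + Complex.I * lam j * (g x * star (φ j x)))
      (g11 x * star (φ j x) + ((lam j ^ 2 : ℝ) : ℂ) * (g x * star (φ j x))) x := fun x => by
    refine (((hg1 x).mul (h.hasDerivAt_star j x)).add
      (((hg x).mul (h.hasDerivAt_star j x)).const_mul (Complex.I * (lam j : ℂ)))).congr_deriv ?_
    push_cast
    linear_combination (-(lam j : ℂ) ^ 2 * g x * star (φ j x)) * Complex.I_sq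
  have hi1 : IntervalIntegrable (fun x => g11 x * star (φ j x)) volume 0 L :=
    (hc.mul hcφ).intervalIntegrable 0 L
  have hi2 : IntervalIntegrable (fun x => ((lam j ^ 2 : ℝ) : ℂ) * (g x * star (φ j x)))
      volume 0 L := (continuous_const.mul (hcg.mul hcφ)).intervalIntegrable 0 L
  have hφL : star (φ j L) = star ν * star (φ j 0) := by
    have := h.add_period j 0
    rw [zero_add] at this
    rw [this, star_mul']
  have h1 := intervalIntegral.integral_eq_sub_of_hasDerivAt (fun x _ => hd x) (hi1.add hi2)
  rw [intervalIntegral.integral_add hi1 hi2, intervalIntegral.integral_const_mul, hp, hp1, hφL] at h1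
  linear_combination h1 + (g1 0 * star (φ j 0)
    + Complex.I * lam j * (g 0 * star (φ j 0))) * h.star_phase_mul

theorem norm_integral_mul_star_le (h : IsModeFamily L a ν lam φ) {g : ℝ → ℂ} {C : ℝ}
    (hg : ∀ x ∈ Set.Icc 0 L, ‖g x‖ ≤ C) (j : ℤ) :
    ‖∫ x in (0 : ℝ)..L, g x * star (φ j x)‖ ≤ C * Real.sqrt L := by
  have hs : Real.sqrt L ≠ 0 := (Real.sqrt_pos.2 h.pos).ne'
  refine (intervalIntegral.norm_integral_le_of_norm_le_const (C := C * (1 / Real.sqrt L))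
    fun x hx => ?_).trans (le_of_eq ?_)
  · rw [Set.uIoc_of_le h.pos.le] at hx
    rw [norm_mul, norm_star, h.norm_mode]
    exact mul_le_mul_of_nonneg_right (hg x ⟨hx.1.le, hx.2⟩) (by positivity)
  · rw [sub_zero, abs_of_pos h.pos]
    nth_rewrite 2 [← Real.mul_self_sqrt h.pos.le]
    field_simp

theorem norm_coeff_le (h : IsModeFamily L a ν lam φ) {g g1 g11 : ℝ → ℂ} {C : ℝ}
    (hg : ∀ x, HasDerivAt g (g1 x) x) (hg1 : ∀ x, HasDerivAt g1 (g11 x) x) (hc : Continuous g11)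
    (hp : g L = ν * g 0) (hp1 : g1 L = ν * g1 0) (hC : ∀ x ∈ Set.Icc 0 L, ‖g x‖ ≤ C)
    (hC11 : ∀ x ∈ Set.Icc 0 L, ‖g11 x‖ ≤ C) (j : ℤ) :
    ‖∫ x in (0 : ℝ)..L, g x * star (φ j x)‖ ≤ 2 * C * Real.sqrt L * (1 + lam j ^ 2)⁻¹ := by
  have h1 := h.norm_integral_mul_star_le hC j
  have h2 := h.norm_integral_mul_star_le hC11 j
  rw [h.integral_second_deriv hg hg1 hc hp hp1 j, norm_mul, norm_neg, Complex.norm_real,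
    Real.norm_eq_abs, abs_of_nonneg (sq_nonneg (lam j))] at h2
  rw [← div_eq_mul_inv, le_div_iff₀ (by positivity)]
  linarith

theorem summable_inv (h : IsModeFamily L a ν lam φ) :
    Summable fun j : ℤ => (1 + lam j ^ 2)⁻¹ := by
  have hb : 0 < 2 * Real.pi / L := div_pos Real.two_pi_pos h.pos
  have h2 := (Real.summable_one_div_int_pow.2 (le_refl 2)).mul_left
    (2 * (1 + a ^ 2) / (2 * Real.pi / L) ^ 2)
  refine h2.of_norm_bounded_eventually ?_
  have hfin : ∀ᶠ j : ℤ in Filter.cofinite, j ≠ 0 :=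
    (Set.finite_singleton (0 : ℤ)).compl_mem_cofinite
  filter_upwards [hfin] with j hj
  have hj' : (j : ℝ) ≠ 0 := by exact_mod_cast hj
  rw [Real.norm_eq_abs, abs_of_pos (by positivity), inv_le_iff_one_le_mul₀ (by positivity)]
  have e : 2 * Real.pi / L * j = lam j - a := by rw [h.freq]; ring
  have e2 : (2 * Real.pi / L) ^ 2 * (j : ℝ) ^ 2 ≤ 2 * (1 + a ^ 2) * (1 + lam j ^ 2) := by
    rw [← mul_pow, e]
    nlinarith [sq_nonneg (lam j + a), mul_nonneg (sq_nonneg a) (sq_nonneg (lam j))]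
  rw [div_mul_div_comm, mul_one, div_mul_eq_mul_div, le_div_iff₀ (by positivity), one_mul]
  exact e2

/-- Uniform quality of the Fourier expansion of a quasi-periodic `C²` function. -/
theorem hasSum_coeff (h : IsModeFamily L a ν lam φ) {g g1 g11 : ℝ → ℂ}
    (hg : ∀ x, HasDerivAt g (g1 x) x) (hg1 : ∀ x, HasDerivAt g1 (g11 x) x) (hc : Continuous g11)
    (hp : ∀ x, g (x + L) = ν * g x) (hp1 : ∀ x, g1 (x + L) = ν * g1 x) (x : ℝ) :
    HasSum (fun j => (∫ t in (0 : ℝ)..L, g t * star (φ j t)) * φ j x) (g x) := by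
  have : Fact (0 < L) := ⟨h.pos⟩
  have hL : (L : ℂ) ≠ 0 := by exact_mod_cast h.pos.ne'
  have hs : (Real.sqrt L : ℂ) * Real.sqrt L = L := by
    exact_mod_cast Real.mul_self_sqrt h.pos.le
  have hs0 : (Real.sqrt L : ℂ) ≠ 0 := by exact_mod_cast (Real.sqrt_pos.2 h.pos).ne'
  have hcg : Continuous g := continuous_iff_continuousAt.2 fun x => (hg x).continuousAt
  have hper : Function.Periodic (fun x : ℝ => g x * Complex.exp (-(Complex.I * a * x))) L :=
    fun x => by
      have : Complex.exp (-(Complex.I * a * (x + L : ℝ))) * ν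
          = Complex.exp (-(Complex.I * a * x)) := by
        rw [h.phase, ← Complex.exp_add]
        congr 1
        push_cast
        ring
      simp only
      rw [hp, ← this]
      ring
  have hlc : Continuous hper.lift := by
    refine continuous_coinduced_dom.2 ?_
    change Continuous fun x : ℝ => g x * Complex.exp (-(Complex.I * a * x))
    fun_prop
  have hstar : ∀ (j : ℤ) (t : ℝ), star (φ j t)
      = Complex.exp (-(Complex.I * lam j * t)) / Real.sqrt L := fun j t => by
    rw [h.mode, star_div₀]
    congr 1
    · rw [show star (Complex.exp (Complex.I * lam j * t))
        = (starRingEnd ℂ) (Complex.exp (Complex.I * lam j * t)) from rfl, ← Complex.exp_conj]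
      simp
    · exact Complex.conj_ofReal _
  have hcoef : ∀ j : ℤ, fourierCoeff hper.lift j
      = (1 / Real.sqrt L : ℂ) * ∫ t in (0 : ℝ)..L, g t * star (φ j t) := fun j => by
    rw [fourierCoeff_eq_intervalIntegral _ j 0, zero_add, ← intervalIntegral.integral_smul,
      ← intervalIntegral.integral_const_mul]
    refine intervalIntegral.integral_congr fun t _ => ?_
    simp only [Function.Periodic.lift_coe, fourier_coe_apply, hstar, smul_eq_mul,
      Complex.real_smul]
    rw [show Complex.exp (-(Complex.I * lam j * t))
      = Complex.exp (2 * Real.pi * Complex.I * (-j : ℤ) * t / L)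
        * Complex.exp (-(Complex.I * a * t)) by
      rw [← Complex.exp_add, h.freq]; congr 1; push_cast; field_simp; ring]
    push_cast
    field_simp
    rw [← hs]
    ring
  have hsum : Summable (fourierCoeff (⟨hper.lift, hlc⟩ : C(AddCircle L, ℂ))) := by
    obtain ⟨C₁, hC₁⟩ := isCompact_Icc.exists_bound_of_continuousOn (s := Set.Icc 0 L)
      hcg.continuousOn
    obtain ⟨C₂, hC₂⟩ := isCompact_Icc.exists_bound_of_continuousOn (s := Set.Icc 0 L)
      hc.continuousOn
    refine (h.summable_inv.mul_left (‖(1 / Real.sqrt L : ℂ)‖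
      * (2 * max C₁ C₂ * Real.sqrt L))).of_norm_bounded fun j => ?_
    have e : fourierCoeff (⟨hper.lift, hlc⟩ : C(AddCircle L, ℂ)) j = fourierCoeff hper.lift j := rfl
    rw [e, hcoef, norm_mul, mul_assoc]
    have hp0 := hp 0
    have hp10 := hp1 0
    rw [zero_add] at hp0 hp10
    exact mul_le_mul_of_nonneg_left (h.norm_coeff_le hg hg1 hc hp0 hp10
      (fun x hx => (hC₁ x hx).trans (le_max_left _ _))
      (fun x hx => (hC₂ x hx).trans (le_max_right _ _)) j) (norm_nonneg _)
  have hmain := (has_pointwise_sum_fourier_series_of_summable hsum (x : AddCircle L)).mul_right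
    (Complex.exp (Complex.I * a * x))
  have hval : (⟨hper.lift, hlc⟩ : C(AddCircle L, ℂ)) (x : AddCircle L)
      * Complex.exp (Complex.I * a * x) = g x := by
    change g x * Complex.exp (-(Complex.I * a * x)) * Complex.exp (Complex.I * a * x) = g x
    rw [mul_assoc, ← Complex.exp_add]
    simp
  rw [hval] at hmain
  refine hmain.congr_fun fun j => ?_
  have e : fourierCoeff (⟨hper.lift, hlc⟩ : C(AddCircle L, ℂ)) j = fourierCoeff hper.lift j := rfl
  rw [e, hcoef, fourier_coe_apply, h.mode, smul_eq_mul,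
    show Complex.exp (Complex.I * lam j * x) = Complex.exp (2 * Real.pi * Complex.I * j * x / L)
      * Complex.exp (Complex.I * a * x) by
        rw [← Complex.exp_add, h.freq]; congr 1; push_cast; field_simp; ring]
  ring

end IsModeFamily

end Modes

section Expansion

variable {L a : ℝ} {ν : ℂ} {lam : ℤ → ℝ} {φ : ℤ → ℝ → ℂ}

namespace IsModeFamily

theorem coeff_eq_of_tendsto (h : IsModeFamily L a ν lam φ) {g : ℝ → ℂ} (hg : Continuous g)
    {b : ℤ → ℂ} (ht : Filter.Tendsto
      (fun s : Finset ℤ => ∫ x in (0 : ℝ)..L, ‖g x - ∑ j ∈ s, b j * φ j x‖ ^ 2)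
      Filter.atTop (nhds 0)) (j : ℤ) :
    ∫ x in (0 : ℝ)..L, g x * star (φ j x) = b j := by
  have hs : 0 < Real.sqrt L := Real.sqrt_pos.2 h.pos
  have hcφ : ∀ i, Continuous (φ i) := h.continuous
  have hcP : ∀ s : Finset ℤ, Continuous fun x => ∑ i ∈ s, b i * φ i x := fun s =>
    continuous_finsetSum s fun i _ => continuous_const.mul (hcφ i)
  have hcS : Continuous fun x => star (φ j x) := (hcφ j).star
  have key : ∀ δ : ℝ, 0 < δ →
      ‖(∫ x in (0 : ℝ)..L, g x * star (φ j x)) - b j‖ ≤ δ * ((L + 1) / Real.sqrt L) := by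
    intro δ hδ
    have hev := (ht.eventually (gt_mem_nhds (show (0 : ℝ) < δ ^ 2 by positivity))).and
      (Filter.eventually_ge_atTop {j})
    obtain ⟨s, hs1, hs2⟩ := hev.exists
    have hjs : j ∈ s := hs2 (Finset.mem_singleton_self j)
    have hP := hcP s
    have e1 : ∫ x in (0 : ℝ)..L, (∑ i ∈ s, b i * φ i x) * star (φ j x) = b j := by
      simp only [Finset.sum_mul, mul_assoc]
      have hi : ∀ i ∈ s, IntervalIntegrable (fun x => b i * (φ i x * star (φ j x))) volume 0 L :=
        fun i _ => (continuous_const.mul ((hcφ i).mul hcS)).intervalIntegrable 0 L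
      rw [intervalIntegral.integral_finsetSum hi]
      simp only [intervalIntegral.integral_const_mul, h.integral_mode_mul_star]
      simp [hjs]
    have i1 : IntervalIntegrable (fun x => g x * star (φ j x)) volume 0 L :=
      Continuous.intervalIntegrable (by fun_prop) 0 L
    have i2 : IntervalIntegrable (fun x => (∑ i ∈ s, b i * φ i x) * star (φ j x)) volume 0 L :=
      (hP.mul hcS).intervalIntegrable 0 L
    have e : (∫ x in (0 : ℝ)..L, g x * star (φ j x)) - b j
        = ∫ x in (0 : ℝ)..L, (g x - ∑ i ∈ s, b i * φ i x) * star (φ j x) := by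
      simp only [sub_mul]
      rw [intervalIntegral.integral_sub i1 i2, e1]
    rw [e]
    have hgc : Continuous fun x => g x - ∑ i ∈ s, b i * φ i x := hg.sub hP
    have hgc2 : Continuous fun x => 1 / δ * ‖g x - ∑ i ∈ s, b i * φ i x‖ ^ 2 :=
      continuous_const.mul (hgc.norm.pow 2)
    refine (intervalIntegral.norm_integral_le_of_norm_le h.pos.le
      (g := fun x => (δ + 1 / δ * ‖g x - ∑ i ∈ s, b i * φ i x‖ ^ 2) * (1 / Real.sqrt L))
      (Filter.Eventually.of_forall fun x _ => ?_)
      (((continuous_const.add hgc2).mul continuous_const).intervalIntegrable 0 L)).trans ?_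
    · rw [norm_mul, norm_star, h.norm_mode]
      refine mul_le_mul_of_nonneg_right ?_ (by positivity)
      set r := ‖g x - ∑ i ∈ s, b i * φ i x‖
      have : δ + 1 / δ * r ^ 2 - r = ((δ - r) ^ 2 + δ * r) / δ := by field_simp; ring
      have h0 : 0 ≤ r := norm_nonneg _
      have : 0 ≤ δ + 1 / δ * r ^ 2 - r := by rw [this]; positivity
      linarith
    · rw [intervalIntegral.integral_mul_const,
        intervalIntegral.integral_add (continuous_const.intervalIntegrable 0 L)
          (hgc2.intervalIntegrable 0 L), intervalIntegral.integral_const_mul,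
        intervalIntegral.integral_const, sub_zero, smul_eq_mul, mul_one_div, ← mul_div_assoc]
      refine div_le_div_of_nonneg_right ?_ hs.le
      have : 1 / δ * ∫ x in (0 : ℝ)..L, ‖g x - ∑ i ∈ s, b i * φ i x‖ ^ 2 ≤ 1 / δ * δ ^ 2 := by
        gcongr
      have e3 : 1 / δ * δ ^ 2 = δ := by field_simp
      linarith
  rw [← sub_eq_zero, ← norm_le_zero_iff]
  refine le_of_forall_pos_le_add fun η hη => ?_
  have hL1 : 0 < (L + 1) / Real.sqrt L := div_pos (by linarith [h.pos]) hs
  have := key (η / ((L + 1) / Real.sqrt L)) (div_pos hη hL1)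
  rwa [div_mul_cancel₀ _ hL1.ne', ← zero_add η] at this

/-- The mode coefficients of a quasi-periodic `C²` field are differentiable. -/
theorem hasDerivAt_coeff (h : IsModeFamily L a ν lam φ) {W W2 : ℝ × ℝ → ℂ} (hW : Continuous W)
    (hW2 : Continuous W2) (hd : ∀ p : ℝ × ℝ, HasDerivAt (fun t => W (p.1, t)) (W2 p) p.2)
    (j : ℤ) (y : ℝ) :
    HasDerivAt (fun t => ∫ x in (0 : ℝ)..L, W (x, t) * star (φ j x))
      (∫ x in (0 : ℝ)..L, W2 (x, y) * star (φ j x)) y := by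
  have hc := h.continuous j
  exact hasDerivAt_integral_of_continuous (F := fun p => W p * star (φ j p.1))
    (F' := fun p => W2 p * star (φ j p.1)) (fun y => by fun_prop) (by fun_prop)
    (fun x y => (hd (x, y)).mul_const (star (φ j x))) 0 L y

/-- The mode equation of a quasi-periodic `C²` field. -/
theorem integral_laplacian_mul_star (h : IsModeFamily L a ν lam φ) {W W1 W2 W11 W22 : ℝ × ℝ → ℂ}
    (hW : IsC2 W W1 W2 W11 W22) (hp : ∀ p : ℝ × ℝ, W (p.1 + L, p.2) = ν * W p)
    (hp1 : ∀ p : ℝ × ℝ, W1 (p.1 + L, p.2) = ν * W1 p) (k : ℝ) (j : ℤ) (y : ℝ) :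
    ∫ x in (0 : ℝ)..L, W22 (x, y) * star (φ j x)
      = (∫ x in (0 : ℝ)..L, (W11 (x, y) + W22 (x, y) + (k : ℂ) ^ 2 * W (x, y)) * star (φ j x))
        - ((k ^ 2 - lam j ^ 2 : ℝ) : ℂ) * ∫ x in (0 : ℝ)..L, W (x, y) * star (φ j x) := by
  have hc : Continuous (fun x => star (φ j x)) := (h.continuous j).star
  have c0 := hW.cont
  have c11 := hW.cont11
  have c22 := hW.cont22
  have e0 := hp (0, y)
  have e1 := hp1 (0, y)
  simp only [zero_add] at e0 e1
  have h2 := h.integral_second_deriv (g := fun x => W (x, y)) (g1 := fun x => W1 (x, y))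
    (g11 := fun x => W11 (x, y)) (fun x => hW.deriv1 (x, y)) (fun x => hW.deriv11 (x, y))
    (by fun_prop) e0 e1 j
  have i1 : IntervalIntegrable (fun x => W11 (x, y) * star (φ j x)) volume 0 L :=
    Continuous.intervalIntegrable (by fun_prop) 0 L
  have i2 : IntervalIntegrable (fun x => W22 (x, y) * star (φ j x)) volume 0 L :=
    Continuous.intervalIntegrable (by fun_prop) 0 L
  have i3 : IntervalIntegrable (fun x => (k : ℂ) ^ 2 * (W (x, y) * star (φ j x))) volume 0 L :=
    Continuous.intervalIntegrable (by fun_prop) 0 L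
  simp only [add_mul, mul_assoc]
  rw [intervalIntegral.integral_add (i1.add i2) i3, intervalIntegral.integral_add i1 i2, h2,
    intervalIntegral.integral_const_mul]
  push_cast
  ring

/-- The mode expansion of a quasi-periodic `C²` field converges uniformly on strips. -/
theorem exists_finset_norm_sub_le (h : IsModeFamily L a ν lam φ) {W W1 W2 W11 W22 : ℝ × ℝ → ℂ}
    (hW : IsC2 W W1 W2 W11 W22) (hp : ∀ p : ℝ × ℝ, W (p.1 + L, p.2) = ν * W p)
    (hp1 : ∀ p : ℝ × ℝ, W1 (p.1 + L, p.2) = ν * W1 p) (Y : ℝ) {δ : ℝ} (hδ : 0 < δ) (i : ℤ) :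
    ∃ s : Finset ℤ, i ∈ s ∧ ∀ x, ∀ y ∈ Set.Icc 0 Y,
      ‖W (x, y) - ∑ j ∈ s, (∫ t in (0 : ℝ)..L, W (t, y) * star (φ j t)) * φ j x‖ ≤ δ := by
  have c0 := hW.cont
  have c11 := hW.cont11
  obtain ⟨C₁, hC₁⟩ := (isCompact_Icc.prod isCompact_Icc).exists_bound_of_continuousOn
    (s := Set.Icc 0 L ×ˢ Set.Icc 0 Y) c0.continuousOn
  obtain ⟨C₂, hC₂⟩ := (isCompact_Icc.prod isCompact_Icc).exists_bound_of_continuousOn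
    (s := Set.Icc 0 L ×ˢ Set.Icc 0 Y) c11.continuousOn
  let β : ℤ → ℝ := fun j => 2 * max C₁ C₂ * Real.sqrt L * (1 + lam j ^ 2)⁻¹ * (1 / Real.sqrt L)
  have hβ : Summable β := (h.summable_inv.mul_left _).mul_right _
  have hterm : ∀ x, ∀ y ∈ Set.Icc 0 Y, ∀ j,
      ‖(∫ t in (0 : ℝ)..L, W (t, y) * star (φ j t)) * φ j x‖ ≤ β j := fun x y hy j => by
    have e0 := hp (0, y)
    have e1 := hp1 (0, y)
    simp only [zero_add] at e0 e1
    rw [norm_mul, h.norm_mode]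
    exact mul_le_mul_of_nonneg_right (h.norm_coeff_le (g := fun x => W (x, y))
      (g1 := fun x => W1 (x, y)) (g11 := fun x => W11 (x, y)) (fun x => hW.deriv1 (x, y))
      (fun x => hW.deriv11 (x, y)) (by fun_prop) e0 e1
      (fun x hx => (hC₁ (x, y) ⟨hx, hy⟩).trans (le_max_left _ _))
      (fun x hx => (hC₂ (x, y) ⟨hx, hy⟩).trans (le_max_right _ _)) j) (by positivity)
  have hev := ((tendsto_tsum_compl_atTop_zero β).eventually (gt_mem_nhds hδ)).and
    (Filter.eventually_ge_atTop {i})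
  obtain ⟨s, hs1, hs2⟩ := hev.exists
  refine ⟨s, hs2 (Finset.mem_singleton_self i), fun x y hy => ?_⟩
  have hsum := h.hasSum_coeff (g := fun x => W (x, y))
      (g1 := fun x => W1 (x, y)) (g11 := fun x => W11 (x, y)) (fun x => hW.deriv1 (x, y))
      (fun x => hW.deriv11 (x, y)) (by fun_prop) (fun x => hp (x, y)) (fun x => hp1 (x, y)) x
  have hsplit := hsum.summable.sum_add_tsum_compl (s := s)
  rw [hsum.tsum_eq] at hsplit
  rw [← hsplit, add_sub_cancel_left]
  refine (tsum_of_norm_bounded (hβ.subtype _).hasSum fun j => hterm x y hy j).trans ?_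
  exact hs1.le

end IsModeFamily

end Expansion

section Source

variable {f : ℝ → ℝ} {s L Y B C : ℝ} {X X1 X2 X11 X22 Z Z1 Z2 Z11 Z22 : ℝ × ℝ → ℝ}
  {w w1 w2 w11 w22 : ℝ × ℝ → ℂ}

/-- The commutator of the Laplacian with a cutoff, applied to `w`. -/
def cutoffSource (X1 X2 X11 X22 : ℝ × ℝ → ℝ) (w w1 w2 : ℝ × ℝ → ℂ) (p : ℝ × ℝ) : ℂ :=
  2 * ((X1 p : ℂ) * w1 p + (X2 p : ℂ) * w2 p) + ((X11 p + X22 p : ℝ) : ℂ) * w p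

theorem LayerCutoff.helmholtz_smul_eq_cutoffSource
    (hZ : LayerCutoff f L B s C X X1 X2 X11 X22 Z Z1 Z2 Z11 Z22) (hf : Continuous f) (hs : 0 < s)
    {k : ℝ} (heq : ∀ p : ℝ × ℝ, f p.1 < p.2 → w11 p + w22 p + (k : ℂ) ^ 2 * w p = 0)
    (p : ℝ × ℝ) :
    ((X p • w11 p + X1 p • w1 p) + (X1 p • w1 p + X11 p • w p))
      + ((X p • w22 p + X2 p • w2 p) + (X2 p • w2 p + X22 p • w p)) + (k : ℂ) ^ 2 * (X p • w p)
      = cutoffSource X1 X2 X11 X22 w w1 w2 p := by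
  simp only [Complex.real_smul, cutoffSource]
  by_cases hp : f p.1 < p.2
  · push_cast
    linear_combination (X p : ℂ) * heq p hp
  · have hp' : p.2 < f p.1 + s := by linarith [not_lt.1 hp]
    obtain ⟨e1, e2, e11, e22⟩ := hZ.isC2.eq_zero_of_low hf hZ.low p hp'
    rw [hZ.low p hp', e1, e2, e11, e22]
    simp

theorem LayerCutoff.continuous_cutoffSource
    (hZ : LayerCutoff f L B s C X X1 X2 X11 X22 Z Z1 Z2 Z11 Z22) (hf : Continuous f) (hs : 0 < s)
    (hw : IsC2Above f w w1 w2 w11 w22) : Continuous (cutoffSource X1 X2 X11 X22 w w1 w2) := by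
  have h := hZ.isC2.eq_zero_of_low hf hZ.low
  have c1 := continuous_cutoff_smul hf hs hZ.isC2.cont1 (fun p hp => (h p hp).1) hw.cont1
  have c2 := continuous_cutoff_smul hf hs hZ.isC2.cont2 (fun p hp => (h p hp).2.1) hw.cont2
  have c3 := continuous_cutoff_smul hf hs hZ.isC2.cont11 (fun p hp => (h p hp).2.2.1) hw.cont
  have c4 := continuous_cutoff_smul hf hs hZ.isC2.cont22 (fun p hp => (h p hp).2.2.2) hw.cont
  simp only [Complex.real_smul] at c1 c2 c3 c4
  have : cutoffSource X1 X2 X11 X22 w w1 w2 = fun p =>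
      2 * ((X1 p : ℂ) * w1 p + (X2 p : ℂ) * w2 p) + ((X11 p : ℂ) * w p + (X22 p : ℂ) * w p) := by
    funext p
    simp only [cutoffSource]
    push_cast
    ring
  rw [this]
  exact (continuous_const.mul (c1.add c2)).add (c3.add c4)

theorem LayerCutoff.norm_cutoffSource_sq_le
    (hZ : LayerCutoff f L B s C X X1 X2 X11 X22 Z Z1 Z2 Z11 Z22)
    (p : ℝ × ℝ) :
    ‖cutoffSource X1 X2 X11 X22 w w1 w2 p‖ ^ 2
      ≤ 12 * (C / s) ^ 2 * (Z p * (‖w1 p‖ ^ 2 + ‖w2 p‖ ^ 2))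
        + 3 * (C / s ^ 2) ^ 2 * (Z p * ‖w p‖ ^ 2) := by
  have z0 := hZ.nonneg_bump p
  have z1 := hZ.le_one_bump p
  have n1 : ‖cutoffSource X1 X2 X11 X22 w w1 w2 p‖
      ≤ 2 * (C / s * Z p * ‖w1 p‖ + C / s * Z p * ‖w2 p‖) + C / s ^ 2 * Z p * ‖w p‖ := by
    unfold cutoffSource
    refine (norm_add_le _ _).trans (add_le_add ?_ ?_)
    · rw [norm_mul, Complex.norm_ofNat]
      refine mul_le_mul_of_nonneg_left ((norm_add_le _ _).trans (add_le_add ?_ ?_)) zero_le_two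
      · rw [norm_mul, Complex.norm_real, Real.norm_eq_abs]
        exact mul_le_mul_of_nonneg_right (hZ.bound1 p) (norm_nonneg _)
      · rw [norm_mul, Complex.norm_real, Real.norm_eq_abs]
        exact mul_le_mul_of_nonneg_right (hZ.bound2 p) (norm_nonneg _)
    · rw [norm_mul, Complex.norm_real, Real.norm_eq_abs]
      exact mul_le_mul_of_nonneg_right (hZ.bound_lap p) (norm_nonneg _)
  have hzz : Z p ^ 2 ≤ Z p := by nlinarith
  set a := C / s * ‖w1 p‖
  set b := C / s * ‖w2 p‖
  set c := C / s ^ 2 * ‖w p‖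
  have n2 : ‖cutoffSource X1 X2 X11 X22 w w1 w2 p‖ ≤ Z p * (2 * (a + b) + c) :=
    n1.trans (le_of_eq (by simp only [a, b, c]; ring))
  calc ‖cutoffSource X1 X2 X11 X22 w w1 w2 p‖ ^ 2
      ≤ (Z p * (2 * (a + b) + c)) ^ 2 := pow_le_pow_left₀ (norm_nonneg _) n2 2
    _ = Z p ^ 2 * (2 * (a + b) + c) ^ 2 := by ring
    _ ≤ Z p * (2 * (a + b) + c) ^ 2 := mul_le_mul_of_nonneg_right hzz (sq_nonneg _)
    _ ≤ Z p * (12 * (a ^ 2 + b ^ 2) + 3 * c ^ 2) := by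
        refine mul_le_mul_of_nonneg_left ?_ z0
        nlinarith [sq_nonneg (2 * a - 2 * b), sq_nonneg (2 * a - c), sq_nonneg (2 * b - c)]
    _ = _ := by simp only [a, b, c]; ring

theorem LayerCutoff.cutoffSource_eq_zero
    (hZ : LayerCutoff f L B s C X X1 X2 X11 X22 Z Z1 Z2 Z11 Z22) {p : ℝ × ℝ}
    (hp : f p.1 + (B - 2) * s < p.2) : cutoffSource X1 X2 X11 X22 w w1 w2 p = 0 := by
  obtain ⟨e1, e2, e3⟩ := hZ.deriv_high p hp
  simp [cutoffSource, e1, e2, e3]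

theorem intervalIntegrable_integral_of_continuous {H : ℝ × ℝ → ℝ} (hH : Continuous H)
    (L a b : ℝ) : IntervalIntegrable (fun y => ∫ x in (0 : ℝ)..L, H (x, y)) volume a b :=
  (intervalIntegral.continuous_parametric_intervalIntegral_of_continuous'
    (f := fun y x => H (x, y)) (by simp only [Function.uncurry_def]; fun_prop) 0
      L).intervalIntegrable _ _

theorem integral_integral_add {H H' : ℝ × ℝ → ℝ} (hH : Continuous H) (hH' : Continuous H')
    (L Y : ℝ) : ∫ y in (0 : ℝ)..Y, ∫ x in (0 : ℝ)..L, (H (x, y) + H' (x, y))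
      = (∫ y in (0 : ℝ)..Y, ∫ x in (0 : ℝ)..L, H (x, y))
        + ∫ y in (0 : ℝ)..Y, ∫ x in (0 : ℝ)..L, H' (x, y) := by
  rw [← intervalIntegral.integral_add (intervalIntegrable_integral_of_continuous hH L 0 Y)
    (intervalIntegrable_integral_of_continuous hH' L 0 Y)]
  refine intervalIntegral.integral_congr fun y _ => ?_
  exact intervalIntegral.integral_add (intervalIntegrable_fst_of_continuous hH 0 L y)
    (intervalIntegrable_fst_of_continuous hH' 0 L y)

theorem integral_integral_const_mul (c : ℝ) (H : ℝ × ℝ → ℝ) (L Y : ℝ) :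
    ∫ y in (0 : ℝ)..Y, ∫ x in (0 : ℝ)..L, c * H (x, y)
      = c * ∫ y in (0 : ℝ)..Y, ∫ x in (0 : ℝ)..L, H (x, y) := by
  simp only [intervalIntegral.integral_const_mul]

theorem integral_integral_mono {H H' : ℝ × ℝ → ℝ} (hH : Continuous H) (hH' : Continuous H')
    (hL : 0 ≤ L) (hY : 0 ≤ Y) (h : ∀ p, H p ≤ H' p) :
    ∫ y in (0 : ℝ)..Y, ∫ x in (0 : ℝ)..L, H (x, y)
      ≤ ∫ y in (0 : ℝ)..Y, ∫ x in (0 : ℝ)..L, H' (x, y) :=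
  intervalIntegral.integral_mono_on hY (intervalIntegrable_integral_of_continuous hH L 0 Y)
    (intervalIntegrable_integral_of_continuous hH' L 0 Y) fun y _ =>
      intervalIntegral.integral_mono_on hL (intervalIntegrable_fst_of_continuous hH 0 L y)
        (intervalIntegrable_fst_of_continuous hH' 0 L y) fun x _ => h (x, y)

theorem LayerCutoff.integral_cutoffSource_le
    (hZ : LayerCutoff f L B s C X X1 X2 X11 X22 Z Z1 Z2 Z11 Z22) (hf : Continuous f) (hs : 0 < s)
    (hs1 : s ≤ 1) (hC : 0 ≤ C) (hB : 0 ≤ B) (hL : 0 ≤ L) (hY0 : 0 ≤ Y)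
    (hf0 : ∀ x, 0 ≤ f x) (hY : ∀ x, f x + B * s < Y)
    (hw : IsC2Above f w w1 w2 w11 w22) {ν : ℂ} (hν : ‖ν‖ = 1)
    (hper : ∀ p : ℝ × ℝ, f p.1 < p.2 → w (p.1 + L, p.2) = ν * w p)
    (hper1 : ∀ p : ℝ × ℝ, f p.1 < p.2 → w1 (p.1 + L, p.2) = ν * w1 p) {k : ℝ}
    (heq : ∀ p : ℝ × ℝ, f p.1 < p.2 → w11 p + w22 p + (k : ℂ) ^ 2 * w p = 0) {g : ℝ → ℝ}
    (hg : Continuous g) (hg0 : ∀ x, 0 ≤ g x)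
    (hwg : ∀ x y, f x < y → y ≤ f x + B * s → ‖w (x, y)‖ ^ 2 ≤ g x) :
    s ^ 3 * ∫ y in (0 : ℝ)..Y, ∫ x in (0 : ℝ)..L,
        ‖cutoffSource X1 X2 X11 X22 w w1 w2 (x, y)‖ ^ 2
      ≤ (6 * C ^ 2 * B * (C + 2 * k ^ 2) + 3 * C ^ 2 * B) * ∫ x in (0 : ℝ)..L, g x := by
  have hC2 := hZ.isC2_bump
  have z0 : ∀ p : ℝ × ℝ, p.2 < f p.1 + s → Z p = 0 := fun p hp => (hZ.low_bump p hp).1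
  have cS := hZ.continuous_cutoffSource hf hs hw
  have c1 : Continuous fun p => Z p * (‖w1 p‖ ^ 2 + ‖w2 p‖ ^ 2) :=
    continuous_cutoff_smul hf hs hC2.cont z0
      ((hw.cont1.norm.pow 2).add (hw.cont2.norm.pow 2))
  have c0 : Continuous fun p => Z p * ‖w p‖ ^ 2 :=
    continuous_cutoff_smul hf hs hC2.cont z0 (hw.cont.norm.pow 2)
  have hgi : 0 ≤ ∫ x in (0 : ℝ)..L, g x := intervalIntegral.integral_nonneg hL fun x _ => hg0 x
  have h1 := hZ.integral_bump_gradient_le hf hs hC hB hL hY0 hf0 hY hw hν hper hper1 heq hg hg0 hwg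
  have h2 : ∫ y in (0 : ℝ)..Y, ∫ x in (0 : ℝ)..L, Z (x, y) * ‖w (x, y)‖ ^ 2
      ≤ B * s * ∫ x in (0 : ℝ)..L, g x := by
    refine layer_integral_le (f := f) c0 hg hL hY0 (by positivity) hg0 (fun x y h1 h2 => ?_)
      fun x y h => ?_
    · by_cases hp : y < f x + s
      · rw [z0 (x, y) hp, zero_mul]
        exact hg0 x
      · have hlt : f x < y := by linarith [not_lt.1 hp]
        have b2 := hZ.le_one_bump (x, y)
        have b3 := hwg x y hlt h2
        have b4 : 0 ≤ ‖w (x, y)‖ ^ 2 := sq_nonneg _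
        nlinarith
    · rcases h with h | h
      · rw [z0 (x, y) (by simp only; linarith)]; simp
      · rw [(hZ.high_bump (x, y) h).1]; simp
  have h3 := integral_integral_mono (cS.norm.pow 2)
    ((c1.const_mul (12 * (C / s) ^ 2)).add (c0.const_mul (3 * (C / s ^ 2) ^ 2))) hL hY0
    (fun p => hZ.norm_cutoffSource_sq_le (w := w) (w1 := w1) (w2 := w2) p)
  have h4 := integral_integral_add (c1.const_mul (12 * (C / s) ^ 2))
    (c0.const_mul (3 * (C / s ^ 2) ^ 2)) L Y
  rw [integral_integral_const_mul (12 * (C / s) ^ 2) (fun p => Z p * (‖w1 p‖ ^ 2 + ‖w2 p‖ ^ 2)),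
    integral_integral_const_mul (3 * (C / s ^ 2) ^ 2) (fun p => Z p * ‖w p‖ ^ 2)] at h4
  have h5 := h3.trans (le_of_eq h4)
  set I := ∫ x in (0 : ℝ)..L, g x
  set I1 := ∫ y in (0 : ℝ)..Y, ∫ x in (0 : ℝ)..L,
    Z (x, y) * (‖w1 (x, y)‖ ^ 2 + ‖w2 (x, y)‖ ^ 2)
  set I2 := ∫ y in (0 : ℝ)..Y, ∫ x in (0 : ℝ)..L, Z (x, y) * ‖w (x, y)‖ ^ 2
  have h6 : B * s * ((C / s ^ 2 + 2 * k ^ 2) / 2) * I ≤ B / s * ((C + 2 * k ^ 2) / 2) * I := by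
    refine mul_le_mul_of_nonneg_right ?_ hgi
    have : B * s * ((C / s ^ 2 + 2 * k ^ 2) / 2) = B / s * ((C + 2 * k ^ 2 * s ^ 2) / 2) := by
      field_simp
    rw [this]
    have hsq : s ^ 2 ≤ 1 := pow_le_one₀ hs.le hs1
    have : k ^ 2 * s ^ 2 ≤ k ^ 2 * 1 := by gcongr
    exact mul_le_mul_of_nonneg_left (by linarith) (by positivity)
  calc s ^ 3 * ∫ y in (0 : ℝ)..Y, ∫ x in (0 : ℝ)..L,
        ‖cutoffSource X1 X2 X11 X22 w w1 w2 (x, y)‖ ^ 2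
      ≤ s ^ 3 * (12 * (C / s) ^ 2 * (B / s * ((C + 2 * k ^ 2) / 2) * I)
          + 3 * (C / s ^ 2) ^ 2 * (B * s * I)) := by
        refine mul_le_mul_of_nonneg_left (h5.trans ?_) (by positivity)
        have := h1.trans h6
        gcongr
    _ = _ := by
        field_simp
        ring

end Source

section CoefficientBound

theorem hasDerivAt_max_zero_sq (u : ℝ) :
    HasDerivAt (fun t : ℝ => max t 0 ^ 2) (2 * max u 0) u := by
  rcases lt_trichotomy u 0 with h | h | h
  · rw [max_eq_right h.le, mul_zero]
    refine (hasDerivAt_const u (0 : ℝ)).congr_of_eventuallyEq ?_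
    filter_upwards [Iio_mem_nhds h] with t ht
    rw [max_eq_right (le_of_lt ht)]
    simp
  · subst h
    rw [max_self, mul_zero, hasDerivAt_iff_isLittleO_nhds_zero]
    simp only [zero_add, max_self, smul_zero, sub_zero, ne_eq, OfNat.ofNat_ne_zero,
      not_false_eq_true, zero_pow]
    refine Asymptotics.IsBigO.trans_isLittleO (Asymptotics.IsBigO.of_bound 1
      (Filter.Eventually.of_forall fun t => ?_)) (Asymptotics.isLittleO_pow_id one_lt_two)
    rw [one_mul, norm_pow, norm_pow]
    refine pow_le_pow_left₀ (norm_nonneg _) ?_ 2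
    rw [Real.norm_eq_abs, Real.norm_eq_abs, abs_of_nonneg (le_max_right t 0)]
    exact max_le (le_abs_self t) (abs_nonneg t)
  · rw [max_eq_left h.le]
    refine (((hasDerivAt_id u).pow 2).congr_of_eventuallyEq ?_).congr_deriv (by simp)
    filter_upwards [Ioi_mem_nhds h] with t ht
    rw [max_eq_left (le_of_lt ht)]
    simp

theorem norm_sub_potential_sq_le {s ζ δ : ℝ} (hs : 0 < s) {G W P : ℂ}
    (hP : ‖W - P‖ ≤ δ) (hG : G ≠ 0 → 2 * s ≤ ζ) :
    ‖G - ((ζ ^ 2 / s ^ 4 : ℝ) : ℂ) * P‖ ^ 2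
      ≤ (3 * (s ^ 3 / 4 * ‖G‖ ^ 2 + 1 / (2 * s ^ 4) * (ζ ^ 3 * ‖W‖ ^ 2)
          + δ ^ 2 * (ζ ^ 3 / (2 * s ^ 4)))) * (2 * ζ / s ^ 4) := by
  set q := ζ ^ 2 / s ^ 4
  have hq : 0 ≤ q := by positivity
  have hδ : 0 ≤ δ := (norm_nonneg _).trans hP
  have n1 : ‖G - (q : ℂ) * P‖ ≤ ‖G‖ + q * ‖W‖ + q * δ := by
    rw [show G - (q : ℂ) * P = G - (q : ℂ) * W + (q : ℂ) * (W - P) by ring]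
    refine (norm_add_le _ _).trans (add_le_add ((norm_sub_le _ _).trans ?_) ?_)
    · rw [norm_mul, Complex.norm_real, Real.norm_eq_abs, abs_of_nonneg hq]
    · rw [norm_mul, Complex.norm_real, Real.norm_eq_abs, abs_of_nonneg hq]
      exact mul_le_mul_of_nonneg_left hP hq
  have n2 : ‖G‖ ^ 2 ≤ s ^ 3 / 4 * ‖G‖ ^ 2 * (2 * ζ / s ^ 4) := by
    by_cases h0 : G = 0
    · simp [h0]
    · have h1 := hG h0
      have e : s ^ 3 / 4 * ‖G‖ ^ 2 * (2 * ζ / s ^ 4) = ‖G‖ ^ 2 * (ζ / (2 * s)) := by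
        field_simp; norm_num
      rw [e]
      exact le_mul_of_one_le_right (sq_nonneg _) ((one_le_div (by positivity)).2 h1)
  have e2 : q ^ 2 = ζ ^ 3 / (2 * s ^ 4) * (2 * ζ / s ^ 4) := by
    simp only [q]; field_simp
  calc ‖G - (q : ℂ) * P‖ ^ 2 ≤ (‖G‖ + q * ‖W‖ + q * δ) ^ 2 := pow_le_pow_left₀ (norm_nonneg _) n1 2
    _ ≤ 3 * (‖G‖ ^ 2 + q ^ 2 * ‖W‖ ^ 2 + q ^ 2 * δ ^ 2) := by
        nlinarith [sq_nonneg (‖G‖ - q * ‖W‖), sq_nonneg (‖G‖ - q * δ),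
          sq_nonneg (q * ‖W‖ - q * δ)]
    _ ≤ 3 * (s ^ 3 / 4 * ‖G‖ ^ 2 * (2 * ζ / s ^ 4) + q ^ 2 * ‖W‖ ^ 2 + q ^ 2 * δ ^ 2) := by
        gcongr
    _ = _ := by rw [e2]; ring

variable {f : ℝ → ℝ} {s L Y B C a k : ℝ} {X X1 X2 X11 X22 Z Z1 Z2 Z11 Z22 : ℝ × ℝ → ℝ}
  {w w1 w2 w11 w22 : ℝ × ℝ → ℂ} {ν : ℂ} {lam : ℤ → ℝ} {φ : ℤ → ℝ → ℂ}

/-- The constant in the mode estimate; it does not depend on the layer width. -/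
noncomputable def layerConstant (B C k : ℝ) : ℝ :=
  3 * ((6 * C ^ 2 * B * (C + 2 * k ^ 2) + 3 * C ^ 2 * B) / 2 + B ^ 4 + 1)

theorem layerConstant_pos (hB : 0 ≤ B) (hC : 0 ≤ C) : 0 < layerConstant B C k := by
  unfold layerConstant
  positivity

theorem LayerCutoff.norm_coeff_le
    (hZ : LayerCutoff f L B s C X X1 X2 X11 X22 Z Z1 Z2 Z11 Z22)
    (hm : IsModeFamily L a ν lam φ) (hf : Continuous f) (hs : 0 < s)
    (hs1 : s ≤ 1) (hC : 0 ≤ C) (hB : 0 ≤ B) (hY0 : 0 < Y)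
    (hf0 : ∀ x, 0 ≤ f x) (hY : ∀ x, f x + B * s < Y) (hw : IsC2Above f w w1 w2 w11 w22)
    (hper : ∀ p : ℝ × ℝ, f p.1 < p.2 → w (p.1 + L, p.2) = ν * w p)
    (hper1 : ∀ p : ℝ × ℝ, f p.1 < p.2 → w1 (p.1 + L, p.2) = ν * w1 p)
    (heq : ∀ p : ℝ × ℝ, f p.1 < p.2 → w11 p + w22 p + (k : ℂ) ^ 2 * w p = 0) {g : ℝ → ℝ}
    (hg : Continuous g) (hg0 : ∀ x, 0 ≤ g x)
    (hwg : ∀ x y, f x < y → y ≤ f x + B * s → ‖w (x, y)‖ ^ 2 ≤ g x) {ε : ℝ} (hε : 0 < ε)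
    (hgε : ∫ x in (0 : ℝ)..L, g x ≤ 2 * ε ^ 2) (hk : 0 ≤ k) {μ : ℤ → ℂ}
    (hμ : ∀ j, ‖μ j‖ ^ 2 + (k ^ 2 - lam j ^ 2) ≤ 2 * k * (μ j).re) (hμim : ∀ j, 0 ≤ (μ j).im)
    {b : ℤ → ℂ} (hout : ∀ j, ∀ᶠ y in nhds Y,
      ∫ x in (0 : ℝ)..L, w (x, y) * star (φ j x) = b j * Complex.exp (Complex.I * μ j * y))
    (m : ℤ) :
    ‖b m * Complex.exp (Complex.I * μ m * Y)‖
      ≤ (2 * Y * (k + ‖μ m‖) + 1) * (Real.sqrt (layerConstant B C k) * ε) := by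
  have hL := hm.pos
  have hW := hZ.isC2.smul_above hf hs hZ.low hw
  have hlow := hZ.isC2.eq_zero_of_low hf hZ.low
  have hsrc := hZ.helmholtz_smul_eq_cutoffSource (w1 := w1) (w2 := w2) hf hs heq
  have hG := hZ.continuous_cutoffSource hf hs hw
  set G := cutoffSource X1 X2 X11 X22 w w1 w2 with hGdef
  have hWp : ∀ p : ℝ × ℝ, X (p.1 + L, p.2) • w (p.1 + L, p.2) = ν * (X p • w p) := fun p => by
    rw [hZ.per]
    by_cases hp : f p.1 < p.2
    · rw [hper p hp, mul_smul_comm]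
    · rw [hZ.low p (by linarith [not_lt.1 hp])]; simp
  have hWp1 : ∀ p : ℝ × ℝ, X (p.1 + L, p.2) • w1 (p.1 + L, p.2)
      + X1 (p.1 + L, p.2) • w (p.1 + L, p.2) = ν * (X p • w1 p + X1 p • w p) := fun p => by
    rw [hZ.per, hZ.per1]
    by_cases hp : f p.1 < p.2
    · rw [hper p hp, hper1 p hp, mul_add, mul_smul_comm, mul_smul_comm]
    · have hp' : p.2 < f p.1 + s := by linarith [not_lt.1 hp]
      rw [hZ.low p hp', (hlow p hp').1]; simp
  have hWc := hW.cont
  let ζ : ℝ × ℝ → ℝ := fun p => max (f p.1 + B * s - p.2) 0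
  have hζc : Continuous ζ := by simp only [ζ]; fun_prop
  have hζ0 : ∀ p, 0 ≤ ζ p := fun p => le_max_right _ _
  let I := ∫ y in (0 : ℝ)..Y, ∫ x in (0 : ℝ)..L, ζ (x, y) ^ 3 / (2 * s ^ 4)
  have hI : 0 ≤ I := intervalIntegral.integral_nonneg hY0.le fun y _ =>
    intervalIntegral.integral_nonneg hL.le fun x _ => by have := hζ0 (x, y); positivity
  let δ := Real.sqrt (ε ^ 2 / (I + 1))
  have hδ : 0 < δ := Real.sqrt_pos.2 (by positivity)
  have hδ2 : δ ^ 2 = ε ^ 2 / (I + 1) := Real.sq_sqrt (by positivity)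
  have hδI : δ ^ 2 * I ≤ ε ^ 2 := by
    rw [hδ2, div_mul_eq_mul_div, div_le_iff₀ (by positivity)]
    nlinarith [sq_nonneg ε]
  obtain ⟨S, hmS, hS⟩ := hm.exists_finset_norm_sub_le hW hWp hWp1 Y hδ m
  let h : ℝ × ℝ → ℝ := fun p => 3 * (s ^ 3 / 4 * ‖G p‖ ^ 2
    + 1 / (2 * s ^ 4) * (ζ p ^ 3 * ‖X p • w p‖ ^ 2) + δ ^ 2 * (ζ p ^ 3 / (2 * s ^ 4)))
  have ch : Continuous h := by
    simp only [h]
    fun_prop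
  have hXY : ∀ᶠ y in nhds Y, ∀ x, X (x, y) = 1 := by
    filter_upwards [Ioi_mem_nhds (show Y - 2 * s < Y by linarith)] with y hy x
    have hy' : Y - 2 * s < y := hy
    exact hZ.high (x, y) (by simp only; nlinarith [hY x])
  have hout' : ∀ j, (fun y => ∫ x in (0 : ℝ)..L, (X (x, y) • w (x, y)) * star (φ j x))
      =ᶠ[nhds Y] fun y => b j * Complex.exp (Complex.I * μ j * y) := fun j => by
    filter_upwards [hXY, hout j] with y hy hy2
    simp only [hy, one_smul, hy2]
  have hWd := fun (j : ℤ) y => hm.hasDerivAt_coeff hW.cont hW.cont2 hW.deriv2 j y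
  have hmain := norm_mode_le_of_weight (ι := S) (L := L) (Y := Y) (κ := k)
    (τ := fun j => star (Complex.I * μ j)) (d := fun j => k ^ 2 - lam j ^ 2)
    (ψ := fun j => φ j) (q := fun p => ζ p ^ 2 / s ^ 4) (ρ := fun p => 2 * ζ p / s ^ 4)
    (G := G) (h := h)
    (W := fun y j => ∫ x in (0 : ℝ)..L, (X (x, y) • w (x, y)) * star (φ j x))
    (W' := fun y j => ∫ x in (0 : ℝ)..L,
      (X (x, y) • w2 (x, y) + X2 (x, y) • w (x, y)) * star (φ j x))
    hL hY0 hk ?_ ?_ (fun j => hm.continuous j) (by fun_prop) (by fun_prop) ?_ ?_ ?_ hG ch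
    ?_ ?_ ?_ ?_ ?_ ?_ ?_ (δ := Real.sqrt (layerConstant B C k) * ε) ?_ ?_ ⟨m, hmS⟩
  · have hval := (hout' m).eq_of_nhds
    simp only [norm_star, norm_mul, Complex.norm_I, one_mul] at hmain
    rw [hval] at hmain
    simpa only [norm_mul] using hmain
  · intro j
    simp only [norm_star, norm_mul, Complex.norm_I, one_mul]
    refine (hμ j).trans (le_of_eq ?_)
    simp
  · intro j
    simpa using hμim j
  · intro x y
    have h1 : HasDerivAt (fun t : ℝ => f x + B * s - t) (-1) y := by
      simpa using (hasDerivAt_id y).const_sub (f x + B * s)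
    refine (((hasDerivAt_max_zero_sq (f x + B * s - y)).comp y h1).div_const (s ^ 4)).congr_deriv ?_
    simp only [ζ]
    ring
  · intro p
    have := hζ0 p
    positivity
  · intro x
    simp only [ζ]
    rw [max_eq_right (by linarith [hY x])]
    simp
  · intro y _ j
    exact hWd j y
  · intro y _ j
    refine (hm.hasDerivAt_coeff hW.cont2 hW.cont22 hW.deriv22 j y).congr_deriv ?_
    rw [hm.integral_laplacian_mul_star hW hWp hWp1 k j y]
    simp only [hsrc]
  · funext j
    have : ∀ x, X (x, 0) = 0 := fun x => hZ.low (x, 0) (by simp only; linarith [hf0 x])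
    simp [this]
  · funext j
    have h0 : ∀ x, (0 : ℝ) < f x + s := fun x => by linarith [hf0 x]
    have e1 : ∀ x, X (x, 0) = 0 := fun x => hZ.low (x, 0) (h0 x)
    have e2 : ∀ x, X2 (x, 0) = 0 := fun x => (hlow (x, 0) (h0 x)).2.1
    simp [e1, e2]
  · intro j
    have h1 : HasDerivAt (fun y : ℝ => b j * Complex.exp (Complex.I * μ j * y))
        (Complex.I * μ j * (b j * Complex.exp (Complex.I * μ j * Y))) Y := by
      have h2 : HasDerivAt (fun x : ℝ => Complex.I * μ j * (x : ℂ)) (Complex.I * μ j) Y := by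
        simpa using (Complex.ofRealCLM.hasDerivAt (x := Y)).const_mul (Complex.I * (μ j : ℂ))
      exact (h2.cexp.const_mul (b j)).congr_deriv (by ring)
    have h3 := (hWd j Y).unique (h1.congr_of_eventuallyEq (hout' j))
    have hval := (hout' j).eq_of_nhds
    simp only [star_star] at hval ⊢
    rw [hval]
    exact h3
  · intro x _ y hy
    have hP := hS x y hy
    rw [← Finset.sum_coe_sort S] at hP
    refine norm_sub_potential_sq_le hs hP fun hne => ?_
    by_contra hlt
    refine hne (hZ.cutoffSource_eq_zero (p := (x, y)) ?_)
    have : f x + B * s - y < 2 * s := lt_of_le_of_lt (le_max_left _ _) (not_le.1 hlt)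
    simp only
    linarith
  · intro p
    have := hζ0 p
    simp only [h]
    positivity
  · exact mul_pos (Real.sqrt_pos.2 (layerConstant_pos hB hC)) hε
  · have c1 : Continuous fun p => ‖G p‖ ^ 2 := hG.norm.pow 2
    have c2 : Continuous fun p => ζ p ^ 3 * ‖X p • w p‖ ^ 2 := (hζc.pow 3).mul (hWc.norm.pow 2)
    have c3 : Continuous fun p => ζ p ^ 3 / (2 * s ^ 4) := (hζc.pow 3).div_const _
    have i1 := hZ.integral_cutoffSource_le hf hs hs1 hC hB hL.le hY0.le hf0 hY hw hm.norm_phase hper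
      hper1 heq hg hg0 hwg
    rw [← hGdef] at i1
    have i2 : ∫ y in (0 : ℝ)..Y, ∫ x in (0 : ℝ)..L, ζ (x, y) ^ 3 * ‖X (x, y) • w (x, y)‖ ^ 2
        ≤ B * s * ∫ x in (0 : ℝ)..L, (B * s) ^ 3 * g x := by
      refine layer_integral_le (f := f) c2 (hg.const_mul _) hL.le hY0.le (by positivity)
        (fun x => mul_nonneg (by positivity) (hg0 x)) (fun x y h1 h2 => ?_) fun x y h => ?_
      · have hζB : ζ (x, y) ≤ B * s := max_le (by simp only; linarith) (by positivity)
        refine mul_le_mul (pow_le_pow_left₀ (hζ0 _) hζB 3) ?_ (sq_nonneg _) (by positivity)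
        by_cases hp : y < f x + s
        · rw [hZ.low (x, y) hp]
          simpa using hg0 x
        · refine le_trans ?_ (hwg x y (by linarith) h2)
          rw [norm_smul, Real.norm_eq_abs, abs_of_nonneg (hZ.nonneg _)]
          exact pow_le_pow_left₀ (by have := hZ.nonneg (x, y); positivity)
            (mul_le_of_le_one_left (norm_nonneg _) (hZ.le_one _)) 2
      · rcases h with h | h
        · rw [hZ.low (x, y) (by simp only; linarith)]
          simp
        · have : ζ (x, y) = 0 := max_eq_right (by simp only; linarith)
          rw [this]
          simp
    rw [intervalIntegral.integral_const_mul] at i2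
    set J := ∫ x in (0 : ℝ)..L, g x
    have c4 : Continuous fun p => s ^ 3 / 4 * ‖G p‖ ^ 2 := continuous_const.mul c1
    have c5 : Continuous fun p => 1 / (2 * s ^ 4) * (ζ p ^ 3 * ‖X p • w p‖ ^ 2) :=
      continuous_const.mul c2
    have c6 : Continuous fun p => δ ^ 2 * (ζ p ^ 3 / (2 * s ^ 4)) := continuous_const.mul c3
    have c7 : Continuous fun p => s ^ 3 / 4 * ‖G p‖ ^ 2
      + 1 / (2 * s ^ 4) * (ζ p ^ 3 * ‖X p • w p‖ ^ 2) := c4.add c5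
    simp only [h]
    rw [integral_integral_const_mul 3 (fun p => s ^ 3 / 4 * ‖G p‖ ^ 2
      + 1 / (2 * s ^ 4) * (ζ p ^ 3 * ‖X p • w p‖ ^ 2) + δ ^ 2 * (ζ p ^ 3 / (2 * s ^ 4))),
      integral_integral_add c7 c6, integral_integral_add c4 c5,
      integral_integral_const_mul (s ^ 3 / 4) fun p => ‖G p‖ ^ 2,
      integral_integral_const_mul (1 / (2 * s ^ 4)) fun p => ζ p ^ 3 * ‖X p • w p‖ ^ 2,
      integral_integral_const_mul (δ ^ 2) fun p => ζ p ^ 3 / (2 * s ^ 4), mul_pow,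
      Real.sq_sqrt (layerConstant_pos hB hC).le]
    have e1 : 1 / (2 * s ^ 4) * (B * s * ((B * s) ^ 3 * J)) = B ^ 4 / 2 * J := by
      field_simp
    have i3 := mul_le_mul_of_nonneg_left i2 (show 0 ≤ 1 / (2 * s ^ 4) by positivity)
    rw [e1] at i3
    have i4 : (6 * C ^ 2 * B * (C + 2 * k ^ 2) + 3 * C ^ 2 * B) * J
        ≤ (6 * C ^ 2 * B * (C + 2 * k ^ 2) + 3 * C ^ 2 * B) * (2 * ε ^ 2) :=
      mul_le_mul_of_nonneg_left hgε (by positivity)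
    have i5 : B ^ 4 / 2 * J ≤ B ^ 4 / 2 * (2 * ε ^ 2) :=
      mul_le_mul_of_nonneg_left hgε (by positivity)
    unfold layerConstant
    linarith

end CoefficientBound

section Stability

theorem exists_weight_le {Y k ρ : ℝ} (hY : 0 ≤ Y) (hk : 0 ≤ k) (hρ : 0 < ρ) :
    ∃ A, ∀ n : ℝ, 0 ≤ n →
      (2 * Y * (2 * k + n) + 1) * (1 + k ^ 2 + n ^ 2) * Real.exp (-(n * ρ)) ≤ A := by
  have hδ : 0 < min 1 (ρ / 3) := lt_min one_pos (by positivity)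
  refine ⟨(4 * Y * k + 2 * Y + 1) * (1 + k ^ 2) / min 1 (ρ / 3) ^ 3, fun n hn => ?_⟩
  rw [le_div_iff₀ (by positivity)]
  set δ := min 1 (ρ / 3) with hd
  have h1 : δ * (1 + n) ≤ Real.exp (n * ρ / 3) := by
    have := Real.add_one_le_exp (n * ρ / 3)
    nlinarith [min_le_left 1 (ρ / 3), mul_le_mul_of_nonneg_left (min_le_right 1 (ρ / 3)) hn]
  have h2 : (δ * (1 + n)) ^ 3 ≤ Real.exp (n * ρ) := by
    refine (pow_le_pow_left₀ (by positivity) h1 3).trans_eq ?_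
    rw [← Real.exp_nat_mul]
    congr 1
    push_cast
    ring
  have h3 : (δ * (1 + n)) ^ 3 * Real.exp (-(n * ρ)) ≤ 1 := by
    refine (mul_le_mul_of_nonneg_right h2 (Real.exp_pos _).le).trans_eq ?_
    rw [← Real.exp_add, add_neg_cancel, Real.exp_zero]
  have h4 : 2 * Y * (2 * k + n) + 1 ≤ (4 * Y * k + 2 * Y + 1) * (1 + n) := by
    have : 0 ≤ Y * k * n := by positivity
    nlinarith
  have h5 : 1 + k ^ 2 + n ^ 2 ≤ (1 + k ^ 2) * (1 + n) ^ 2 := by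
    have : 0 ≤ k ^ 2 * n + k ^ 2 * n ^ 2 := by positivity
    nlinarith
  calc (2 * Y * (2 * k + n) + 1) * (1 + k ^ 2 + n ^ 2) * Real.exp (-(n * ρ)) * δ ^ 3
      ≤ ((4 * Y * k + 2 * Y + 1) * (1 + n)) * ((1 + k ^ 2) * (1 + n) ^ 2)
        * Real.exp (-(n * ρ)) * δ ^ 3 := by gcongr
    _ = (4 * Y * k + 2 * Y + 1) * (1 + k ^ 2) * ((δ * (1 + n)) ^ 3 * Real.exp (-(n * ρ))) := by
      ring
    _ ≤ _ := mul_le_of_le_one_right (by positivity) h3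

/-- On a sufficiently thin layer above a periodic graph a quasi-periodic function is controlled
by its boundary values. -/
theorem exists_layer_sq_le {f : ℝ → ℝ} {w : ℝ × ℝ → ℂ} {L η : ℝ} {ν : ℂ} (hf : Continuous f)
    (hw : ContinuousOn w {p : ℝ × ℝ | f p.1 ≤ p.2}) (hL : 0 < L) (hfp : ∀ x, f (x + L) = f x)
    (hν : ‖ν‖ = 1) (hp : ∀ p : ℝ × ℝ, f p.1 ≤ p.2 → w (p.1 + L, p.2) = ν * w p) (hη : 0 < η) :
    ∃ s, 0 < s ∧ ∀ x y, f x ≤ y → y ≤ f x + s → ‖w (x, y)‖ ^ 2 ≤ ‖w (x, f x)‖ ^ 2 + η := by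
  have hv : Continuous fun q : ℝ × ℝ => ‖w (q.1, f q.1 + |q.2|)‖ ^ 2 := by
    refine (Continuous.norm ?_).pow 2
    refine hw.comp_continuous (f := fun q : ℝ × ℝ => (q.1, f q.1 + |q.2|)) (by fun_prop)
      fun q => ?_
    simp
  set v : ℝ × ℝ → ℝ := fun q => ‖w (q.1, f q.1 + |q.2|)‖ ^ 2 with hvd
  have hvp : Function.Periodic (fun x => fun t => v (x, t)) L := fun x => by
    funext t
    simp only [hvd, hfp]
    rw [hp (x, f x + |t|) (by simp), norm_mul, hν, one_mul]
  have hK : IsCompact (Set.Icc (0 : ℝ) L ×ˢ Set.Icc (0 : ℝ) 1) := isCompact_Icc.prod isCompact_Icc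
  obtain ⟨δ, hδ, hu⟩ := Metric.uniformContinuousOn_iff.1
    (hK.uniformContinuousOn_of_continuous hv.continuousOn) η hη
  refine ⟨min 1 (δ / 2), lt_min one_pos (by positivity), fun x y hy hys => ?_⟩
  obtain ⟨x', hx', he⟩ := hvp.exists_mem_Ico₀ hL x
  have ht0 : 0 ≤ y - f x := sub_nonneg.2 hy
  have ht1 : y - f x ≤ 1 := by linarith [min_le_left 1 (δ / 2)]
  have ht2 : y - f x < δ := by linarith [min_le_right 1 (δ / 2)]
  have hd := hu (x', y - f x) ⟨⟨hx'.1, hx'.2.le⟩, ht0, ht1⟩ (x', 0)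
    ⟨⟨hx'.1, hx'.2.le⟩, le_rfl, zero_le_one⟩ (by
      rw [Prod.dist_eq, dist_self, Real.dist_eq, sub_zero, abs_of_nonneg ht0]
      exact max_lt hδ ht2)
  have e1 : v (x, y - f x) = v (x', y - f x) := congrFun he _
  have e2 : v (x, 0) = v (x', 0) := congrFun he _
  rw [← e1, ← e2, Real.dist_eq] at hd
  have e3 : v (x, y - f x) = ‖w (x, y)‖ ^ 2 := by
    simp [hvd, abs_of_nonneg ht0]
  have e4 : v (x, 0) = ‖w (x, f x)‖ ^ 2 := by simp [hvd]
  rw [e3, e4] at hd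
  linarith [(abs_lt.1 hd).2]

theorem norm_exp_I_mul (z : ℂ) (y : ℝ) :
    ‖Complex.exp (Complex.I * z * y)‖ = Real.exp (-(z.im * y)) := by
  rw [Complex.norm_exp]
  simp

end Stability

/- STATEMENT 14 (Stability estimate for outgoing solutions, Lemma 4.2, sup-norm form):
Context: L > 0, k > 0, θ ∈ (0,π/2), ν = e^{ikL cos θ}, λ_j = k cos θ + 2πj/L,
φ_j(x) = e^{iλ_j x}/√L, λ_j² ≠ k² for all j, μ_j = √(k²−λ_j²) for λ_j² < k² and
μ_j = i√(λ_j²−k²) otherwise; f Lipschitz, L-periodic, nonnegative,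
M = sup_{0≤x≤L} f(x); D = {y > f(x)}, closure Dbar = {y ≥ f(x)}.
"Outgoing" is formalized as L²(0,L)-convergence of the net of finite partial sums of
Σ_j c_j e^{iμ_j y} φ_j(x) to w(·,y) for every y > M.  The boundary L²(S_L) norm is
rendered (equivalently, up to constants absorbed in c, since f is Lipschitz) as the
L²(0,L) norm of x ↦ w(x,f(x)).
Fix R > M.  Then there is a constant c > 0 (depending only on f, L, k, θ, R) such that
for every ε > 0 and every w continuous on Dbar, C² in D, quasiperiodic, outgoing,
solving Δw + k²w = 0 in D, with boundary norm ≤ ε, one has |w(x,y)| ≤ c ε whenever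
(x,y) ∈ D and y ≥ R. -/
theorem statement14
    (L k θ : ℝ) (hL : 0 < L) (hk : 0 < k) (hθ : θ ∈ Set.Ioo 0 (Real.pi / 2))
    (ν : ℂ) (hν : ν = Complex.exp (Complex.I * k * L * Real.cos θ))
    (lam : ℤ → ℝ) (hlam : ∀ j : ℤ, lam j = k * Real.cos θ + 2 * Real.pi * j / L)
    (hnr : ∀ j : ℤ, (lam j) ^ 2 ≠ k ^ 2)
    (φ : ℤ → ℝ → ℂ)
    (hφ : ∀ (j : ℤ) (x : ℝ), φ j x = Complex.exp (Complex.I * lam j * x) / Real.sqrt L)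
    (μ : ℤ → ℂ)
    (hμ1 : ∀ j : ℤ, (lam j) ^ 2 < k ^ 2 → μ j = (Real.sqrt (k ^ 2 - (lam j) ^ 2) : ℝ))
    (hμ2 : ∀ j : ℤ, k ^ 2 < (lam j) ^ 2 → μ j = Complex.I * (Real.sqrt ((lam j) ^ 2 - k ^ 2) : ℝ))
    (f : ℝ → ℝ) (hlip : ∃ K : NNReal, LipschitzWith K f)
    (hper : ∀ x : ℝ, f (x + L) = f x) (hpos : ∀ x : ℝ, 0 ≤ f x)
    (M : ℝ) (hM : M = sSup (f '' Set.Icc 0 L))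
    (D Dbar : Set (ℝ × ℝ))
    (hD : D = {p : ℝ × ℝ | f p.1 < p.2})
    (hDbar : Dbar = {p : ℝ × ℝ | f p.1 ≤ p.2})
    (R : ℝ) (hR : M < R) :
    ∃ c : ℝ, 0 < c ∧
      ∀ ε : ℝ, 0 < ε →
        ∀ (w w1 w2 w11 w22 : ℝ × ℝ → ℂ) (cf : ℤ → ℂ),
          ContinuousOn w Dbar →
          (∀ p ∈ D, HasDerivAt (fun t => w (t, p.2)) (w1 p) p.1) →
          (∀ p ∈ D, HasDerivAt (fun t => w (p.1, t)) (w2 p) p.2) →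
          (∀ p ∈ D, HasDerivAt (fun t => w1 (t, p.2)) (w11 p) p.1) →
          (∀ p ∈ D, HasDerivAt (fun t => w2 (p.1, t)) (w22 p) p.2) →
          ContinuousOn w1 D → ContinuousOn w2 D →
          ContinuousOn w11 D → ContinuousOn w22 D →
          (∀ p ∈ D, w11 p + w22 p + (k : ℂ) ^ 2 * w p = 0) →
          (∀ p ∈ Dbar, w (p.1 + L, p.2) = ν * w p) →
          (∀ p ∈ D, w1 (p.1 + L, p.2) = ν * w1 p) →
          (∀ y : ℝ, M < y → Filter.Tendsto
            (fun s : Finset ℤ => ∫ x in (0 : ℝ)..L,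
              ‖w (x, y) - ∑ j ∈ s, cf j * Complex.exp (Complex.I * μ j * y) * φ j x‖ ^ 2)
            Filter.atTop (nhds 0)) →
          (∫ x in (0 : ℝ)..L, ‖w (x, f x)‖ ^ 2) ≤ ε ^ 2 →
          ∀ p ∈ D, R ≤ p.2 → ‖w p‖ ≤ c * ε := by
  obtain ⟨K, hK⟩ := hlip
  have hf : Continuous f := hK.continuous
  have hm : IsModeFamily L (k * Real.cos θ) ν lam φ :=
    ⟨hL, by rw [hν]; congr 1; push_cast; ring, hlam, hφ⟩
  have hfM : ∀ x, f x ≤ M := fun x => by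
    obtain ⟨y, hy, he⟩ := Function.Periodic.exists_mem_Ico₀ hper hL x
    rw [he, hM]
    exact le_csSup (isCompact_Icc.bddAbove_image hf.continuousOn) ⟨y, ⟨hy.1, hy.2.le⟩, rfl⟩
  have hM0 : 0 ≤ M := (hpos 0).trans (hfM 0)
  have hK0 : (0 : ℝ) ≤ K := K.2
  obtain ⟨C, hC, hcut⟩ := exists_layerCutoff hK0
  have hfK : ∀ x y, |f x - f y| ≤ K * |x - y| := fun x y => by
    simpa [Real.dist_eq] using hK.dist_le_mul x y
  set B : ℝ := 4 * K + 5 with hBd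
  have hB : 0 < B := by positivity
  obtain ⟨Y, hMY, hYR⟩ := exists_between hR
  have hY0 : 0 < Y := hM0.trans_lt hMY
  have hcase : ∀ j, (lam j ^ 2 < k ^ 2 ∧ μ j = (Real.sqrt (k ^ 2 - lam j ^ 2) : ℝ)) ∨
      (k ^ 2 < lam j ^ 2 ∧ μ j = Complex.I * (Real.sqrt (lam j ^ 2 - k ^ 2) : ℝ)) := fun j =>
    (lt_or_gt_of_ne (hnr j)).imp (fun h => ⟨h, hμ1 j h⟩) fun h => ⟨h, hμ2 j h⟩
  have hmode : ∀ j, ‖μ j‖ ^ 2 + (k ^ 2 - lam j ^ 2) ≤ 2 * k * (μ j).re ∧ 0 ≤ (μ j).im ∧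
      ‖μ j‖ ≤ k + (μ j).im ∧ 1 + lam j ^ 2 ≤ 1 + k ^ 2 + (μ j).im ^ 2 := fun j => by
    rcases hcase j with ⟨h, e⟩ | ⟨h, e⟩
    · have hs := Real.sq_sqrt (sub_nonneg.2 h.le)
      have hs0 := Real.sqrt_nonneg (k ^ 2 - lam j ^ 2)
      have hsk : Real.sqrt (k ^ 2 - lam j ^ 2) ≤ k :=
        Real.sqrt_le_iff.2 ⟨hk.le, by nlinarith [sq_nonneg (lam j)]⟩
      rw [e, Complex.norm_real, Real.norm_eq_abs, abs_of_nonneg hs0, Complex.ofReal_re,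
        Complex.ofReal_im]
      refine ⟨?_, le_rfl, by linarith, by linarith⟩
      nlinarith
    · have hs := Real.sq_sqrt (sub_nonneg.2 h.le)
      have hs0 := Real.sqrt_nonneg (lam j ^ 2 - k ^ 2)
      rw [e, norm_mul, Complex.norm_I, one_mul, Complex.norm_real, Real.norm_eq_abs,
        abs_of_nonneg hs0, Complex.I_mul_re, Complex.I_mul_im, Complex.ofReal_re,
        Complex.ofReal_im]
      exact ⟨by linarith, hs0, by linarith, by linarith⟩
  obtain ⟨A, hA⟩ := exists_weight_le (Y := Y) (k := k) (ρ := R - Y) hY0.le hk.le (sub_pos.2 hYR)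
  set W : ℤ → ℝ := fun j =>
    (2 * Y * (k + ‖μ j‖) + 1) * Real.exp (-((μ j).im * (R - Y))) with hWd
  have hW0 : ∀ j, 0 ≤ W j := fun j => by positivity
  have hWs : Summable W := by
    refine Summable.of_nonneg_of_le hW0 (fun j => ?_) (hm.summable_inv.mul_left A)
    obtain ⟨-, h2, h3, h4⟩ := hmode j
    rw [← div_eq_mul_inv, le_div_iff₀ (by positivity)]
    refine le_trans ?_ (hA _ h2)
    rw [hWd]
    dsimp only
    rw [mul_right_comm]
    gcongr ?_ * ?_ * _
    nlinarith
  have hS : 0 ≤ ∑' j, W j := tsum_nonneg hW0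
  have hQ : 0 < Real.sqrt (layerConstant B C k) := Real.sqrt_pos.2 (layerConstant_pos hB.le hC.le)
  have hsL : 0 < Real.sqrt L := Real.sqrt_pos.2 hL
  refine ⟨(∑' j, W j) * (Real.sqrt (layerConstant B C k) / Real.sqrt L) + 1, by positivity, ?_⟩
  intro ε hε w w1 w2 w11 w22 cf hc hd1 hd2 hd11 hd22 hc1 hc2 hc11 hc22 heq hp hp1 hout hbd
  subst hD hDbar
  have hw : IsC2Above f w w1 w2 w11 w22 :=
    ⟨hc.mono fun p (h : f p.1 < p.2) => h.le, hc1, hc2, hc11, hc22, hd1, hd2, hd11, hd22⟩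
  obtain ⟨s₀, hs₀, hlayer⟩ := exists_layer_sq_le hf hc hL hper hm.norm_phase hp
    (η := ε ^ 2 / L) (by positivity)
  have hs : 0 < min 1 (min s₀ ((Y - M) / 2) / B) :=
    lt_min one_pos (div_pos (lt_min hs₀ (half_pos (sub_pos.2 hMY))) hB)
  set s := min 1 (min s₀ ((Y - M) / 2) / B) with hsd
  have hBs : B * s ≤ min s₀ ((Y - M) / 2) := by
    have := (le_div_iff₀ hB).1 (min_le_right 1 (min s₀ ((Y - M) / 2) / B))
    rwa [mul_comm]
  obtain ⟨X, X1, X2, X11, X22, Z, Z1, Z2, Z11, Z22, hZ⟩ := hcut f L s hfK hf hper hs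
  have hgc : Continuous fun x => ‖w (x, f x)‖ ^ 2 :=
    (hc.comp_continuous (f := fun x : ℝ => (x, f x)) (by fun_prop) fun x => le_refl (f x)).norm.pow 2
  have hgi : ∫ x in (0 : ℝ)..L, (‖w (x, f x)‖ ^ 2 + ε ^ 2 / L) ≤ 2 * ε ^ 2 := by
    rw [intervalIntegral.integral_add (hgc.intervalIntegrable _ _) intervalIntegrable_const,
      intervalIntegral.integral_const, sub_zero, smul_eq_mul, mul_div_cancel₀ _ hL.ne']
    linarith
  have hmem : ∀ x y, M < y → f x < y := fun x y h => (hfM x).trans_lt h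
  have hcoeff : ∀ j y, M < y → ∫ x in (0 : ℝ)..L, w (x, y) * star (φ j x)
      = cf j * Complex.exp (Complex.I * μ j * y) := fun j y hy =>
    hm.coeff_eq_of_tendsto
      (hw.cont.comp_continuous (f := fun x : ℝ => (x, y)) (by fun_prop) fun x => hmem x y hy)
      (b := fun j => cf j * Complex.exp (Complex.I * μ j * y)) (hout y hy) j
  have hbound : ∀ j, ‖cf j * Complex.exp (Complex.I * μ j * Y)‖
      ≤ (2 * Y * (k + ‖μ j‖) + 1) * (Real.sqrt (layerConstant B C k) * ε) := fun j =>
    hZ.norm_coeff_le hm hf hs (min_le_left _ _) hC.le hB.le hY0 hpos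
      (fun x => by linarith [hfM x, hBs.trans (min_le_right _ _)]) hw
      (fun p h => hp p (le_of_lt h)) hp1 heq (hgc.add continuous_const)
      (fun x => add_nonneg (sq_nonneg _) (by positivity))
      (fun x y h1 h2 => hlayer x y h1.le (by linarith [hBs.trans (min_le_left _ _)])) hε hgi hk.le
      (fun j => (hmode j).1) (fun j => (hmode j).2.1)
      (fun j => Filter.mem_of_superset (Ioi_mem_nhds hMY) fun y hy => hcoeff j y hy) j
  rintro ⟨x, y⟩ - (hy : R ≤ y)
  have hMy : M < y := hR.trans_le hy
  have hsum := hm.hasSum_coeff (g := fun x => w (x, y)) (g1 := fun x => w1 (x, y))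
    (g11 := fun x => w11 (x, y)) (fun x => hd1 (x, y) (hmem x y hMy))
    (fun x => hd11 (x, y) (hmem x y hMy))
    (hc11.comp_continuous (f := fun x : ℝ => (x, y)) (by fun_prop) fun x => hmem x y hMy)
    (fun x => hp (x, y) (hmem x y hMy).le) (fun x => hp1 (x, y) (hmem x y hMy)) x
  have hterm : ∀ j, ‖(∫ t in (0 : ℝ)..L, w (t, y) * star (φ j t)) * φ j x‖
      ≤ W j * (Real.sqrt (layerConstant B C k) / Real.sqrt L * ε) := fun j => by
    have h0 : ‖cf j * Complex.exp (Complex.I * μ j * y)‖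
        = ‖cf j * Complex.exp (Complex.I * μ j * Y)‖ * Real.exp (-((μ j).im * (y - Y))) := by
      rw [norm_mul, norm_mul, norm_exp_I_mul, norm_exp_I_mul, mul_assoc, ← Real.exp_add]
      congr 2
      ring
    have h1 : Real.exp (-((μ j).im * (y - Y))) ≤ Real.exp (-((μ j).im * (R - Y))) :=
      Real.exp_le_exp.2 (neg_le_neg (mul_le_mul_of_nonneg_left (by linarith) (hmode j).2.1))
    rw [hcoeff j y hMy, norm_mul, hm.norm_mode, h0]
    calc _ ≤ (2 * Y * (k + ‖μ j‖) + 1) * (Real.sqrt (layerConstant B C k) * ε)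
          * Real.exp (-((μ j).im * (R - Y))) * (1 / Real.sqrt L) := by
          gcongr
          exact hbound j
      _ = _ := by
          rw [hWd]
          ring
  have hfin := tsum_of_norm_bounded (hWs.mul_right _).hasSum hterm
  rw [hsum.tsum_eq, tsum_mul_right] at hfin
  linarith
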